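/- arXiv:1404.2624 — 2 statements merged into one kernel-verified Lean document; each statement's English description precedes it below -/
import Mathlib

section
/- For every integer N there exist an integer n > N and a set V of n points on the unit sphere S² ⊆ ℝ³ with N(V) = (17/4)n − 6; that is, there are sets of n points on S² with exactly (17/4)n − 6 double-normal pairs for infinitely many values of n. -/
open scoped RealInnerProductSpace Classical

noncomputable section

abbrev Euc (d : ℕ) : Type := EuclideanSpace ℝ (Fin d)

/-- `{p, q}` is a double-normal pair of the finite point set `V`. -/
def IsDNPair {d : ℕ} (V : Finset (Euc d)) (p q : Euc d) : Prop :=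
  p ∈ V ∧ q ∈ V ∧ p ≠ q ∧
    ∀ v ∈ V, 0 ≤ ⟪v - p, q - p⟫ ∧ 0 ≤ ⟪v - q, p - q⟫

/-- `N(V)`: the number of (unordered) double-normal pairs of `V`. -/
def numDN {d : ℕ} (V : Finset (Euc d)) : ℕ :=
  ((V ×ˢ V).filter fun pq => IsDNPair V pq.1 pq.2).card / 2

/-- `{p, q}` is a strict double-normal pair of `V`. -/
def IsStrictDNPair {d : ℕ} (V : Finset (Euc d)) (p q : Euc d) : Prop :=
  IsDNPair V p q ∧
    ∀ v ∈ V, v ≠ p → v ≠ q → 0 < ⟪v - p, q - p⟫ ∧ 0 < ⟪v - q, p - q⟫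

/-- `N'(V)`: the number of (unordered) strict double-normal pairs of `V`. -/
def numStrictDN {d : ℕ} (V : Finset (Euc d)) : ℕ :=
  ((V ×ˢ V).filter fun pq => IsStrictDNPair V pq.1 pq.2).card / 2


abbrev R3 : Type := ℝ × ℝ × ℝ

def gg (v x y : R3) : ℝ :=
  (x.1 - v.1) * (y.1 - v.1) + (x.2.1 - v.2.1) * (y.2.1 - v.2.1) + (x.2.2 - v.2.2) * (y.2.2 - v.2.2)

def Gab (V : Finset R3) (x y : R3) : Prop := ∀ v ∈ V, 0 ≤ gg v x y

def rho (v : R3) : R3 := (v.1, v.2.1, -v.2.2)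

def GP (V : Finset R3) : Finset (R3 × R3) :=
  (V ×ˢ V).filter fun q => q.2 ≠ -q.1 ∧ Gab V q.1 q.2

def sm {ι : Type} (nx : Equiv.Perm ι) (X : ι → ℝ) (i : ι) : ℝ := X i + X (nx i)

def adj {ι : Type} (nx : Equiv.Perm ι) (i j : ι) : Prop := j = i ∨ j = nx i ∨ i = nx j

structure Cfg (ι : Type) [Fintype ι] where
  V : Finset R3
  X : ι → ℝ
  Y : ι → ℝ
  nx : Equiv.Perm ι
  z : ℝ
  hz : 0 < z
  nx1 : ∀ i, nx i ≠ i
  nx2 : ∀ i, nx (nx i) ≠ i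
  sph : ∀ v ∈ V, v.1 ^ 2 + v.2.1 ^ 2 + v.2.2 ^ 2 = 1
  mem : ∀ i, (X i, Y i, z) ∈ V
  rmem : ∀ v ∈ V, rho v ∈ V
  neg : ∀ v ∈ V, -v ∈ V
  hgt : ∀ v ∈ V, z ≤ v.2.2 ∨ v.2.2 ≤ -z
  ronly : ∀ v ∈ V, v.2.2 = z → ∃ i, v = (X i, Y i, z)
  sup : ∀ i, ∀ v ∈ V, sm nx X i * v.1 + sm nx Y i * v.2.1 ≤ sm nx X i * X i + sm nx Y i * Y i
  strict : ∀ i j, j ≠ i → j ≠ nx i →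
    sm nx X i * X j + sm nx Y i * Y j < sm nx X i * X i + sm nx Y i * Y i
  det : ∀ i, 0 < X i * Y (nx i) - X (nx i) * Y i
  nn : ∀ i, 0 ≤ sm nx X i * sm nx X (nx i) + sm nx Y i * sm nx Y (nx i)
  anti : ∀ i, ∃ j, X j = -X i ∧ Y j = -Y i ∧ X (nx j) = -X (nx i) ∧ Y (nx j) = -Y (nx i)
  rgab : ∀ i, Gab V (X i, Y i, z) (X (nx i), Y (nx i), z)
  cross : ∀ v ∈ V, ∀ w ∈ V, 0 < v.2.2 → w.2.2 < 0 → w ≠ -v → Gab V v w →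
    ∃ i j, v = (X i, Y i, z) ∧ w = (X j, Y j, -z) ∧ adj nx i j
  cnt : 2 * (GP V).card + 24 = 17 * V.card

/-- parent -/
def par {ι : Type} (nx : Equiv.Perm ι) (k : ι × Bool) : ι := if k.2 then nx k.1 else k.1

/-- new coordinates -/
def nw {ι : Type} (nx : Equiv.Perm ι) (b : ι → ℝ) (X : ι → ℝ) (k : ι × Bool) : ℝ :=
  X (par nx k) + b k.1 * sm nx X k.1

def nnx {ι : Type} (nx : Equiv.Perm ι) : Equiv.Perm (ι × Bool) where
  toFun k := if k.2 then (nx k.1, false) else (k.1, true)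
  invFun k := if k.2 then (k.1, false) else (nx.symm k.1, true)
  left_inv := by rintro ⟨i, _ | _⟩ <;> simp
  right_inv := by rintro ⟨i, _ | _⟩ <;> simp

section basic
variable {ι : Type} [Fintype ι] (C : Cfg ι)

def Cfg.n2 (i : ι) : ℝ := sm C.nx C.X i ^ 2 + sm C.nx C.Y i ^ 2

/-- dot product of normals -/
def Cfg.nd (i l : ι) : ℝ := sm C.nx C.X i * sm C.nx C.X l + sm C.nx C.Y i * sm C.nx C.Y l

/-- normal dot point -/
def Cfg.np (i j : ι) : ℝ := sm C.nx C.X i * C.X j + sm C.nx C.Y i * C.Y j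

/-- point dot point -/
def Cfg.pp (i j : ι) : ℝ := C.X i * C.X j + C.Y i * C.Y j

theorem Cfg.circ (i : ι) : C.X i ^ 2 + C.Y i ^ 2 = 1 - C.z ^ 2 := by
  have := C.sph _ (C.mem i); simp only at this; linarith

theorem Cfg.edge (i : ι) : C.np i (C.nx i) = C.np i i := by
  have h1 := C.circ i
  have h2 := C.circ (C.nx i)
  unfold Cfg.np sm; linear_combination h2 - h1

theorem Cfg.n2pos (i : ι) : 0 < C.n2 i := by
  have h := C.det i
  unfold Cfg.n2 sm
  by_contra hc
  have h1 : C.X i + C.X (C.nx i) = 0 := by nlinarith [sq_nonneg (C.X i + C.X (C.nx i)), sq_nonneg (C.Y i + C.Y (C.nx i))]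
  have h2 : C.Y i + C.Y (C.nx i) = 0 := by nlinarith [sq_nonneg (C.X i + C.X (C.nx i)), sq_nonneg (C.Y i + C.Y (C.nx i))]
  have : C.X (C.nx i) = - C.X i := by linarith
  have h3 : C.Y (C.nx i) = - C.Y i := by linarith
  rw [this, h3] at h; nlinarith

theorem Cfg.np_half (i : ι) : 2 * C.np i i = C.n2 i := by
  have h1 := C.circ i
  have h2 := C.circ (C.nx i)
  unfold Cfg.np Cfg.n2 sm; linear_combination h1 - h2

theorem Cfg.nd_comm (i l : ι) : C.nd i l = C.nd l i := by unfold Cfg.nd; ring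

theorem Cfg.nd_self (i : ι) : C.nd i i = C.n2 i := by unfold Cfg.nd Cfg.n2; ring

theorem Cfg.nd_eq (i l : ι) : C.nd i l = C.np i l + C.np i (C.nx l) := by
  unfold Cfg.nd Cfg.np; simp only [sm]; ring

theorem Cfg.strict' (i j : ι) (h1 : j ≠ i) (h2 : j ≠ C.nx i) : C.np i j < C.np i i := C.strict i j h1 h2

theorem Cfg.np_le (i j : ι) : C.np i j ≤ C.np i i := C.sup i _ (C.mem j)

theorem Cfg.nd_lt (i : ι) : C.nd i (C.nx i) < C.n2 i := by
  rw [C.nd_eq, C.edge, ← C.np_half]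
  have := C.strict' i (C.nx (C.nx i)) (C.nx2 i) (fun h => C.nx1 _ h)
  linarith

theorem Cfg.nd_lt' (i : ι) : C.nd i (C.nx i) < C.n2 (C.nx i) := by
  rw [C.nd_comm, C.nd_eq, ← C.np_half]
  have := C.strict' (C.nx i) i (fun h => C.nx1 i h.symm) (fun h => C.nx2 _ h.symm)
  linarith

theorem Cfg.inj {i j : ι} (hx : C.X i = C.X j) (hy : C.Y i = C.Y j) : i = j := by
  by_contra h
  by_cases h2 : j = C.nx i
  · subst h2
    have := C.det i
    rw [← hx, ← hy] at this; nlinarith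
  · have := C.strict' i j (fun h' => h h'.symm) h2
    unfold Cfg.np at this
    rw [hx, hy] at this; exact lt_irrefl _ this

theorem Cfg.pp_lt {i j : ι} (h : i ≠ j) : C.pp i j < 1 - C.z ^ 2 := by
  have h1 := C.circ i
  have h2 := C.circ j
  have : C.X i ≠ C.X j ∨ C.Y i ≠ C.Y j := by
    by_contra hc; push Not at hc; exact h (C.inj hc.1 hc.2)
  unfold Cfg.pp
  rcases this with h | h
  · have := sq_pos_of_ne_zero (sub_ne_zero.2 h)
    nlinarith [sq_nonneg (C.Y i - C.Y j)]
  · have := sq_pos_of_ne_zero (sub_ne_zero.2 h)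
    nlinarith [sq_nonneg (C.X i - C.X j)]

theorem Cfg.z1 [Nonempty ι] : C.z < 1 := by
  obtain ⟨i⟩ := ‹Nonempty ι›
  have h := C.circ i
  have hd := C.det i
  have := C.hz
  by_contra hc
  have hx : C.X i = 0 := by nlinarith [sq_nonneg (C.X i), sq_nonneg (C.Y i)]
  have hy : C.Y i = 0 := by nlinarith [sq_nonneg (C.X i), sq_nonneg (C.Y i)]
  rw [hx, hy] at hd; simp at hd

/-- determinant of two adjacent normals -/
def Cfg.dt (i : ι) : ℝ :=
  sm C.nx C.X i * sm C.nx C.Y (C.nx i) - sm C.nx C.X (C.nx i) * sm C.nx C.Y i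

def Cfg.dd (i : ι) : ℝ := C.X i * C.Y (C.nx i) - C.X (C.nx i) * C.Y i

structure RExt where
  z' : ℝ
  b : ι → ℝ
  hz' : 0 < z'
  hzz : z' < C.z
  bpos : ∀ i, 0 < b i
  beq : ∀ i, b i * (1 + b i) * C.n2 i = C.z ^ 2 - z' ^ 2
  bcong : ∀ i j, C.n2 i = C.n2 j → b i = b j
  s1 : ∀ i j l, j ≠ i → j ≠ C.nx i → C.np i j + b l * C.nd i l < C.np i i
  s2 : ∀ i, b (C.nx i) * C.nd i (C.nx i) < b i * C.n2 i
  s2' : ∀ i, b i * C.nd i (C.nx i) < b (C.nx i) * C.n2 (C.nx i)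
  s3 : ∀ i j l, j ≠ C.nx i →
    2 * C.pp (C.nx i) j + 2 * b l * C.np l (C.nx i) + b i * (C.np i j + b l * C.nd i l)
      + b (C.nx i) * (C.np (C.nx i) j + b l * C.nd (C.nx i) l)
    < 2 * (1 - C.z ^ 2) + 2 * b i * C.np i (C.nx i) + b i * (C.np i (C.nx i) + b i * C.nd i i)
      + b (C.nx i) * (C.np (C.nx i) (C.nx i) + b i * C.nd (C.nx i) i)
  s4 : ∀ i, 0 < C.dd (C.nx i) + b i * C.dt i
  s5 : ∀ i l q j j', 0 < C.pp j' j - C.pp j' q - C.pp q j + C.pp q q →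
    0 ≤ C.pp j' j - C.pp j' q - C.pp q j + C.pp q q
      + (b i * (C.np i j - C.np i q) - b l * (C.np l j - C.np l q))
      - (b l * (C.np l j' - C.np l q)) - (b i * b l * C.nd i l - b l * b l * C.n2 l)

end basic

section ext
open Filter Topology
variable {ι : Type} [Fintype ι] (C : Cfg ι)

theorem ev_pos {F : ℝ → ℝ} (hF : ContinuousAt F 0) (h0 : 0 < F 0) : ∀ᶠ s in 𝓝[>] (0:ℝ), 0 < F s :=
  (hF.eventually (lt_mem_nhds h0)).filter_mono nhdsWithin_le_nhds

def bb (s n : ℝ) : ℝ := (Real.sqrt (1 + 4 * s / n) - 1) / 2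

theorem bb_cont (n : ℝ) : Continuous fun s => bb s n := by unfold bb; fun_prop

theorem bb_zero (n : ℝ) : bb 0 n = 0 := by simp [bb]

theorem exists_ext [Nonempty ι] : Nonempty (RExt C) := by
  have cb : ∀ n, ContinuousAt (fun s => bb s n) 0 := fun n => (bb_cont n).continuousAt
  have e0 : ∀ᶠ s in 𝓝[>] (0:ℝ), 0 < s := eventually_mem_nhdsWithin
  have ez : ∀ᶠ s in 𝓝[>] (0:ℝ), 0 < C.z ^ 2 - s :=
    ev_pos (by fun_prop) (by simpa using pow_pos C.hz 2)
  have e1 : ∀ᶠ s in 𝓝[>] (0:ℝ), ∀ i j l, j ≠ i → j ≠ C.nx i →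
      0 < C.np i i - (C.np i j + bb s (C.n2 l) * C.nd i l) := by
    simp only [eventually_all]
    intro i j l h1 h2
    apply ev_pos
    · have := cb (C.n2 l); fun_prop
    · have := C.strict' i j h1 h2
      simp only [bb_zero]; linarith
  have e2 : ∀ᶠ s in 𝓝[>] (0:ℝ), ∀ i,
      0 < C.n2 (C.nx i) * (1 + bb s (C.n2 (C.nx i))) - C.nd i (C.nx i) * (1 + bb s (C.n2 i)) := by
    simp only [eventually_all]
    intro i
    apply ev_pos
    · have := cb (C.n2 i); have := cb (C.n2 (C.nx i)); fun_prop
    · have := C.nd_lt' i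
      simp only [bb_zero]; linarith
  have e2' : ∀ᶠ s in 𝓝[>] (0:ℝ), ∀ i,
      0 < C.n2 i * (1 + bb s (C.n2 i)) - C.nd i (C.nx i) * (1 + bb s (C.n2 (C.nx i))) := by
    simp only [eventually_all]
    intro i
    apply ev_pos
    · have := cb (C.n2 i); have := cb (C.n2 (C.nx i)); fun_prop
    · have := C.nd_lt i
      simp only [bb_zero]; linarith
  have e3 : ∀ᶠ s in 𝓝[>] (0:ℝ), ∀ i j l, j ≠ C.nx i →
     0 < (2 * (1 - C.z ^ 2) + 2 * bb s (C.n2 i) * C.np i (C.nx i) + bb s (C.n2 i) * (C.np i (C.nx i) + bb s (C.n2 i) * C.nd i i)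
      + bb s (C.n2 (C.nx i)) * (C.np (C.nx i) (C.nx i) + bb s (C.n2 i) * C.nd (C.nx i) i)) -
      (2 * C.pp (C.nx i) j + 2 * bb s (C.n2 l) * C.np l (C.nx i) + bb s (C.n2 i) * (C.np i j + bb s (C.n2 l) * C.nd i l)
      + bb s (C.n2 (C.nx i)) * (C.np (C.nx i) j + bb s (C.n2 l) * C.nd (C.nx i) l)) := by
    simp only [eventually_all]
    intro i j l h
    apply ev_pos
    · have := cb (C.n2 i); have := cb (C.n2 (C.nx i)); have := cb (C.n2 l); fun_prop
    · have := C.pp_lt (fun h' => h h'.symm : C.nx i ≠ j)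
      simp only [bb_zero]; linarith
  have e4 : ∀ᶠ s in 𝓝[>] (0:ℝ), ∀ i, 0 < C.dd (C.nx i) + bb s (C.n2 i) * C.dt i := by
    simp only [eventually_all]
    intro i
    apply ev_pos
    · have := cb (C.n2 i); fun_prop
    · have : 0 < C.dd (C.nx i) := C.det (C.nx i)
      simp only [bb_zero]; linarith
  have e5 : ∀ᶠ s in 𝓝[>] (0:ℝ), ∀ i l q j j', 0 < C.pp j' j - C.pp j' q - C.pp q j + C.pp q q →
    0 < C.pp j' j - C.pp j' q - C.pp q j + C.pp q q
      + (bb s (C.n2 i) * (C.np i j - C.np i q) - bb s (C.n2 l) * (C.np l j - C.np l q))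
      - (bb s (C.n2 l) * (C.np l j' - C.np l q)) - (bb s (C.n2 i) * bb s (C.n2 l) * C.nd i l - bb s (C.n2 l) * bb s (C.n2 l) * C.n2 l) := by
    simp only [eventually_all]
    intro i l q j j' h
    apply ev_pos
    · have := cb (C.n2 i); have := cb (C.n2 l); fun_prop
    · simp only [bb_zero]; linarith
  obtain ⟨s, h0, hz, h1, h2, h2', h3, h4, h5⟩ :=
    (e0.and (ez.and (e1.and (e2.and (e2'.and (e3.and (e4.and e5))))))).exists
  have hb : ∀ i, 0 < bb s (C.n2 i) := by
    intro i
    have hn := C.n2pos i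
    have : 1 < Real.sqrt (1 + 4 * s / C.n2 i) := by
      rw [Real.lt_sqrt (by norm_num)]
      have : 0 < 4 * s / C.n2 i := by positivity
      linarith
    unfold bb; linarith
  have hq : ∀ i, bb s (C.n2 i) * (1 + bb s (C.n2 i)) * C.n2 i = s := by
    intro i
    have hn := C.n2pos i
    have hp : 0 < 4 * s / C.n2 i := by positivity
    have := Real.sq_sqrt (show 0 ≤ 1 + 4 * s / C.n2 i by linarith)
    have e : bb s (C.n2 i) * (1 + bb s (C.n2 i)) = s / C.n2 i := by
      unfold bb
      linear_combination this / 4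
    rw [e]; field_simp
  have hzs := Real.sq_sqrt hz.le
  refine ⟨⟨Real.sqrt (C.z ^ 2 - s), fun i => bb s (C.n2 i), Real.sqrt_pos.2 hz, ?_, hb, ?_, ?_, ?_, ?_, ?_, ?_, h4, ?_⟩⟩
  · rw [Real.sqrt_lt' C.hz]; linarith
  · intro i; rw [hzs, hq]; ring
  · intro i j h; simp only [h]
  · intro i j l a c; linarith [h1 i j l a c]
  · intro i
    have a := hb i
    have c := hb (C.nx i)
    have k := h2 i
    have q1 := hq i
    have q2 := hq (C.nx i)
    have : 0 < bb s (C.n2 (C.nx i)) * (C.n2 (C.nx i) * (1 + bb s (C.n2 (C.nx i))) - C.nd i (C.nx i) * (1 + bb s (C.n2 i))) := by positivity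
    have : 0 < (1 + bb s (C.n2 i)) * (bb s (C.n2 i) * C.n2 i - bb s (C.n2 (C.nx i)) * C.nd i (C.nx i)) := by
      nlinarith
    have := pos_of_mul_pos_right this (by linarith)
    linarith
  · intro i
    have a := hb i
    have c := hb (C.nx i)
    have k := h2' i
    have q1 := hq i
    have q2 := hq (C.nx i)
    have : 0 < bb s (C.n2 i) * (C.n2 i * (1 + bb s (C.n2 i)) - C.nd i (C.nx i) * (1 + bb s (C.n2 (C.nx i)))) := by positivity
    have : 0 < (1 + bb s (C.n2 (C.nx i))) * (bb s (C.n2 (C.nx i)) * C.n2 (C.nx i) - bb s (C.n2 i) * C.nd i (C.nx i)) := by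
      nlinarith
    have := pos_of_mul_pos_right this (by linarith)
    linarith
  · intro i j l a; linarith [h3 i j l a]
  · intro i l q j j' a; exact (h5 i l q j j' a).le

end ext

set_option linter.unusedSectionVars false

section step
variable {ι : Type} [Fintype ι] {C : Cfg ι} (E : RExt C)

def RExt.NX (k : ι × Bool) : ℝ := nw C.nx E.b C.X k
def RExt.NY (k : ι × Bool) : ℝ := nw C.nx E.b C.Y k

theorem smF (nx : Equiv.Perm ι) (b X : ι → ℝ) (i : ι) :
    sm (nnx nx) (nw nx b X) (i, false) = (1 + 2 * b i) * sm nx X i := by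
  simp [sm, nnx, nw, par]; ring

theorem smT (nx : Equiv.Perm ι) (b X : ι → ℝ) (i : ι) :
    sm (nnx nx) (nw nx b X) (i, true) =
      2 * X (nx i) + b i * sm nx X i + b (nx i) * sm nx X (nx i) := by
  simp [sm, nnx, nw, par]; ring

theorem Cfg.npe (i j : ι) (h : j = i ∨ j = C.nx i) : C.np i j = C.np i i := by
  rcases h with rfl | rfl
  · rfl
  · exact C.edge i

theorem par_or (k : ι × Bool) : par C.nx k = k.1 ∨ par C.nx k = C.nx k.1 := by
  rcases k with ⟨i, _ | _⟩ <;> simp [par]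

theorem Cfg.cone {v : R3} (hv : v ∈ C.V) {i j : ι} (h : j = i ∨ j = C.nx i) :
    sm C.nx C.X i * (v.1 - C.X j) + sm C.nx C.Y i * (v.2.1 - C.Y j) ≤ 0 := by
  have h1 := C.sup i v hv
  have h2 := C.npe i j h
  unfold Cfg.np at h2
  linarith

theorem Cfg.pv {v : R3} (hv : v ∈ C.V) (i : ι) : C.X i * v.1 + C.Y i * v.2.1 ≤ 1 - C.z ^ 2 := by
  have h1 := C.sph v hv
  have h2 := C.circ i
  have : C.z ^ 2 ≤ v.2.2 ^ 2 := by
    have := C.hz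
    rcases C.hgt v hv with h | h <;> nlinarith
  nlinarith [sq_nonneg (C.X i - v.1), sq_nonneg (C.Y i - v.2.1)]

theorem RExt.npn (i : ι) (k : ι × Bool) :
    sm C.nx C.X i * E.NX k + sm C.nx C.Y i * E.NY k = C.np i (par C.nx k) + E.b k.1 * C.nd i k.1 := by
  unfold RExt.NX RExt.NY nw Cfg.np Cfg.nd; ring

theorem RExt.circ (k : ι × Bool) : E.NX k ^ 2 + E.NY k ^ 2 = 1 - E.z' ^ 2 := by
  have h1 := C.circ (par C.nx k)
  have h2 := C.npe k.1 _ (par_or k)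
  have h3 := C.np_half k.1
  have h4 := E.beq k.1
  have : E.NX k ^ 2 + E.NY k ^ 2 = C.X (par C.nx k) ^ 2 + C.Y (par C.nx k) ^ 2 +
      2 * E.b k.1 * C.np k.1 (par C.nx k) + E.b k.1 ^ 2 * C.n2 k.1 := by
    unfold RExt.NX RExt.NY nw Cfg.np Cfg.n2; ring
  rw [this, h1, h2]
  linear_combination h4 + E.b k.1 * h3

theorem RExt.s2g {i l : ι} (h : l = C.nx i ∨ i = C.nx l) : E.b l * C.nd i l < E.b i * C.n2 i := by
  rcases h with rfl | rfl
  · exact E.s2 i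
  · rw [C.nd_comm]; exact E.s2' l

theorem RExt.strictN (k w : ι × Bool) (h1 : w ≠ k) (h2 : w ≠ nnx C.nx k) :
    sm (nnx C.nx) E.NX k * E.NX w + sm (nnx C.nx) E.NY k * E.NY w <
    sm (nnx C.nx) E.NX k * E.NX k + sm (nnx C.nx) E.NY k * E.NY k := by
  rcases k with ⟨i, _ | _⟩
  · have hb := E.bpos i
    have key : C.np i (par C.nx w) + E.b w.1 * C.nd i w.1 < C.np i i + E.b i * C.n2 i := by
      have hn := C.n2pos i
      rcases w with ⟨l, _ | _⟩
      · by_cases hl : l = C.nx i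
        · subst hl
          have := E.s2 i
          have := C.edge i
          simp only [par]; simp; linarith
        · have hli : l ≠ i := by rintro rfl; exact h1 rfl
          have := E.s1 i l l hli hl
          simp only [par]; simp; nlinarith
      · by_cases hl : C.nx l = i
        · have := E.s2g (i := i) (l := l) (Or.inr hl.symm)
          simp only [par]; simp [hl]; linarith
        · have hli : C.nx l ≠ C.nx i := by
            intro h
            have := C.nx.injective h
            subst this; exact h2 (by simp [nnx])
          have := E.s1 i (C.nx l) l hl hli
          simp only [par]; simp; nlinarith
    have e1 := E.npn i w
    have e2 := E.npn i (i, false)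
    simp only [par, C.nd_self] at e2; simp at e2
    have f1 : sm (nnx C.nx) E.NX (i, false) = _ := smF C.nx E.b C.X i
    have f2 : sm (nnx C.nx) E.NY (i, false) = _ := smF C.nx E.b C.Y i
    rw [f1, f2]
    nlinarith
  · have hj : par C.nx w ≠ C.nx i := by
      intro h
      rcases w with ⟨l, _ | _⟩
      · simp [par] at h; subst h; exact h2 (by simp [nnx])
      · simp [par] at h; subst h; exact h1 rfl
    have s3 := E.s3 i (par C.nx w) w.1 hj
    have f1 : sm (nnx C.nx) E.NX (i, true) = _ := smT C.nx E.b C.X i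
    have f2 : sm (nnx C.nx) E.NY (i, true) = _ := smT C.nx E.b C.Y i
    have hc := C.circ (C.nx i)
    rw [f1, f2]
    have ex : ∀ k', (2 * C.X (C.nx i) + E.b i * sm C.nx C.X i + E.b (C.nx i) * sm C.nx C.X (C.nx i)) * E.NX k' +
        (2 * C.Y (C.nx i) + E.b i * sm C.nx C.Y i + E.b (C.nx i) * sm C.nx C.Y (C.nx i)) * E.NY k' =
        2 * C.pp (C.nx i) (par C.nx k') + 2 * E.b k'.1 * C.np k'.1 (C.nx i) +
        E.b i * (C.np i (par C.nx k') + E.b k'.1 * C.nd i k'.1) +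
        E.b (C.nx i) * (C.np (C.nx i) (par C.nx k') + E.b k'.1 * C.nd (C.nx i) k'.1) := by
      intro k'
      rw [← E.npn, ← E.npn]
      unfold RExt.NX RExt.NY nw Cfg.np Cfg.pp; ring
    rw [ex, ex]
    refine lt_of_lt_of_eq s3 ?_
    have : C.pp (C.nx i) (C.nx i) = 1 - C.z ^ 2 := by rw [← hc]; unfold Cfg.pp; ring
    simp [par, this]

theorem RExt.eqN (k : ι × Bool) :
    sm (nnx C.nx) E.NX k * E.NX (nnx C.nx k) + sm (nnx C.nx) E.NY k * E.NY (nnx C.nx k) =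
    sm (nnx C.nx) E.NX k * E.NX k + sm (nnx C.nx) E.NY k * E.NY k := by
  have h1 := E.circ k
  have h2 := E.circ (nnx C.nx k)
  unfold sm; linear_combination h2 - h1

theorem RExt.supNN (k w : ι × Bool) :
    sm (nnx C.nx) E.NX k * E.NX w + sm (nnx C.nx) E.NY k * E.NY w ≤
    sm (nnx C.nx) E.NX k * E.NX k + sm (nnx C.nx) E.NY k * E.NY k := by
  by_cases h1 : w = k
  · rw [h1]
  by_cases h2 : w = nnx C.nx k
  · rw [h2, E.eqN]
  exact (E.strictN k w h1 h2).le

theorem Cfg.nn' (i : ι) : 0 ≤ C.nd i (C.nx i) := C.nn i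

theorem RExt.supNV (k : ι × Bool) {v : R3} (hv : v ∈ C.V) :
    sm (nnx C.nx) E.NX k * v.1 + sm (nnx C.nx) E.NY k * v.2.1 ≤
    sm (nnx C.nx) E.NX k * E.NX k + sm (nnx C.nx) E.NY k * E.NY k := by
  rcases k with ⟨i, _ | _⟩
  · have hb := E.bpos i
    have hn := C.n2pos i
    have e2 := E.npn i (i, false)
    simp only [par, C.nd_self] at e2; simp at e2
    have f1 : sm (nnx C.nx) E.NX (i, false) = _ := smF C.nx E.b C.X i
    have f2 : sm (nnx C.nx) E.NY (i, false) = _ := smF C.nx E.b C.Y i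
    have h := C.sup i v hv
    have h' : sm C.nx C.X i * v.1 + sm C.nx C.Y i * v.2.1 ≤ C.np i i := h
    rw [f1, f2]
    have : 0 < E.b i * C.n2 i := by positivity
    nlinarith
  · have f1 : sm (nnx C.nx) E.NX (i, true) = _ := smT C.nx E.b C.X i
    have f2 : sm (nnx C.nx) E.NY (i, true) = _ := smT C.nx E.b C.Y i
    have hb := E.bpos i
    have hb2 := E.bpos (C.nx i)
    have hn := C.n2pos i
    have e1 := C.edge i
    have e2 := C.np_half i
    have h1 : sm C.nx C.X i * v.1 + sm C.nx C.Y i * v.2.1 ≤ C.np i i := C.sup i v hv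
    have h2 : sm C.nx C.X (C.nx i) * v.1 + sm C.nx C.Y (C.nx i) * v.2.1 ≤ C.np (C.nx i) (C.nx i) := C.sup (C.nx i) v hv
    have h3 := C.pv hv (C.nx i)
    have hc := C.circ (C.nx i)
    have hnn := C.nn' i
    rw [f1, f2]
    have ex : (2 * C.X (C.nx i) + E.b i * sm C.nx C.X i + E.b (C.nx i) * sm C.nx C.X (C.nx i)) * E.NX (i, true) +
        (2 * C.Y (C.nx i) + E.b i * sm C.nx C.Y i + E.b (C.nx i) * sm C.nx C.Y (C.nx i)) * E.NY (i, true) =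
        2 * (1 - C.z ^ 2) + 3 * E.b i * C.np i (C.nx i) + E.b i ^ 2 * C.n2 i +
          E.b (C.nx i) * C.np (C.nx i) (C.nx i) + E.b (C.nx i) * E.b i * C.nd i (C.nx i) := by
      rw [← hc]
      unfold RExt.NX RExt.NY nw Cfg.np Cfg.nd Cfg.n2; simp [par]; ring
    rw [ex, e1]
    have k1 := mul_le_mul_of_nonneg_left h1 hb.le
    have k2 := mul_le_mul_of_nonneg_left h2 hb2.le
    have k3 : 0 ≤ E.b (C.nx i) * E.b i * C.nd i (C.nx i) := by positivity
    have k4 : 0 ≤ E.b i ^ 2 * C.n2 i := by positivity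
    have k5 : 0 ≤ E.b i * C.np i i := by
      have : 0 < C.np i i := by linarith
      positivity
    nlinarith

theorem RExt.detN (k : ι × Bool) : 0 < E.NX k * E.NY (nnx C.nx k) - E.NX (nnx C.nx k) * E.NY k := by
  rcases k with ⟨i, _ | _⟩
  · have hb := E.bpos i
    have h := C.det i
    have : E.NX (i, false) * E.NY (nnx C.nx (i, false)) - E.NX (nnx C.nx (i, false)) * E.NY (i, false) =
      (1 + 2 * E.b i) * (C.X i * C.Y (C.nx i) - C.X (C.nx i) * C.Y i) := by
      simp [nnx, RExt.NX, RExt.NY, nw, par, sm]; ring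
    rw [this]; positivity
  · have hb := E.bpos i
    have hb2 := E.bpos (C.nx i)
    have h := C.det i
    have h4 := E.s4 i
    have : E.NX (i, true) * E.NY (nnx C.nx (i, true)) - E.NX (nnx C.nx (i, true)) * E.NY (i, true) =
      E.b (C.nx i) * (C.dd (C.nx i) + E.b i * C.dt i) + E.b i * (C.X i * C.Y (C.nx i) - C.X (C.nx i) * C.Y i) := by
      simp [nnx, RExt.NX, RExt.NY, nw, par, sm, Cfg.dd, Cfg.dt]; ring
    rw [this]; positivity

theorem RExt.nnN (k : ι × Bool) :
    0 ≤ sm (nnx C.nx) E.NX k * sm (nnx C.nx) E.NX (nnx C.nx k) + sm (nnx C.nx) E.NY k * sm (nnx C.nx) E.NY (nnx C.nx k) := by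
  rcases k with ⟨i, _ | _⟩
  · have e : nnx C.nx (i, false) = (i, true) := by simp [nnx]
    have f1 : sm (nnx C.nx) E.NX (i, true) = _ := smT C.nx E.b C.X i
    have f2 : sm (nnx C.nx) E.NY (i, true) = _ := smT C.nx E.b C.Y i
    have f3 : sm (nnx C.nx) E.NX (i, false) = _ := smF C.nx E.b C.X i
    have f4 : sm (nnx C.nx) E.NY (i, false) = _ := smF C.nx E.b C.Y i
    have hb := E.bpos i
    have hb2 := E.bpos (C.nx i)
    have hn := C.n2pos i
    have e1 := C.edge i
    have e2 := C.np_half i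
    have hnn := C.nn' i
    rw [e, f1, f2, f3, f4]
    have : (1 + 2 * E.b i) * sm C.nx C.X i * (2 * C.X (C.nx i) + E.b i * sm C.nx C.X i + E.b (C.nx i) * sm C.nx C.X (C.nx i)) +
      (1 + 2 * E.b i) * sm C.nx C.Y i * (2 * C.Y (C.nx i) + E.b i * sm C.nx C.Y i + E.b (C.nx i) * sm C.nx C.Y (C.nx i))
      = (1 + 2 * E.b i) * (2 * C.np i (C.nx i) + E.b i * C.n2 i + E.b (C.nx i) * C.nd i (C.nx i)) := by
      unfold Cfg.np Cfg.nd Cfg.n2; ring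
    rw [this, e1, e2]; positivity
  · have e : nnx C.nx (i, true) = (C.nx i, false) := by simp [nnx]
    have f1 : sm (nnx C.nx) E.NX (i, true) = _ := smT C.nx E.b C.X i
    have f2 : sm (nnx C.nx) E.NY (i, true) = _ := smT C.nx E.b C.Y i
    have f3 : sm (nnx C.nx) E.NX (C.nx i, false) = _ := smF C.nx E.b C.X (C.nx i)
    have f4 : sm (nnx C.nx) E.NY (C.nx i, false) = _ := smF C.nx E.b C.Y (C.nx i)
    have hb := E.bpos i
    have hb2 := E.bpos (C.nx i)
    have hn := C.n2pos (C.nx i)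
    have e2 := C.np_half (C.nx i)
    have hnn := C.nn' i
    rw [e, f1, f2, f3, f4]
    have : (2 * C.X (C.nx i) + E.b i * sm C.nx C.X i + E.b (C.nx i) * sm C.nx C.X (C.nx i)) * ((1 + 2 * E.b (C.nx i)) * sm C.nx C.X (C.nx i)) +
      (2 * C.Y (C.nx i) + E.b i * sm C.nx C.Y i + E.b (C.nx i) * sm C.nx C.Y (C.nx i)) * ((1 + 2 * E.b (C.nx i)) * sm C.nx C.Y (C.nx i))
      = (1 + 2 * E.b (C.nx i)) * (2 * C.np (C.nx i) (C.nx i) + E.b (C.nx i) * C.n2 (C.nx i) + E.b i * C.nd i (C.nx i)) := by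
      unfold Cfg.np Cfg.nd Cfg.n2; ring
    rw [this, e2]; positivity

theorem RExt.antiN (k : ι × Bool) : ∃ j, E.NX j = -E.NX k ∧ E.NY j = -E.NY k ∧
    E.NX (nnx C.nx j) = -E.NX (nnx C.nx k) ∧ E.NY (nnx C.nx j) = -E.NY (nnx C.nx k) := by
  have aux : ∀ i, ∃ j, (C.X j = -C.X i ∧ C.Y j = -C.Y i ∧ C.X (C.nx j) = -C.X (C.nx i) ∧ C.Y (C.nx j) = -C.Y (C.nx i)) ∧ E.b j = E.b i := by
    intro i
    obtain ⟨j, h1, h2, h3, h4⟩ := C.anti i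
    refine ⟨j, ⟨h1, h2, h3, h4⟩, E.bcong _ _ ?_⟩
    unfold Cfg.n2 sm; rw [h1, h2, h3, h4]; ring
  rcases k with ⟨i, c⟩
  obtain ⟨j, ⟨h1, h2, h3, h4⟩, h5⟩ := aux i
  obtain ⟨m, ⟨g1, g2, g3, g4⟩, g5⟩ := aux (C.nx i)
  have : m = C.nx j := C.inj (by rw [g1, h3]) (by rw [g2, h4])
  subst this
  refine ⟨(j, c), ?_⟩
  cases c
  · simp only [RExt.NX, RExt.NY, nw, par, nnx, sm]
    simp [h1, h2, h3, h4, h5]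
    refine ⟨by ring, by ring, by ring, by ring⟩
  · simp only [RExt.NX, RExt.NY, nw, par, nnx, sm]
    simp [h1, h2, h3, h4, h5, g5, g3, g4]
    refine ⟨by ring, by ring, by ring, by ring⟩

theorem RExt.injN {i j : ι × Bool} (hx : E.NX i = E.NX j) (hy : E.NY i = E.NY j) : i = j := by
  by_contra h
  by_cases h2 : j = nnx C.nx i
  · subst h2
    have := E.detN i
    rw [← hx, ← hy] at this; nlinarith
  · have := E.strictN i j (fun h' => h h'.symm) h2
    rw [hx, hy] at this; exact lt_irrefl _ this

set_option maxHeartbeats 1000000 in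
/-- Thales -/
theorem RExt.thales (k l : ι × Bool) (h0 : ¬ adj (nnx C.nx) k l)
    (h : ∀ m, 0 ≤ (E.NX k - E.NX m) * (E.NX l - E.NX m) + (E.NY k - E.NY m) * (E.NY l - E.NY m)) :
    E.NX l = - E.NX k ∧ E.NY l = - E.NY k := by
  obtain ⟨m, rfl⟩ := (nnx C.nx).surjective k
  unfold adj at h0; push Not at h0
  obtain ⟨n1, n2, n3⟩ := h0
  have n4 : l ≠ m := fun h => n3 (by rw [h])
  have a1 := E.strictN _ l n1 n2
  have a2 := E.strictN m l n4 n1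
  have q1 := h (nnx C.nx (nnx C.nx m))
  have q2 := h m
  have d1 := E.detN m
  have d2 := E.detN (nnx C.nx m)
  have c0 := E.circ m
  have c1 := E.circ (nnx C.nx m)
  have c2 := E.circ (nnx C.nx (nnx C.nx m))
  have c3 := E.circ l
  have e2 := E.eqN m
  unfold sm at a1 a2 e2
  generalize E.NX (nnx C.nx (nnx C.nx m)) = px at *
  generalize E.NY (nnx C.nx (nnx C.nx m)) = py at *
  generalize E.NX (nnx C.nx m) = ux at *
  generalize E.NY (nnx C.nx m) = uy at *
  generalize E.NX m = mx at *
  generalize E.NY m = my at *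
  generalize E.NX l = wx at *
  generalize E.NY l = wy at *
  -- d = w - u, s = w + u
  have b1 : (ux + px) * (wx - ux) + (uy + py) * (wy - uy) < 0 := by linarith
  have b2 : (mx + ux) * (wx - ux) + (my + uy) * (wy - uy) < 0 := by linarith
  have t1 : (px - ux) * (wx + ux) + (py - uy) * (wy + uy) ≤ 0 := by nlinarith
  have t2 : 0 ≤ (ux - mx) * (wx + ux) + (uy - my) * (wy + uy) := by nlinarith
  have i1 : ((ux + px) ^ 2 + (uy + py) ^ 2) * ((px - ux) * (wx + ux) + (py - uy) * (wy + uy)) =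
      2 * (ux * py - px * uy) * ((ux + px) * (wy + uy) - (uy + py) * (wx + ux)) := by
    linear_combination ((ux + px) * (wx + ux) + (uy + py) * (wy + uy)) * (c2 - c1)
  have i2 : ((mx + ux) ^ 2 + (my + uy) ^ 2) * ((ux - mx) * (wx + ux) + (uy - my) * (wy + uy)) =
      2 * (mx * uy - ux * my) * ((mx + ux) * (wy + uy) - (my + uy) * (wx + ux)) := by
    linear_combination ((mx + ux) * (wx + ux) + (my + uy) * (wy + uy)) * (c1 - c0)
  have j1 : (ux + px) * (wy + uy) - (uy + py) * (wx + ux) ≤ 0 := by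
    by_contra hc; push Not at hc
    have : 0 < 2 * (ux * py - px * uy) * ((ux + px) * (wy + uy) - (uy + py) * (wx + ux)) := by positivity
    rw [← i1] at this
    have : ((ux + px) ^ 2 + (uy + py) ^ 2) * ((px - ux) * (wx + ux) + (py - uy) * (wy + uy)) ≤ 0 :=
      mul_nonpos_of_nonneg_of_nonpos (by positivity) t1
    linarith
  have j2 : 0 ≤ (mx + ux) * (wy + uy) - (my + uy) * (wx + ux) := by
    by_contra hc; push Not at hc
    have : 2 * (mx * uy - ux * my) * ((mx + ux) * (wy + uy) - (my + uy) * (wx + ux)) < 0 :=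
      mul_neg_of_pos_of_neg (by linarith) hc
    rw [← i2] at this
    have : 0 ≤ ((mx + ux) ^ 2 + (my + uy) ^ 2) * ((ux - mx) * (wx + ux) + (uy - my) * (wy + uy)) :=
      mul_nonneg (by positivity) t2
    linarith
  -- lambda * |d|^2 = la
  have orth : (wx + ux) * (wx - ux) + (wy + uy) * (wy - uy) = 0 := by linear_combination c3 - c1
  set la := (wy + uy) * (wx - ux) - (wx + ux) * (wy - uy) with hla
  set dd := (wx - ux) ^ 2 + (wy - uy) ^ 2 with hdd
  have k1 : dd * ((ux + px) * (wy + uy) - (uy + py) * (wx + ux)) = la * ((ux + px) * (wx - ux) + (uy + py) * (wy - uy)) := by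
    rw [hla, hdd]; linear_combination ((ux + px) * (wy - uy) - (uy + py) * (wx - ux)) * orth
  have k2 : dd * ((mx + ux) * (wy + uy) - (my + uy) * (wx + ux)) = la * ((mx + ux) * (wx - ux) + (my + uy) * (wy - uy)) := by
    rw [hla, hdd]; linear_combination ((mx + ux) * (wy - uy) - (my + uy) * (wx - ux)) * orth
  have hd0 : 0 ≤ dd := by positivity
  have l1 : 0 ≤ la := by
    by_contra hc; push Not at hc
    have := mul_pos_of_neg_of_neg hc b1
    have := mul_nonpos_of_nonneg_of_nonpos hd0 j1
    linarith
  have l2 : la ≤ 0 := by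
    by_contra hc; push Not at hc
    have := mul_neg_of_pos_of_neg hc b2
    have := mul_nonneg hd0 j2
    linarith
  have l0 : la = 0 := le_antisymm l2 l1
  have hdp : 0 < dd := by
    rcases hd0.lt_or_eq with h | h
    · exact h
    · exfalso
      have x1 : wx - ux = 0 := pow_eq_zero_iff two_ne_zero |>.1 (by linarith [sq_nonneg (wx - ux), sq_nonneg (wy - uy)])
      have x2 : wy - uy = 0 := pow_eq_zero_iff two_ne_zero |>.1 (by linarith [sq_nonneg (wx - ux), sq_nonneg (wy - uy)])
      rw [x1, x2] at b1; simp at b1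
  have sx : dd * (wx + ux) = 0 := by
    rw [hdd]; linear_combination (wx - ux) * orth - (wy - uy) * l0 + (wy - uy) * hla
  have sy : dd * (wy + uy) = 0 := by
    rw [hdd]; linear_combination (wy - uy) * orth + (wx - ux) * l0 - (wx - ux) * hla
  have sx' := (mul_eq_zero.1 sx).resolve_left hdp.ne'
  have sy' := (mul_eq_zero.1 sy).resolve_left hdp.ne'
  constructor <;> linarith

end step
set_option linter.unusedSectionVars false

theorem gg_comm (v x y : R3) : gg v x y = gg v y x := by unfold gg; ring

theorem gg_rho (v x y : R3) : gg (rho v) (rho x) (rho y) = gg v x y := by unfold gg rho; ring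

theorem rho_rho (v : R3) : rho (rho v) = v := by simp [rho]

theorem gab_comm {V : Finset R3} {x y : R3} (h : Gab V x y) : Gab V y x := fun v hv => by
  rw [gg_comm]; exact h v hv

theorem gab_rho {V : Finset R3} (hV : ∀ v ∈ V, rho v ∈ V) {x y : R3} (h : Gab V x y) :
    Gab V (rho x) (rho y) := fun v hv => by
  have := h _ (hV v hv)
  rwa [← gg_rho, rho_rho] at this

theorem gab_up {V : Finset R3} (hV : ∀ v ∈ V, rho v ∈ V) {x y : R3} (hx : 0 < x.2.2) (hy : 0 < y.2.2)
    (h : ∀ v ∈ V, 0 ≤ v.2.2 → 0 ≤ gg v x y) : Gab V x y := by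
  intro v hv
  rcases le_or_gt 0 v.2.2 with h0 | h0
  · exact h v hv h0
  · have := h _ (hV v hv) (by simp [rho]; linarith)
    have e : gg v x y = gg (rho v) x y + 2 * (-v.2.2) * (x.2.2 + y.2.2) := by unfold gg rho; ring
    rw [e]
    have : 0 ≤ 2 * (-v.2.2) * (x.2.2 + y.2.2) := mul_nonneg (by linarith) (by linarith)
    linarith

section step2
variable {ι : Type} [Fintype ι] {C : Cfg ι} (E : RExt C)

def RExt.Q (q : (ι × Bool) × Bool) : R3 := (E.NX q.1, E.NY q.1, if q.2 then E.z' else -E.z')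

def RExt.W : Finset R3 := Finset.univ.image E.Q

def RExt.V' : Finset R3 := C.V ∪ E.W

theorem RExt.QT (k : ι × Bool) : E.Q (k, true) = (E.NX k, E.NY k, E.z') := by simp [RExt.Q]
theorem RExt.QF (k : ι × Bool) : E.Q (k, false) = (E.NX k, E.NY k, -E.z') := by simp [RExt.Q]

theorem RExt.rhoQ (k : ι × Bool) (σ : Bool) : rho (E.Q (k, σ)) = E.Q (k, !σ) := by
  cases σ <;> simp [RExt.Q, rho]

theorem RExt.memW {v : R3} : v ∈ E.W ↔ ∃ k σ, v = E.Q (k, σ) := by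
  unfold RExt.W
  simp only [Finset.mem_image, Finset.mem_univ, true_and, Prod.exists, eq_comm]

theorem RExt.memV' {v : R3} : v ∈ E.V' ↔ v ∈ C.V ∨ ∃ k σ, v = E.Q (k, σ) := by
  unfold RExt.V'; rw [Finset.mem_union, E.memW]

theorem RExt.memQ (k σ) : E.Q (k, σ) ∈ E.V' := E.memV'.2 (Or.inr ⟨k, σ, rfl⟩)

theorem RExt.memC {v : R3} (h : v ∈ C.V) : v ∈ E.V' := E.memV'.2 (Or.inl h)

theorem RExt.rV' : ∀ v ∈ E.V', rho v ∈ E.V' := by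
  intro v hv
  rcases E.memV'.1 hv with h | ⟨k, σ, rfl⟩
  · exact E.memC (C.rmem v h)
  · rw [E.rhoQ]; exact E.memQ _ _

theorem RExt.up {v : R3} (hv : v ∈ E.V') (h : 0 ≤ v.2.2) :
    (v ∈ C.V ∧ C.z ≤ v.2.2) ∨ ∃ k, v = (E.NX k, E.NY k, E.z') := by
  have hz := C.hz
  have hz' := E.hz'
  rcases E.memV'.1 hv with h1 | ⟨k, σ, rfl⟩
  · left; refine ⟨h1, ?_⟩
    rcases C.hgt v h1 with h | h
    · exact h
    · linarith
  · right
    cases σ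
    · rw [E.QF] at h; simp at h; linarith
    · exact ⟨k, E.QT k⟩

theorem RExt.hgt' {v : R3} (hv : v ∈ E.V') : E.z' ≤ v.2.2 ∨ v.2.2 ≤ -E.z' := by
  have := E.hzz
  rcases E.memV'.1 hv with h1 | ⟨k, σ, rfl⟩
  · rcases C.hgt v h1 with h | h
    · left; linarith
    · right; linarith
  · cases σ <;> simp [RExt.Q]

theorem RExt.sph' {v : R3} (hv : v ∈ E.V') : v.1 ^ 2 + v.2.1 ^ 2 + v.2.2 ^ 2 = 1 := by
  rcases E.memV'.1 hv with h1 | ⟨k, σ, rfl⟩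
  · exact C.sph v h1
  · have := E.circ k
    cases σ <;> simp [RExt.Q] <;> linarith

theorem RExt.sup' (k : ι × Bool) {v : R3} (hv : v ∈ E.V') :
    sm (nnx C.nx) E.NX k * v.1 + sm (nnx C.nx) E.NY k * v.2.1 ≤
    sm (nnx C.nx) E.NX k * E.NX k + sm (nnx C.nx) E.NY k * E.NY k := by
  rcases E.memV'.1 hv with h1 | ⟨l, σ, rfl⟩
  · exact E.supNV k h1
  · exact E.supNN k l

/-- inner product of the displacement with v - P_j -/
theorem RExt.coneD {v : R3} (hv : v ∈ C.V) (hz : C.z ≤ v.2.2) {i j : ι} (h : j = i ∨ j = C.nx i) :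
    E.b i * (sm C.nx C.X i * (v.1 - C.X j) + sm C.nx C.Y i * (v.2.1 - C.Y j)) + (E.z' - C.z) * (v.2.2 - C.z) ≤ 0 := by
  have h1 := C.cone hv h
  have h2 := E.bpos i
  have h3 := E.hzz
  have := mul_nonpos_of_nonneg_of_nonpos h2.le h1
  have := mul_nonpos_of_nonpos_of_nonneg (by linarith : E.z' - C.z ≤ 0) (by linarith : 0 ≤ v.2.2 - C.z)
  linarith

theorem RExt.L1 {x y : R3} (hx : x ∈ C.V) (hy : y ∈ C.V) (zx : C.z ≤ x.2.2) (zy : C.z ≤ y.2.2)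
    (h : Gab C.V x y) : Gab E.V' x y := by
  have hz := C.hz
  apply gab_up E.rV' (by linarith) (by linarith)
  intro v hv h0
  rcases E.up hv h0 with ⟨h1, _⟩ | ⟨k, rfl⟩
  · exact h v h1
  · have a := E.coneD hx zx (par_or k)
    have b := E.coneD hy zy (par_or k)
    have c := h _ (C.mem (par C.nx k))
    have d : 0 ≤ (E.b k.1 * sm C.nx C.X k.1) ^ 2 + (E.b k.1 * sm C.nx C.Y k.1) ^ 2 + (E.z' - C.z) ^ 2 := by positivity
    unfold gg at c ⊢
    simp only [RExt.NX, RExt.NY, nw] at c ⊢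
    linarith

theorem RExt.b2 (i : ι) : E.b i ^ 2 * C.n2 i < C.z ^ 2 - E.z' ^ 2 := by
  have := E.beq i
  have h := E.bpos i
  have hn := C.n2pos i
  have : 0 < E.b i * C.n2 i := by positivity
  nlinarith

theorem RExt.L2a (i j : ι) (h : j = i ∨ j = C.nx i) : gg (E.NX (i, false), E.NY (i, false), E.z') (C.X i, C.Y i, C.z) (C.X j, C.Y j, -C.z) < 0 := by
  have h1 := E.b2 i
  have h2 := C.npe i j h
  have : gg (E.NX (i, false), E.NY (i, false), E.z') (C.X i, C.Y i, C.z) (C.X j, C.Y j, -C.z) =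
    E.b i ^ 2 * C.n2 i - (C.z ^ 2 - E.z' ^ 2) - E.b i * (C.np i j - C.np i i) := by
    unfold gg Cfg.n2 Cfg.np; simp only [RExt.NX, RExt.NY, nw, par]; simp; ring
  rw [this, h2]; linarith

theorem RExt.L2 (i j : ι) (h : adj C.nx i j) : ¬ Gab E.V' (C.X i, C.Y i, C.z) (C.X j, C.Y j, -C.z) := by
  intro hg
  rcases h with h | h | h
  · exact absurd (hg _ (by rw [← E.QT]; exact E.memQ _ _)) (not_le.2 (E.L2a i j (Or.inl h)))
  · exact absurd (hg _ (by rw [← E.QT]; exact E.memQ _ _)) (not_le.2 (E.L2a i j (Or.inr h)))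
  · have := gab_comm (gab_rho E.rV' hg)
    simp only [rho, neg_neg] at this
    exact absurd (this _ (by rw [← E.QT]; exact E.memQ _ _)) (not_le.2 (E.L2a j i (Or.inr h)))

theorem RExt.L3 {x : R3} (hx : x ∈ C.V) (k : ι × Bool) (h : Gab E.V' (E.NX k, E.NY k, E.z') x) :
    ∃ j, (j = k.1 ∨ j = C.nx k.1) ∧ x = (C.X j, C.Y j, C.z) := by
  have hz := C.hz
  have hz' := E.hz'
  have hzz := E.hzz
  have hb := E.bpos k.1
  set p := par C.nx k with hp
  have c1 := C.cone hx (par_or k)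
  have hpe := C.npe k.1 p (par_or k)
  -- identify
  have ident : ∀ y ∈ C.V, y.2.2 = C.z →
      0 ≤ sm C.nx C.X k.1 * (y.1 - C.X p) + sm C.nx C.Y k.1 * (y.2.1 - C.Y p) →
      ∃ j, (j = k.1 ∨ j = C.nx k.1) ∧ y = (C.X j, C.Y j, C.z) := by
    intro y hy h1 h2
    obtain ⟨j, rfl⟩ := C.ronly y hy h1
    refine ⟨j, ?_, rfl⟩
    by_contra hc; push Not at hc
    have := C.strict' k.1 j hc.1 hc.2
    rw [← hpe] at this
    unfold Cfg.np at this
    simp only at h2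
    linarith
  rcases C.hgt x hx with hu | hl
  · have g1 := h _ (E.memC (C.mem p))
    have e : gg (C.X p, C.Y p, C.z) (E.NX k, E.NY k, E.z') x =
      E.b k.1 * (sm C.nx C.X k.1 * (x.1 - C.X p) + sm C.nx C.Y k.1 * (x.2.1 - C.Y p)) + (E.z' - C.z) * (x.2.2 - C.z) := by
      unfold gg; simp only [RExt.NX, RExt.NY, nw, ← hp]; ring
    rw [e] at g1
    have m1 := mul_nonpos_of_nonneg_of_nonpos hb.le c1
    have m2 := mul_nonpos_of_nonpos_of_nonneg (by linarith : E.z' - C.z ≤ 0) (by linarith : 0 ≤ x.2.2 - C.z)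
    have m3 : (E.z' - C.z) * (x.2.2 - C.z) = 0 := by linarith
    have m4 : x.2.2 = C.z := by
      rcases mul_eq_zero.1 m3 with q | q <;> linarith
    apply ident x hx m4
    have : 0 ≤ E.b k.1 * (sm C.nx C.X k.1 * (x.1 - C.X p) + sm C.nx C.Y k.1 * (x.2.1 - C.Y p)) := by linarith
    exact nonneg_of_mul_nonneg_right this hb
  · exfalso
    have g1 := h _ (E.memC (C.rmem _ (C.mem p)))
    have e : gg (rho (C.X p, C.Y p, C.z)) (E.NX k, E.NY k, E.z') x =
      E.b k.1 * (sm C.nx C.X k.1 * (x.1 - C.X p) + sm C.nx C.Y k.1 * (x.2.1 - C.Y p)) + (E.z' + C.z) * (x.2.2 + C.z) := by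
      unfold gg rho; simp only [RExt.NX, RExt.NY, nw, ← hp]; ring
    rw [e] at g1
    have m1 := mul_nonpos_of_nonneg_of_nonpos hb.le c1
    have m2 := mul_nonpos_of_nonneg_of_nonpos (by linarith : 0 ≤ E.z' + C.z) (by linarith : x.2.2 + C.z ≤ 0)
    have m3 : (E.z' + C.z) * (x.2.2 + C.z) = 0 := by linarith
    have m4 : x.2.2 = -C.z := by
      rcases mul_eq_zero.1 m3 with q | q <;> linarith
    have m5 : 0 ≤ E.b k.1 * (sm C.nx C.X k.1 * (x.1 - C.X p) + sm C.nx C.Y k.1 * (x.2.1 - C.Y p)) := by linarith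
    have m6 := nonneg_of_mul_nonneg_right m5 hb
    have g2 := h _ (E.memQ k false)
    rw [E.QF] at g2
    have e2 : gg (E.NX k, E.NY k, -E.z') (E.NX k, E.NY k, E.z') x = 2 * E.z' * (x.2.2 + E.z') := by
      unfold gg; simp only; ring
    rw [e2, m4] at g2
    have := mul_neg_of_pos_of_neg (by linarith : 0 < 2 * E.z') (by linarith : -C.z + E.z' < 0)
    linarith

theorem RExt.dnn {i l : ι} (h : l = i ∨ l = C.nx i ∨ i = C.nx l) :
    0 ≤ E.b l * (E.b l * C.n2 l - E.b i * C.nd i l) := by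
  apply mul_nonneg (E.bpos l).le
  rcases h with rfl | h | h
  · rw [C.nd_self]; linarith
  · have := E.s2g (i := l) (l := i) (Or.inr h)
    rw [C.nd_comm] at this; linarith
  · have := E.s2g (i := l) (l := i) (Or.inl h)
    rw [C.nd_comm] at this; linarith

theorem RExt.L4 (k : ι × Bool) (j : ι) (hj : j = k.1 ∨ j = C.nx k.1) :
    Gab E.V' (E.NX k, E.NY k, E.z') (C.X j, C.Y j, C.z) := by
  obtain ⟨j', hj'⟩ : ∃ j', j' = par C.nx k := ⟨_, rfl⟩
  have hj2 : j' = k.1 ∨ j' = C.nx k.1 := by rw [hj']; exact par_or k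
  apply gab_up E.rV' E.hz' C.hz
  intro v hv h0
  rcases E.up hv h0 with ⟨h1, hvz⟩ | ⟨w, rfl⟩
  · have c := E.coneD h1 hvz hj
    have base : 0 ≤ gg v (C.X j', C.Y j', C.z) (C.X j, C.Y j, C.z) := by
      rcases hj with r1 | r1 <;> rcases hj2 with r2 | r2 <;> rw [r1, r2]
      · unfold gg; simp only; nlinarith [sq_nonneg (C.X k.1 - v.1), sq_nonneg (C.Y k.1 - v.2.1), sq_nonneg (C.z - v.2.2)]
      · exact gab_comm (C.rgab k.1) v h1
      · exact C.rgab k.1 v h1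
      · unfold gg; simp only; nlinarith [sq_nonneg (C.X (C.nx k.1) - v.1), sq_nonneg (C.Y (C.nx k.1) - v.2.1), sq_nonneg (C.z - v.2.2)]
    have e : gg v (E.NX k, E.NY k, E.z') (C.X j, C.Y j, C.z) = gg v (C.X j', C.Y j', C.z) (C.X j, C.Y j, C.z)
      - (E.b k.1 * (sm C.nx C.X k.1 * (v.1 - C.X j) + sm C.nx C.Y k.1 * (v.2.1 - C.Y j)) + (E.z' - C.z) * (v.2.2 - C.z)) := by
      unfold gg; simp only [RExt.NX, RExt.NY, nw, ← hj']; ring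
    rw [e]; linarith
  · obtain ⟨q, hq⟩ : ∃ q, q = par C.nx w := ⟨_, rfl⟩
    have hq2 : q = w.1 ∨ q = C.nx w.1 := by rw [hq]; exact par_or w
    have e : gg (E.NX w, E.NY w, E.z') (E.NX k, E.NY k, E.z') (C.X j, C.Y j, C.z) =
      C.pp j' j - C.pp j' q - C.pp q j + C.pp q q
      + (E.b k.1 * (C.np k.1 j - C.np k.1 q) - E.b w.1 * (C.np w.1 j - C.np w.1 q))
      - (E.b w.1 * (C.np w.1 j' - C.np w.1 q)) - (E.b k.1 * E.b w.1 * C.nd k.1 w.1 - E.b w.1 * E.b w.1 * C.n2 w.1) := by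
      unfold gg; simp only [RExt.NX, RExt.NY, nw, ← hj', ← hq, Cfg.pp, Cfg.np, Cfg.nd, Cfg.n2]; ring
    rw [e]
    by_cases hp : 0 < C.pp j' j - C.pp j' q - C.pp q j + C.pp q q
    · exact E.s5 _ _ _ _ _ hp
    -- now q = j or q = j'
    have hqq : q = j ∨ q = j' := by
      by_contra hc; push Not at hc
      apply hp
      have self : ∀ a, C.pp a a = 1 - C.z ^ 2 := fun a => by rw [← C.circ a]; unfold Cfg.pp; ring
      have comm : ∀ a b, C.pp a b = C.pp b a := fun a b => by unfold Cfg.pp; ring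
      by_cases hjj : j = j'
      · subst hjj
        have := C.pp_lt hc.1
        rw [self, self, comm j q]; linarith
      · have hs : ¬ (q = k.1) ∧ ¬ (q = C.nx k.1) := by
          rcases hj with r1 | r1 <;> rcases hj2 with r2 | r2 <;> subst r1 <;> subst r2
          · exact absurd rfl hjj
          · exact ⟨hc.1, hc.2⟩
          · exact ⟨hc.2, hc.1⟩
          · exact absurd rfl hjj
        have st := C.strict' k.1 q hs.1 hs.2
        have hne : C.pp j' j = C.pp k.1 (C.nx k.1) ∧ C.pp j' q + C.pp q j = C.np k.1 q := by
          rcases hj with r1 | r1 <;> rcases hj2 with r2 | r2 <;> subst r1 <;> subst r2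
          · exact absurd rfl hjj
          · exact ⟨comm _ _, by unfold Cfg.pp Cfg.np sm; ring⟩
          · exact ⟨rfl, by unfold Cfg.pp Cfg.np sm; ring⟩
          · exact absurd rfl hjj
        have e2 : C.np k.1 k.1 = 1 - C.z ^ 2 + C.pp k.1 (C.nx k.1) := by
          rw [← C.circ k.1]; unfold Cfg.np Cfg.pp sm; ring
        rw [self, hne.1]; linarith [hne.2]
    have hw : w.1 = k.1 ∨ w.1 = C.nx k.1 ∨ k.1 = C.nx w.1 := by
      have hqk : q = k.1 ∨ q = C.nx k.1 := by
        rcases hqq with r | r <;> rw [r] <;> assumption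
      rcases hqk with r | r <;> rcases hq2 with r2 | r2
      · left; rw [← r, ← r2]
      · right; right; rw [← r, ← r2]
      · right; left; rw [← r, ← r2]
      · left; exact C.nx.injective (by rw [← r, ← r2])
    have hd := E.dnn hw
    have hA : C.np k.1 j - C.np k.1 q = 0 := by
      have hqk : q = k.1 ∨ q = C.nx k.1 := by
        rcases hqq with r | r <;> rw [r] <;> assumption
      rw [C.npe _ _ hj, C.npe _ _ hqk]; ring
    have hB : C.np w.1 j - C.np w.1 q ≤ 0 := by rw [C.npe _ _ hq2]; linarith [C.np_le w.1 j]
    have hC : C.np w.1 j' - C.np w.1 q ≤ 0 := by rw [C.npe _ _ hq2]; linarith [C.np_le w.1 j']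
    have hD : C.pp j' j - C.pp j' q - C.pp q j + C.pp q q = 0 := by
      rcases hqq with r | r <;> rw [r] <;> ring
    have hbw := E.bpos w.1
    have m1 := mul_nonpos_of_nonneg_of_nonpos hbw.le hB
    have m2 := mul_nonpos_of_nonneg_of_nonpos hbw.le hC
    rw [hA, hD]
    linarith

theorem RExt.L5 (k l : ι × Bool) (σ : Bool) (hne : E.Q (l, σ) ≠ -E.Q (k, true))
    (h : Gab E.V' (E.Q (k, true)) (E.Q (l, σ))) : adj (nnx C.nx) k l := by
  by_contra hc
  have hz' := E.hz'
  have hzz := E.hzz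
  have th := E.thales k l hc (by
    intro m
    have := h _ (E.memQ m true)
    cases σ
    · simp only [E.QT, E.QF, gg] at this; linarith
    · simp only [E.QT, gg] at this; linarith)
  cases σ
  · apply hne
    rw [E.QT, E.QF, th.1, th.2]; rfl
  · have g := h _ (E.memC (C.mem (par C.nx k)))
    have c1 := E.circ k
    have c2 := C.circ (par C.nx k)
    simp only [E.QT, th.1, th.2, gg] at g
    nlinarith

theorem RExt.L6c (k : ι × Bool) : Gab E.V' (E.NX k, E.NY k, E.z') (E.NX k, E.NY k, -E.z') := by
  intro v hv
  have hz' := E.hz'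
  have : E.z' ^ 2 ≤ v.2.2 ^ 2 := by rcases E.hgt' hv with h | h <;> nlinarith
  unfold gg; simp only
  nlinarith [sq_nonneg (E.NX k - v.1), sq_nonneg (E.NY k - v.2.1)]

theorem RExt.L6b (k : ι × Bool) : Gab E.V' (E.NX k, E.NY k, E.z') (E.NX (nnx C.nx k), E.NY (nnx C.nx k), -E.z') := by
  intro v hv
  have h1 := E.sup' k hv
  have h2 := E.sph' hv
  have h3 := E.circ k
  unfold sm at h1
  unfold gg; simp only
  nlinarith

theorem RExt.L6a (k : ι × Bool) : Gab E.V' (E.NX k, E.NY k, E.z') (E.NX (nnx C.nx k), E.NY (nnx C.nx k), E.z') := by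
  apply gab_up E.rV' E.hz' E.hz'
  intro v hv h0
  rcases E.up hv h0 with ⟨h1, hvz⟩ | ⟨w, rfl⟩
  · rcases k with ⟨i, _ | _⟩
    · have r := C.rgab i v h1
      have a := E.coneD h1 hvz (i := i) (j := i) (Or.inl rfl)
      have b := E.coneD h1 hvz (i := i) (j := C.nx i) (Or.inr rfl)
      have d : 0 ≤ (E.b i * sm C.nx C.X i) ^ 2 + (E.b i * sm C.nx C.Y i) ^ 2 + (E.z' - C.z) ^ 2 := by positivity
      have e : gg v (E.NX (i, false), E.NY (i, false), E.z') (E.NX (nnx C.nx (i, false)), E.NY (nnx C.nx (i, false)), E.z') =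
        gg v (C.X i, C.Y i, C.z) (C.X (C.nx i), C.Y (C.nx i), C.z) -
        (E.b i * (sm C.nx C.X i * (v.1 - C.X i) + sm C.nx C.Y i * (v.2.1 - C.Y i)) + (E.z' - C.z) * (v.2.2 - C.z)) -
        (E.b i * (sm C.nx C.X i * (v.1 - C.X (C.nx i)) + sm C.nx C.Y i * (v.2.1 - C.Y (C.nx i))) + (E.z' - C.z) * (v.2.2 - C.z)) +
        ((E.b i * sm C.nx C.X i) ^ 2 + (E.b i * sm C.nx C.Y i) ^ 2 + (E.z' - C.z) ^ 2) := by
        unfold gg; simp only [RExt.NX, RExt.NY, nw, nnx, par]; simp; ring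
      rw [e]; linarith
    · have a := E.coneD h1 hvz (i := i) (j := C.nx i) (Or.inr rfl)
      have b := E.coneD h1 hvz (i := C.nx i) (j := C.nx i) (Or.inl rfl)
      have hb := E.bpos i
      have hb2 := E.bpos (C.nx i)
      have hnn := C.nn' i
      have d : 0 ≤ (C.X (C.nx i) - v.1) ^ 2 + (C.Y (C.nx i) - v.2.1) ^ 2 + (C.z - v.2.2) ^ 2 +
        E.b i * E.b (C.nx i) * C.nd i (C.nx i) + (E.z' - C.z) ^ 2 := by positivity
      have e : gg v (E.NX (i, true), E.NY (i, true), E.z') (E.NX (nnx C.nx (i, true)), E.NY (nnx C.nx (i, true)), E.z') =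
        ((C.X (C.nx i) - v.1) ^ 2 + (C.Y (C.nx i) - v.2.1) ^ 2 + (C.z - v.2.2) ^ 2 +
        E.b i * E.b (C.nx i) * C.nd i (C.nx i) + (E.z' - C.z) ^ 2) -
        (E.b i * (sm C.nx C.X i * (v.1 - C.X (C.nx i)) + sm C.nx C.Y i * (v.2.1 - C.Y (C.nx i))) + (E.z' - C.z) * (v.2.2 - C.z)) -
        (E.b (C.nx i) * (sm C.nx C.X (C.nx i) * (v.1 - C.X (C.nx i)) + sm C.nx C.Y (C.nx i) * (v.2.1 - C.Y (C.nx i))) + (E.z' - C.z) * (v.2.2 - C.z)) := by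
        unfold gg; simp only [RExt.NX, RExt.NY, nw, nnx, par, Cfg.nd]; simp; ring
      rw [e]; linarith
  · have := E.L6b k _ hv
    unfold gg at this ⊢; simp only at this ⊢
    linarith

theorem RExt.L6 (k l : ι × Bool) (σ : Bool) (h : adj (nnx C.nx) k l) : Gab E.V' (E.Q (k, true)) (E.Q (l, σ)) := by
  rcases h with rfl | rfl | rfl
  · cases σ
    · rw [E.QT, E.QF]; exact E.L6c _
    · intro v _; unfold gg
      have := mul_self_nonneg ((E.Q (l, true)).1 - v.1)
      have := mul_self_nonneg ((E.Q (l, true)).2.1 - v.2.1)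
      have := mul_self_nonneg ((E.Q (l, true)).2.2 - v.2.2)
      linarith
  · cases σ
    · rw [E.QT, E.QF]; exact E.L6b _
    · rw [E.QT, E.QT]; exact E.L6a _
  · cases σ
    · have := gab_comm (gab_rho E.rV' (E.L6b l))
      simpa [rho, E.QT, E.QF] using this
    · rw [E.QT, E.QT]; exact gab_comm (E.L6a _)

theorem RExt.L7 (k l : ι × Bool) (σ : Bool) (h : adj (nnx C.nx) k l) : E.Q (l, σ) ≠ -E.Q (k, true) := by
  intro he
  have hx : E.NX l = -E.NX k := congrArg (fun v : R3 => v.1) he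
  have hy : E.NY l = -E.NY k := congrArg (fun v : R3 => v.2.1) he
  rcases h with rfl | rfl | rfl
  · have := E.detN l
    have h1 : E.NX l = 0 := by linarith
    have h2 : E.NY l = 0 := by linarith
    rw [h1, h2] at this; simp at this
  · have := E.detN k
    rw [hx, hy] at this; linarith
  · have := E.detN l
    rw [hx, hy] at this; linarith

end step2
set_option linter.unusedSectionVars false

def AdjS {ι : Type} [Fintype ι] (nx : Equiv.Perm ι) : Finset (ι × ι) :=
  Finset.univ.filter fun p => adj nx p.1 p.2

theorem AdjS_card {ι : Type} [Fintype ι] (nx : Equiv.Perm ι) (h1 : ∀ i, nx i ≠ i) (h2 : ∀ i, nx (nx i) ≠ i) :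
    (AdjS nx).card = 3 * Fintype.card ι := by
  have e : AdjS nx = (Finset.univ.image (fun i : ι => (i, i)) ∪ Finset.univ.image (fun i : ι => (i, nx i))) ∪
      Finset.univ.image (fun i : ι => (nx i, i)) := by
    ext ⟨i, j⟩
    simp only [AdjS, Finset.mem_filter, Finset.mem_univ, true_and, Finset.mem_union, Finset.mem_image, Prod.mk.injEq]
    unfold adj
    constructor
    · rintro (h | h | h)
      · left; left; exact ⟨i, rfl, h.symm⟩
      · left; right; exact ⟨i, rfl, h.symm⟩
      · right; exact ⟨j, h.symm, rfl⟩
    · rintro ((⟨a, rfl, rfl⟩ | ⟨a, rfl, rfl⟩) | ⟨a, rfl, rfl⟩) <;> simp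
  rw [e, Finset.card_union_of_disjoint, Finset.card_union_of_disjoint, Finset.card_image_of_injective,
    Finset.card_image_of_injective, Finset.card_image_of_injective, Finset.card_univ]
  · ring
  · intro a b h; exact (Prod.mk.inj h).2
  · intro a b h; exact (Prod.mk.inj h).1
  · intro a b h; exact (Prod.mk.inj h).1
  · rw [Finset.disjoint_left]
    rintro ⟨i, j⟩ ha hb
    simp only [Finset.mem_image, Finset.mem_univ, true_and, Prod.mk.injEq] at ha hb
    obtain ⟨a, rfl, rfl⟩ := ha
    obtain ⟨b, rfl, hb⟩ := hb
    exact h1 _ hb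
  · rw [Finset.disjoint_left]
    rintro ⟨i, j⟩ ha hb
    simp only [Finset.mem_union, Finset.mem_image, Finset.mem_univ, true_and, Prod.mk.injEq] at ha hb
    obtain ⟨b, rfl, rfl⟩ := hb
    rcases ha with ⟨a, rfl, ha⟩ | ⟨a, rfl, ha⟩
    · exact h1 _ ha
    · exact h2 _ ha

def ParS {ι : Type} [Fintype ι] (nx : Equiv.Perm ι) : Finset ((ι × Bool) × ι) :=
  Finset.univ.filter fun p => p.2 = p.1.1 ∨ p.2 = nx p.1.1

theorem ParS_card {ι : Type} [Fintype ι] (nx : Equiv.Perm ι) (h1 : ∀ i, nx i ≠ i) :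
    (ParS nx).card = 4 * Fintype.card ι := by
  have e : ParS nx = Finset.univ.image (fun k : ι × Bool => (k, k.1)) ∪ Finset.univ.image (fun k : ι × Bool => (k, nx k.1)) := by
    ext ⟨k, j⟩
    simp only [ParS, Finset.mem_filter, Finset.mem_univ, true_and, Finset.mem_union, Finset.mem_image, Prod.mk.injEq]
    constructor
    · rintro (h | h)
      · left; exact ⟨k, rfl, h.symm⟩
      · right; exact ⟨k, rfl, h.symm⟩
    · rintro (⟨a, rfl, rfl⟩ | ⟨a, rfl, rfl⟩) <;> simp
  rw [e, Finset.card_union_of_disjoint, Finset.card_image_of_injective,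
    Finset.card_image_of_injective, Finset.card_univ, Fintype.card_prod, Fintype.card_bool]
  · ring
  · intro a b h; exact (Prod.mk.inj h).1
  · intro a b h; exact (Prod.mk.inj h).1
  · rw [Finset.disjoint_left]
    rintro ⟨i, j⟩ ha hb
    simp only [Finset.mem_image, Finset.mem_univ, true_and, Prod.mk.injEq] at ha hb
    obtain ⟨a, rfl, rfl⟩ := ha
    obtain ⟨b, rfl, hb⟩ := hb
    exact h1 _ hb

theorem nnx1 {ι : Type} (nx : Equiv.Perm ι) (k : ι × Bool) : nnx nx k ≠ k := by
  rcases k with ⟨i, _ | _⟩ <;> simp [nnx]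

theorem nnx2 {ι : Type} (nx : Equiv.Perm ι) (h1 : ∀ i, nx i ≠ i) (k : ι × Bool) : nnx nx (nnx nx k) ≠ k := by
  rcases k with ⟨i, _ | _⟩ <;> simp [nnx, h1]

theorem rho_neg (v : R3) : rho (-v) = - rho v := by simp [rho]

theorem rho_inj {v w : R3} (h : rho v = rho w) : v = w := by
  rw [← rho_rho v, h, rho_rho]

section step3
variable {ι : Type} [Fintype ι] {C : Cfg ι} (E : RExt C)

def Cfg.P (C : Cfg ι) (q : ι × Bool) : R3 := (C.X q.1, C.Y q.1, if q.2 then C.z else -C.z)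

theorem Cfg.PT (i : ι) : C.P (i, true) = (C.X i, C.Y i, C.z) := by simp [Cfg.P]
theorem Cfg.PF (i : ι) : C.P (i, false) = (C.X i, C.Y i, -C.z) := by simp [Cfg.P]

theorem Cfg.rhoP (i : ι) (σ : Bool) : rho (C.P (i, σ)) = C.P (i, !σ) := by
  cases σ <;> simp [Cfg.P, rho]

theorem Cfg.memP (i : ι) (σ : Bool) : C.P (i, σ) ∈ C.V := by
  cases σ
  · have := C.rmem _ (C.mem i)
    rwa [← C.PT, C.rhoP] at this
  · rw [C.PT]; exact C.mem i

theorem Cfg.P_inj : Function.Injective C.P := by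
  rintro ⟨i, σ⟩ ⟨j, τ⟩ h
  have h1 : C.X i = C.X j := congrArg (fun v : R3 => v.1) h
  have h2 : C.Y i = C.Y j := congrArg (fun v : R3 => v.2.1) h
  have h3 : (if σ then C.z else -C.z) = (if τ then C.z else -C.z) := congrArg (fun v : R3 => v.2.2) h
  have := C.inj h1 h2
  have hz := C.hz
  subst this
  cases σ <;> cases τ <;> simp at h3 ⊢ <;> linarith

theorem RExt.Q_inj : Function.Injective E.Q := by
  rintro ⟨i, σ⟩ ⟨j, τ⟩ h
  have h1 : E.NX i = E.NX j := congrArg (fun v : R3 => v.1) h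
  have h2 : E.NY i = E.NY j := congrArg (fun v : R3 => v.2.1) h
  have h3 : (if σ then E.z' else -E.z') = (if τ then E.z' else -E.z') := congrArg (fun v : R3 => v.2.2) h
  have := E.injN h1 h2
  have hz := E.hz'
  subst this
  cases σ <;> cases τ <;> simp at h3 ⊢ <;> linarith

theorem RExt.notMem (q) : E.Q q ∉ C.V := by
  intro h
  have hz := E.hz'
  have hzz := E.hzz
  rcases q with ⟨k, σ⟩
  have := C.hgt _ h
  cases σ
  · rw [E.QF] at this; simp at this; rcases this with h | h <;> linarith
  · rw [E.QT] at this; simp at this; rcases this with h | h <;> linarith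

theorem adj_symm {κ : Type} {nx : Equiv.Perm κ} {k l : κ} (h : adj nx k l) : adj nx l k := by
  unfold adj at *; tauto

/-- equatorial pairs of the old configuration are Gabriel. -/
theorem Cfg.eqG (i j : ι) (h : adj C.nx i j) : Gab C.V (C.P (i, true)) (C.P (j, false)) := by
  have a : ∀ i, Gab C.V (C.P (i, true)) (C.P (C.nx i, false)) := by
    intro i v hv
    have h1 := C.sup i v hv
    have h2 := C.sph v hv
    have h3 := C.circ i
    unfold sm at h1
    rw [C.PT, C.PF]
    unfold gg; simp only
    nlinarith
  rcases h with rfl | rfl | rfl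
  · intro v hv
    have hz' := C.hz
    have : C.z ^ 2 ≤ v.2.2 ^ 2 := by rcases C.hgt v hv with h | h <;> nlinarith
    rw [C.PT, C.PF]
    unfold gg; simp only
    nlinarith [sq_nonneg (C.X j - v.1), sq_nonneg (C.Y j - v.2.1)]
  · exact a i
  · have := gab_comm (gab_rho C.rmem (a j))
    simpa [C.rhoP] using this

theorem Cfg.eqN (i j : ι) (σ τ : Bool) (h : adj C.nx i j) : C.P (j, τ) ≠ -C.P (i, σ) := by
  intro he
  have hx : C.X j = -C.X i := congrArg (fun v : R3 => v.1) he
  have hy : C.Y j = -C.Y i := congrArg (fun v : R3 => v.2.1) he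
  rcases h with rfl | rfl | rfl
  · have := C.det j
    have h1 : C.X j = 0 := by linarith
    have h2 : C.Y j = 0 := by linarith
    rw [h1, h2] at this; simp at this
  · have := C.det i
    rw [hx, hy] at this; linarith
  · have := C.det j
    rw [hx, hy] at this; linarith

theorem Cfg.eqG' (i j : ι) (σ : Bool) (h : adj C.nx i j) : Gab C.V (C.P (i, σ)) (C.P (j, !σ)) := by
  cases σ
  · have := gab_rho C.rmem (C.eqG i j h)
    simpa [C.rhoP] using this
  · exact C.eqG i j h

theorem RExt.WW (k l : ι × Bool) (σ τ : Bool) :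
    (E.Q (l, τ) ≠ -E.Q (k, σ) ∧ Gab E.V' (E.Q (k, σ)) (E.Q (l, τ))) ↔ adj (nnx C.nx) k l := by
  have main : ∀ τ, (E.Q (l, τ) ≠ -E.Q (k, true) ∧ Gab E.V' (E.Q (k, true)) (E.Q (l, τ))) ↔ adj (nnx C.nx) k l :=
    fun τ => ⟨fun h => E.L5 k l τ h.1 h.2, fun h => ⟨E.L7 k l τ h, E.L6 k l τ h⟩⟩
  cases σ
  · rw [← main (!τ)]
    constructor
    · rintro ⟨h1, h2⟩
      refine ⟨fun h => h1 (rho_inj ?_), ?_⟩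
      · rw [rho_neg, E.rhoQ, E.rhoQ, h]; rfl
      · have := gab_rho E.rV' h2
        simpa [E.rhoQ] using this
    · rintro ⟨h1, h2⟩
      refine ⟨fun h => h1 (rho_inj ?_), ?_⟩
      · rw [rho_neg, E.rhoQ, E.rhoQ, Bool.not_not, h]; rfl
      · have := gab_rho E.rV' h2
        simpa [E.rhoQ] using this
  · exact main τ

theorem RExt.negQ (k σ) : -E.Q (k, σ) ∉ C.V := by
  intro h
  have := C.neg _ h
  rw [neg_neg] at this
  exact E.notMem _ this

theorem RExt.WV (k : ι × Bool) (σ : Bool) {x : R3} (hx : x ∈ C.V) :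
    (x ≠ -E.Q (k, σ) ∧ Gab E.V' (E.Q (k, σ)) x) ↔ ∃ j, (j = k.1 ∨ j = C.nx k.1) ∧ x = C.P (j, σ) := by
  have h0 : x ≠ -E.Q (k, σ) := fun h => E.negQ k σ (h ▸ hx)
  simp only [h0, ne_eq, not_false_eq_true, true_and]
  cases σ
  · constructor
    · intro h
      have := gab_rho E.rV' h
      rw [E.rhoQ, Bool.not_false, E.QT] at this
      obtain ⟨j, hj, e⟩ := E.L3 (C.rmem _ hx) k this
      refine ⟨j, hj, rho_inj ?_⟩
      rw [e, C.rhoP, Bool.not_false, C.PT]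
    · rintro ⟨j, hj, rfl⟩
      have := gab_rho E.rV' (E.L4 k j hj)
      rwa [← E.QT, E.rhoQ, ← C.PT, C.rhoP] at this
  · rw [E.QT]
    constructor
    · intro h
      obtain ⟨j, hj, e⟩ := E.L3 hx k h
      exact ⟨j, hj, by rw [C.PT]; exact e⟩
    · rintro ⟨j, hj, rfl⟩
      rw [C.PT]; exact E.L4 k j hj

theorem Gab.mono {V V' : Finset R3} (h : V ⊆ V') {x y : R3} (hg : Gab V' x y) : Gab V x y :=
  fun v hv => hg v (h hv)

theorem RExt.VV {x y : R3} (hx : x ∈ C.V) (hy : y ∈ C.V) :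
    (y ≠ -x ∧ Gab E.V' x y) ↔ (y ≠ -x ∧ Gab C.V x y) ∧
      ¬ ∃ i j σ, adj C.nx i j ∧ x = C.P (i, σ) ∧ y = C.P (j, !σ) := by
  have sub : C.V ⊆ E.V' := fun v hv => E.memC hv
  have hz := C.hz
  constructor
  · rintro ⟨h1, h2⟩
    refine ⟨⟨h1, h2.mono sub⟩, ?_⟩
    rintro ⟨i, j, σ, ha, rfl, rfl⟩
    cases σ
    · have := gab_rho E.rV' h2
      rw [C.rhoP, C.rhoP] at this
      exact E.L2 i j ha (by simpa [Cfg.P] using this)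
    · exact E.L2 i j ha (by simpa [Cfg.P] using h2)
  · rintro ⟨⟨h1, h2⟩, h3⟩
    refine ⟨h1, ?_⟩
    rcases C.hgt x hx with a | a <;> rcases C.hgt y hy with b | b
    · exact E.L1 hx hy a b h2
    · exfalso
      obtain ⟨i, j, e1, e2, ha⟩ := C.cross x hx y hy (by linarith) (by linarith) h1 h2
      exact h3 ⟨i, j, true, ha, by rw [C.PT]; exact e1, by rw [Bool.not_true, C.PF]; exact e2⟩
    · exfalso
      obtain ⟨i, j, e1, e2, ha⟩ := C.cross y hy x hx (by linarith) (by linarith)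
        (fun h => h1 (by rw [h, neg_neg])) (gab_comm h2)
      exact h3 ⟨j, i, false, adj_symm ha, by rw [C.PF]; exact e2, by rw [Bool.not_false, C.PT]; exact e1⟩
    · have := E.L1 (C.rmem _ hx) (C.rmem _ hy) (by simp [rho]; linarith) (by simp [rho]; linarith) (gab_rho C.rmem h2)
      have := gab_rho E.rV' this
      rwa [rho_rho, rho_rho] at this

def S0 (C : Cfg ι) : Finset (R3 × R3) :=
  (AdjS C.nx ×ˢ (Finset.univ : Finset Bool)).image fun q => (C.P (q.1.1, q.2), C.P (q.1.2, !q.2))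

def RExt.S1 : Finset (R3 × R3) :=
  (ParS C.nx ×ˢ (Finset.univ : Finset Bool)).image fun q => (E.Q (q.1.1, q.2), C.P (q.1.2, q.2))

def RExt.S2 : Finset (R3 × R3) :=
  (ParS C.nx ×ˢ (Finset.univ : Finset Bool)).image fun q => (C.P (q.1.2, q.2), E.Q (q.1.1, q.2))

def RExt.S3 : Finset (R3 × R3) :=
  (AdjS (nnx C.nx) ×ˢ (Finset.univ : Finset (Bool × Bool))).image fun q => (E.Q (q.1.1, q.2.1), E.Q (q.1.2, q.2.2))

theorem memS0 {x y : R3} : (x, y) ∈ S0 C ↔ ∃ i j σ, adj C.nx i j ∧ x = C.P (i, σ) ∧ y = C.P (j, !σ) := by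
  simp only [S0, AdjS, Finset.mem_image, Finset.mem_product, Finset.mem_filter, Finset.mem_univ, true_and, and_true, Prod.mk.injEq]
  constructor
  · rintro ⟨⟨⟨i, j⟩, σ⟩, h, h1, h2⟩; exact ⟨i, j, σ, h, h1.symm, h2.symm⟩
  · rintro ⟨i, j, σ, h, h1, h2⟩; exact ⟨⟨⟨i, j⟩, σ⟩, h, h1.symm, h2.symm⟩

theorem RExt.memS1 {x y : R3} : (x, y) ∈ E.S1 ↔ ∃ k σ, x = E.Q (k, σ) ∧ ∃ j, (j = k.1 ∨ j = C.nx k.1) ∧ y = C.P (j, σ) := by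
  simp only [RExt.S1, ParS, Finset.mem_image, Finset.mem_product, Finset.mem_filter, Finset.mem_univ, true_and, and_true, Prod.mk.injEq]
  constructor
  · rintro ⟨⟨⟨i, j⟩, σ⟩, h, h1, h2⟩; exact ⟨i, σ, h1.symm, j, h, h2.symm⟩
  · rintro ⟨i, σ, h1, j, h, h2⟩; exact ⟨⟨⟨i, j⟩, σ⟩, h, h1.symm, h2.symm⟩

theorem RExt.memS2 {x y : R3} : (y, x) ∈ E.S2 ↔ ∃ k σ, x = E.Q (k, σ) ∧ ∃ j, (j = k.1 ∨ j = C.nx k.1) ∧ y = C.P (j, σ) := by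
  simp only [RExt.S2, ParS, Finset.mem_image, Finset.mem_product, Finset.mem_filter, Finset.mem_univ, true_and, and_true, Prod.mk.injEq]
  constructor
  · rintro ⟨⟨⟨i, j⟩, σ⟩, h, h1, h2⟩; exact ⟨i, σ, h2.symm, j, h, h1.symm⟩
  · rintro ⟨i, σ, h1, j, h, h2⟩; exact ⟨⟨⟨i, j⟩, σ⟩, h, h2.symm, h1.symm⟩

theorem RExt.memS3 {x y : R3} : (x, y) ∈ E.S3 ↔ ∃ k l σ τ, adj (nnx C.nx) k l ∧ x = E.Q (k, σ) ∧ y = E.Q (l, τ) := by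
  simp only [RExt.S3, AdjS, Finset.mem_image, Finset.mem_product, Finset.mem_filter, Finset.mem_univ, true_and, and_true, Prod.mk.injEq]
  constructor
  · rintro ⟨⟨⟨i, j⟩, σ, τ⟩, h, h1, h2⟩; exact ⟨i, j, σ, τ, h, h1.symm, h2.symm⟩
  · rintro ⟨i, j, σ, τ, h, h1, h2⟩; exact ⟨⟨⟨i, j⟩, σ, τ⟩, h, h1.symm, h2.symm⟩

theorem memGP {V : Finset R3} {x y : R3} : (x, y) ∈ GP V ↔ (x ∈ V ∧ y ∈ V) ∧ (y ≠ -x ∧ Gab V x y) := by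
  simp only [GP, Finset.mem_filter, Finset.mem_product]

theorem RExt.gp_eq : GP E.V' = (((GP C.V \ S0 C) ∪ E.S1) ∪ E.S2) ∪ E.S3 := by
  ext ⟨x, y⟩
  simp only [Finset.mem_union, Finset.mem_sdiff, memGP, memS0, E.memS1, E.memS2, E.memS3, E.memV']
  constructor
  · rintro ⟨⟨hx | ⟨k, σ, rfl⟩, hy | ⟨l, τ, rfl⟩⟩, h⟩
    · left; left; left
      have := (E.VV hx hy).1 h
      exact ⟨⟨⟨hx, hy⟩, this.1⟩, this.2⟩
    · left; right
      refine ⟨l, τ, rfl, (E.WV l τ hx).1 ⟨fun h' => h.1 (by rw [h', neg_neg]), gab_comm h.2⟩⟩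
    · left; left; right
      exact ⟨k, σ, rfl, (E.WV k σ hy).1 h⟩
    · right
      exact ⟨k, l, σ, τ, (E.WW k l σ τ).1 h, rfl, rfl⟩
  · rintro (((⟨⟨⟨hx, hy⟩, h⟩, h'⟩ | ⟨k, σ, rfl, j, hj, rfl⟩) | ⟨k, σ, rfl, j, hj, rfl⟩) | ⟨k, l, σ, τ, h, rfl, rfl⟩)
    · exact ⟨⟨Or.inl hx, Or.inl hy⟩, (E.VV hx hy).2 ⟨h, h'⟩⟩
    · exact ⟨⟨Or.inr ⟨k, σ, rfl⟩, Or.inl (C.memP _ _)⟩, (E.WV k σ (C.memP _ _)).2 ⟨j, hj, rfl⟩⟩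
    · have := (E.WV k σ (C.memP j σ)).2 ⟨j, hj, rfl⟩
      exact ⟨⟨Or.inl (C.memP _ _), Or.inr ⟨k, σ, rfl⟩⟩, fun h' => this.1 (by rw [h', neg_neg]), gab_comm this.2⟩
    · exact ⟨⟨Or.inr ⟨k, σ, rfl⟩, Or.inr ⟨l, τ, rfl⟩⟩, (E.WW k l σ τ).2 h⟩

theorem S0_sub : S0 C ⊆ GP C.V := by
  rintro ⟨x, y⟩ h
  obtain ⟨i, j, σ, ha, rfl, rfl⟩ := memS0.1 h
  exact memGP.2 ⟨⟨C.memP _ _, C.memP _ _⟩, C.eqN _ _ _ _ ha, C.eqG' _ _ _ ha⟩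

theorem S0_card : (S0 C).card = 6 * Fintype.card ι := by
  unfold S0
  rw [Finset.card_image_of_injective, Finset.card_product, AdjS_card _ C.nx1 C.nx2, Finset.card_univ, Fintype.card_bool]
  · ring
  · rintro ⟨⟨i, j⟩, σ⟩ ⟨⟨i', j'⟩, σ'⟩ h
    have h1 := C.P_inj (Prod.mk.inj h).1
    have h2 := C.P_inj (Prod.mk.inj h).2
    simp only [Prod.mk.injEq] at h1 h2 ⊢
    exact ⟨⟨h1.1, h2.1⟩, h1.2⟩

theorem RExt.S1_card : E.S1.card = 8 * Fintype.card ι := by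
  unfold RExt.S1
  rw [Finset.card_image_of_injective, Finset.card_product, ParS_card _ C.nx1, Finset.card_univ, Fintype.card_bool]
  · ring
  · rintro ⟨⟨i, j⟩, σ⟩ ⟨⟨i', j'⟩, σ'⟩ h
    have h1 := E.Q_inj (Prod.mk.inj h).1
    have h2 := C.P_inj (Prod.mk.inj h).2
    simp only [Prod.mk.injEq] at h1 h2 ⊢
    exact ⟨⟨h1.1, h2.1⟩, h1.2⟩

theorem RExt.S2_card : E.S2.card = 8 * Fintype.card ι := by
  unfold RExt.S2
  rw [Finset.card_image_of_injective, Finset.card_product, ParS_card _ C.nx1, Finset.card_univ, Fintype.card_bool]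
  · ring
  · rintro ⟨⟨i, j⟩, σ⟩ ⟨⟨i', j'⟩, σ'⟩ h
    have h1 := E.Q_inj (Prod.mk.inj h).2
    have h2 := C.P_inj (Prod.mk.inj h).1
    simp only [Prod.mk.injEq] at h1 h2 ⊢
    exact ⟨⟨h1.1, h2.1⟩, h1.2⟩

theorem RExt.S3_card : E.S3.card = 24 * Fintype.card ι := by
  unfold RExt.S3
  rw [Finset.card_image_of_injective, Finset.card_product, AdjS_card _ (nnx1 C.nx) (nnx2 C.nx C.nx1), Finset.card_univ,
    Fintype.card_prod, Fintype.card_prod, Fintype.card_bool]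
  · ring
  · rintro ⟨⟨i, j⟩, σ, τ⟩ ⟨⟨i', j'⟩, σ', τ'⟩ h
    have h1 := E.Q_inj (Prod.mk.inj h).1
    have h2 := E.Q_inj (Prod.mk.inj h).2
    simp only [Prod.mk.injEq] at h1 h2 ⊢
    exact ⟨⟨h1.1, h2.1⟩, h1.2, h2.2⟩

theorem RExt.gp_card : (GP E.V').card = (GP C.V).card + 34 * Fintype.card ι := by
  have h0 := S0_card (C := C)
  have hs := Finset.card_sdiff_add_card_eq_card (S0_sub (C := C))
  rw [E.gp_eq, Finset.card_union_of_disjoint, Finset.card_union_of_disjoint, Finset.card_union_of_disjoint,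
    E.S1_card, E.S2_card, E.S3_card]
  · omega
  · rw [Finset.disjoint_left]
    rintro ⟨x, y⟩ h h'
    obtain ⟨k, σ, rfl, -⟩ := E.memS1.1 h'
    exact E.notMem _ (memGP.1 (Finset.mem_sdiff.1 h).1).1.1
  · rw [Finset.disjoint_left]
    rintro ⟨x, y⟩ h h'
    obtain ⟨k, σ, rfl, j, -, rfl⟩ := E.memS2.1 h'
    rcases Finset.mem_union.1 h with h | h
    · exact E.notMem _ (memGP.1 (Finset.mem_sdiff.1 h).1).1.2
    · obtain ⟨k', σ', e, -⟩ := E.memS1.1 h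
      exact E.notMem _ (e ▸ C.memP j σ)
  · rw [Finset.disjoint_left]
    rintro ⟨x, y⟩ h h'
    obtain ⟨k, l, σ, τ, -, rfl, rfl⟩ := E.memS3.1 h'
    rcases Finset.mem_union.1 h with h | h
    · rcases Finset.mem_union.1 h with h | h
      · exact E.notMem _ (memGP.1 (Finset.mem_sdiff.1 h).1).1.2
      · obtain ⟨_, σ', _, j, -, e⟩ := E.memS1.1 h
        exact E.notMem _ (e ▸ C.memP j σ')
    · obtain ⟨_, σ', _, j, -, e⟩ := E.memS2.1 h
      exact E.notMem _ (e ▸ C.memP j σ')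

theorem RExt.V'_card : E.V'.card = C.V.card + 4 * Fintype.card ι := by
  unfold RExt.V'
  rw [Finset.card_union_of_disjoint]
  · unfold RExt.W
    rw [Finset.card_image_of_injective _ E.Q_inj, Finset.card_univ, Fintype.card_prod, Fintype.card_prod, Fintype.card_bool]
    ring
  · rw [Finset.disjoint_left]
    intro v h h'
    obtain ⟨k, σ, rfl⟩ := E.memW.1 h'
    exact E.notMem _ h

def RExt.next : Cfg (ι × Bool) where
  V := E.V'
  X := E.NX
  Y := E.NY
  nx := nnx C.nx
  z := E.z'
  hz := E.hz'
  nx1 := nnx1 C.nx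
  nx2 := nnx2 C.nx C.nx1
  sph := fun _ hv => E.sph' hv
  mem := fun k => by rw [← E.QT]; exact E.memQ _ _
  rmem := E.rV'
  neg := by
    intro v hv
    rcases E.memV'.1 hv with h | ⟨k, σ, rfl⟩
    · exact E.memC (C.neg v h)
    · obtain ⟨j, h1, h2, -, -⟩ := E.antiN k
      have : -E.Q (k, σ) = E.Q (j, !σ) := by
        cases σ <;> simp [RExt.Q, h1, h2]
      rw [this]; exact E.memQ _ _
  hgt := fun _ hv => E.hgt' hv
  ronly := by
    intro v hv h
    have hz := E.hz'
    have hzz := E.hzz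
    rcases E.up hv (by linarith) with h1 | h1
    · linarith [h1.2]
    · exact h1
  sup := fun k _ hv => E.sup' k hv
  strict := E.strictN
  det := E.detN
  nn := E.nnN
  anti := E.antiN
  rgab := E.L6a
  cross := by
    intro v hv w hw h1 h2 h3 hg
    have hz := C.hz
    have hz' := E.hz'
    rcases E.memV'.1 hv with hv | ⟨k, σ, rfl⟩ <;> rcases E.memV'.1 hw with hw | ⟨l, τ, rfl⟩
    · exfalso
      obtain ⟨⟨a, b⟩, c⟩ := (E.VV hv hw).1 ⟨h3, hg⟩
      obtain ⟨i, j, e1, e2, ha⟩ := C.cross v hv w hw h1 h2 a b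
      exact c ⟨i, j, true, ha, by rw [C.PT]; exact e1, by rw [Bool.not_true, C.PF]; exact e2⟩
    · exfalso
      obtain ⟨j, -, rfl⟩ := (E.WV l τ hv).1 ⟨fun h' => h3 (by rw [h', neg_neg]), gab_comm hg⟩
      cases τ <;> simp [Cfg.P, RExt.Q] at h1 h2 <;> linarith
    · exfalso
      obtain ⟨j, -, rfl⟩ := (E.WV k σ hw).1 ⟨h3, hg⟩
      cases σ <;> simp [Cfg.P, RExt.Q] at h1 h2 <;> linarith
    · refine ⟨k, l, ?_, ?_, (E.WW k l σ τ).1 ⟨h3, hg⟩⟩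
      · cases σ
        · simp [RExt.Q] at h1; linarith
        · exact E.QT k
      · cases τ
        · exact E.QF l
        · simp [RExt.Q] at h2; linarith
  cnt := by
    rw [E.gp_card, E.V'_card]
    have := C.cnt
    omega

end step3
set_option linter.unusedSectionVars false

def sgn2 (b : Bool) : ℝ := if b then 1 else -1

theorem sgn2_cases (b : Bool) : sgn2 b = 1 ∨ sgn2 b = -1 := by cases b <;> simp [sgn2]

theorem sgn2_inj {a b : Bool} (h : sgn2 a = sgn2 b) : a = b := by
  cases a <;> cases b <;> simp [sgn2] at h ⊢ <;> norm_num at h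

def bpt (t : Bool × Bool × Bool) : R3 := (2 / 3 * sgn2 t.1, 2 / 3 * sgn2 t.2.1, 1 / 3 * sgn2 t.2.2)

theorem bpt_inj : Function.Injective bpt := by
  rintro ⟨a, b, c⟩ ⟨a', b', c'⟩ h
  simp only [bpt, Prod.mk.injEq] at h
  obtain ⟨h1, h2, h3⟩ := h
  rw [sgn2_inj (a := a) (b := a') (by linarith), sgn2_inj (a := b) (b := b') (by linarith),
    sgn2_inj (a := c) (b := c') (by linarith)]

def V0 : Finset R3 := Finset.univ.image bpt

theorem V0_card : V0.card = 8 := by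
  unfold V0
  rw [Finset.card_image_of_injective _ bpt_inj]; rfl

theorem mem_V0 {v : R3} : v ∈ V0 ↔ (v.1 = 2 / 3 ∨ v.1 = -2 / 3) ∧ (v.2.1 = 2 / 3 ∨ v.2.1 = -2 / 3) ∧
    (v.2.2 = 1 / 3 ∨ v.2.2 = -1 / 3) := by
  obtain ⟨x, y, z⟩ := v
  simp only [V0, Finset.mem_image, Finset.mem_univ, true_and]
  constructor
  · rintro ⟨⟨a, b, c⟩, h⟩
    simp only [bpt, Prod.mk.injEq] at h
    obtain ⟨rfl, rfl, rfl⟩ := h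
    refine ⟨?_, ?_, ?_⟩
    · rcases sgn2_cases a with h | h <;> rw [h] <;> norm_num
    · rcases sgn2_cases b with h | h <;> rw [h] <;> norm_num
    · rcases sgn2_cases c with h | h <;> rw [h] <;> norm_num
  · rintro ⟨h1, h2, h3⟩
    have key : ∀ s r : ℝ, (s = r ∨ s = -r) → ∃ b, r * sgn2 b = s := by
      rintro s r (rfl | rfl)
      · exact ⟨true, by simp [sgn2]⟩
      · exact ⟨false, by simp [sgn2]⟩
    obtain ⟨a, ha⟩ := key x (2 / 3) (by rcases h1 with h | h <;> [left; right] <;> linarith)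
    obtain ⟨b, hb⟩ := key y (2 / 3) (by rcases h2 with h | h <;> [left; right] <;> linarith)
    obtain ⟨c, hc⟩ := key z (1 / 3) (by rcases h3 with h | h <;> [left; right] <;> linarith)
    exact ⟨(a, b, c), by simp only [bpt, ha, hb, hc]⟩

theorem box_aux {r x y v : ℝ} (hx : x = r ∨ x = -r) (hy : y = r ∨ y = -r) (hv : v = r ∨ v = -r) :
    0 ≤ (x - v) * (y - v) := by
  rcases hx with h0 | h0 <;> rcases hy with h | h <;> rcases hv with h' | h' <;> rw [h0, h, h'] <;>
    nlinarith [sq_nonneg r]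

theorem V0_gab {x y : R3} (hx : x ∈ V0) (hy : y ∈ V0) : Gab V0 x y := by
  intro v hv
  rw [mem_V0] at hx hy hv
  simp only [neg_div] at hx hy hv
  unfold gg
  have h1 := box_aux hx.1 hy.1 hv.1
  have h2 := box_aux hx.2.1 hy.2.1 hv.2.1
  have h3 := box_aux hx.2.2 hy.2.2 hv.2.2
  linarith

theorem V0_neg {v : R3} (hv : v ∈ V0) : -v ∈ V0 := by
  rw [mem_V0] at hv ⊢
  simp only [Prod.fst_neg, Prod.snd_neg]
  obtain ⟨h1, h2, h3⟩ := hv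
  refine ⟨?_, ?_, ?_⟩
  · rcases h1 with h | h <;> rw [h] <;> norm_num
  · rcases h2 with h | h <;> rw [h] <;> norm_num
  · rcases h3 with h | h <;> rw [h] <;> norm_num

theorem V0_GP : (GP V0).card = 56 := by
  have e : GP V0 = (V0 ×ˢ V0) \ (V0.image fun v => (v, -v)) := by
    ext ⟨x, y⟩
    simp only [GP, Finset.mem_filter, Finset.mem_product, Finset.mem_sdiff, Finset.mem_image, Prod.mk.injEq, not_exists, not_and]
    constructor
    · rintro ⟨⟨hx, hy⟩, h, -⟩
      refine ⟨⟨hx, hy⟩, ?_⟩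
      rintro a ha rfl h'
      exact h h'.symm
    · rintro ⟨⟨hx, hy⟩, h⟩
      exact ⟨⟨hx, hy⟩, fun h' => h x hx rfl h'.symm, V0_gab hx hy⟩
  rw [e, Finset.card_sdiff_of_subset, Finset.card_product, Finset.card_image_of_injective, V0_card]
  · intro a b h; exact (Prod.mk.inj h).1
  · intro p hp
    simp only [Finset.mem_image] at hp
    obtain ⟨a, ha, rfl⟩ := hp
    exact Finset.mem_product.2 ⟨ha, V0_neg ha⟩

def X0 : Fin 4 → ℝ := ![2 / 3, -2 / 3, -2 / 3, 2 / 3]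
def Y0 : Fin 4 → ℝ := ![2 / 3, 2 / 3, -2 / 3, -2 / 3]

theorem r00 : (finRotate 4) 0 = 1 := by decide
theorem r01 : (finRotate 4) 1 = 2 := by decide
theorem r02 : (finRotate 4) 2 = 3 := by decide
theorem r03 : (finRotate 4) 3 = 0 := by decide
theorem x00 : X0 0 = 2 / 3 := rfl
theorem x01 : X0 1 = -2 / 3 := rfl
theorem x02 : X0 2 = -2 / 3 := rfl
theorem x03 : X0 3 = 2 / 3 := rfl
theorem y00 : Y0 0 = 2 / 3 := rfl
theorem y01 : Y0 1 = 2 / 3 := rfl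
theorem y02 : Y0 2 = -2 / 3 := rfl
theorem y03 : Y0 3 = -2 / 3 := rfl

theorem fin4 {p : Fin 4 → Prop} (h0 : p 0) (h1 : p 1) (h2 : p 2) (h3 : p 3) : ∀ i, p i := by
  intro i; fin_cases i <;> assumption

theorem ring0_mem : ∀ i, (X0 i, Y0 i, (1 / 3 : ℝ)) ∈ V0 := by
  apply fin4 <;> rw [mem_V0] <;> simp only [x00, x01, x02, x03, y00, y01, y02, y03] <;> norm_num

theorem ring0_ex {x y : ℝ} (hx : x = 2 / 3 ∨ x = -2 / 3) (hy : y = 2 / 3 ∨ y = -2 / 3) :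
    ∃ i, x = X0 i ∧ y = Y0 i := by
  rcases hx with rfl | rfl <;> rcases hy with rfl | rfl
  · exact ⟨0, rfl, rfl⟩
  · exact ⟨3, rfl, rfl⟩
  · exact ⟨1, rfl, rfl⟩
  · exact ⟨2, rfl, rfl⟩

theorem cross0 (i j : Fin 4) : adj (finRotate 4) i j ∨ (X0 j = - X0 i ∧ Y0 j = - Y0 i) := by
  fin_cases i <;> fin_cases j <;>
    first
    | (left; unfold adj; decide)
    | (right; constructor <;> simp [X0, Y0] <;> norm_num)

def Cfg0 : Cfg (Fin 4) where
  V := V0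
  X := X0
  Y := Y0
  nx := finRotate 4
  z := 1 / 3
  hz := by norm_num
  nx1 := by decide
  nx2 := by decide
  sph := by
    intro v hv
    rw [mem_V0] at hv
    obtain ⟨h1, h2, h3⟩ := hv
    rcases h1 with h1 | h1 <;> rcases h2 with h2 | h2 <;> rcases h3 with h3 | h3 <;> rw [h1, h2, h3] <;> norm_num
  mem := ring0_mem
  rmem := by
    intro v hv
    rw [mem_V0] at hv ⊢
    refine ⟨hv.1, hv.2.1, ?_⟩
    unfold rho
    rcases hv.2.2 with h | h <;> simp only [h] <;> norm_num
  neg := fun v hv => V0_neg hv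
  hgt := by
    intro v hv
    rw [mem_V0] at hv
    rcases hv.2.2 with h | h <;> rw [h] <;> norm_num
  ronly := by
    intro v hv h
    rw [mem_V0] at hv
    obtain ⟨i, hi⟩ := ring0_ex hv.1 hv.2.1
    exact ⟨i, Prod.ext hi.1 (Prod.ext hi.2 h)⟩
  sup := by
    intro i v hv
    rw [mem_V0] at hv
    obtain ⟨h1, h2, -⟩ := hv
    revert i
    apply fin4 <;> simp only [sm, r00, r01, r02, r03, x00, x01, x02, x03, y00, y01, y02, y03] <;>
      rcases h1 with h1 | h1 <;> rcases h2 with h2 | h2 <;> rw [h1, h2] <;> norm_num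
  strict := by
    apply fin4 <;> apply fin4 <;>
      simp only [sm, r00, r01, r02, r03, x00, x01, x02, x03, y00, y01, y02, y03] <;> intro h1 h2 <;>
      first
      | exact absurd rfl h1
      | exact absurd rfl h2
      | norm_num
  det := by
    apply fin4 <;> simp only [r00, r01, r02, r03, x00, x01, x02, x03, y00, y01, y02, y03] <;> norm_num
  nn := by
    apply fin4 <;> simp only [sm, r00, r01, r02, r03, x00, x01, x02, x03, y00, y01, y02, y03] <;> norm_num
  anti := by
    apply fin4
    · refine ⟨2, ?_⟩
      simp only [r00, r01, r02, r03, x00, x01, x02, x03, y00, y01, y02, y03]; norm_num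
    · refine ⟨3, ?_⟩
      simp only [r00, r01, r02, r03, x00, x01, x02, x03, y00, y01, y02, y03]; norm_num
    · refine ⟨0, ?_⟩
      simp only [r00, r01, r02, r03, x00, x01, x02, x03, y00, y01, y02, y03]; norm_num
    · refine ⟨1, ?_⟩
      simp only [r00, r01, r02, r03, x00, x01, x02, x03, y00, y01, y02, y03]; norm_num
  rgab := fun i => V0_gab (ring0_mem _) (ring0_mem _)
  cross := by
    intro v hv w hw hv0 hw0 hne _
    rw [mem_V0] at hv hw
    obtain ⟨i, hi⟩ := ring0_ex hv.1 hv.2.1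
    obtain ⟨j, hj⟩ := ring0_ex hw.1 hw.2.1
    have hvz : v.2.2 = 1 / 3 := by
      rcases hv.2.2 with h | h
      · exact h
      · rw [h] at hv0; norm_num at hv0
    have hwz : w.2.2 = -(1 / 3) := by
      rcases hw.2.2 with h | h
      · rw [h] at hw0; norm_num at hw0
      · rw [h]; norm_num
    refine ⟨i, j, Prod.ext hi.1 (Prod.ext hi.2 hvz), Prod.ext hj.1 (Prod.ext hj.2 hwz), ?_⟩
    rcases cross0 i j with h | h
    · exact h
    · exfalso; apply hne
      refine Prod.ext ?_ (Prod.ext ?_ ?_)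
      · simp [hi.1, hj.1, h.1]
      · simp [hi.2, hj.2, h.2]
      · simp [hvz, hwz]
  cnt := by rw [V0_GP, V0_card]

theorem exists_big (N : ℕ) : ∃ (ι : Type) (_ : Fintype ι) (_ : Nonempty ι) (C : Cfg ι),
    N < C.V.card ∧ Even (GP C.V).card := by
  induction N with
  | zero =>
    refine ⟨Fin 4, inferInstance, inferInstance, Cfg0, ?_, ?_⟩
    · show 0 < V0.card
      rw [V0_card]; norm_num
    · show Even (GP V0).card
      rw [V0_GP]; decide
  | succ n ih =>
    obtain ⟨ι, i1, i2, C, h1, h2⟩ := ih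
    obtain ⟨E⟩ := exists_ext C
    refine ⟨ι × Bool, inferInstance, inferInstance, E.next, ?_, ?_⟩
    · show n + 1 < E.V'.card
      rw [E.V'_card]
      have : 0 < Fintype.card ι := Fintype.card_pos
      omega
    · show Even (GP E.V').card
      rw [E.gp_card]
      obtain ⟨k, hk⟩ := h2
      exact ⟨k + 17 * Fintype.card ι, by omega⟩

def toE (v : R3) : Euc 3 := !₂[v.1, v.2.1, v.2.2]

theorem toE_inj : Function.Injective toE := by
  intro a b h
  have h0 := congrArg (fun w : Euc 3 => w 0) h
  have h1 := congrArg (fun w : Euc 3 => w 1) h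
  have h2 := congrArg (fun w : Euc 3 => w 2) h
  simp [toE] at h0 h1 h2
  exact Prod.ext h0 (Prod.ext h1 h2)

theorem toE_inner (a b c d : R3) : ⟪toE a - toE b, toE c - toE d⟫ =
    (a.1 - b.1) * (c.1 - d.1) + (a.2.1 - b.2.1) * (c.2.1 - d.2.1) + (a.2.2 - b.2.2) * (c.2.2 - d.2.2) := by
  simp [toE, PiLp.inner_apply, Fin.sum_univ_three]
  ring

theorem toE_norm {v : R3} (h : v.1 ^ 2 + v.2.1 ^ 2 + v.2.2 ^ 2 = 1) : ‖toE v‖ = 1 := by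
  rw [EuclideanSpace.norm_eq]
  simp [toE, Fin.sum_univ_three, h]

theorem dn_iff {ι : Type} [Fintype ι] (C : Cfg ι) {p q : R3} (hp : p ∈ C.V) (hq : q ∈ C.V) :
    IsDNPair (C.V.image toE) (toE p) (toE q) ↔ p ≠ q ∧ Gab C.V p (-q) := by
  have sp := C.sph p hp
  have sq := C.sph q hq
  unfold IsDNPair
  constructor
  · rintro ⟨-, -, h1, h2⟩
    refine ⟨fun h => h1 (by rw [h]), ?_⟩
    intro v hv
    have := (h2 _ (Finset.mem_image_of_mem _ hv)).1
    rw [toE_inner] at this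
    have sv := C.sph v hv
    unfold gg
    simp only [Prod.fst_neg, Prod.snd_neg]
    linarith
  · rintro ⟨h1, h2⟩
    refine ⟨Finset.mem_image_of_mem _ hp, Finset.mem_image_of_mem _ hq, fun h => h1 (toE_inj h), ?_⟩
    intro w hw
    obtain ⟨v, hv, rfl⟩ := Finset.mem_image.1 hw
    have sv := C.sph v hv
    have a1 := h2 v hv
    have a2 := h2 _ (C.neg v hv)
    unfold gg at a1 a2
    simp only [Prod.fst_neg, Prod.snd_neg] at a1 a2
    rw [toE_inner, toE_inner]
    constructor <;> linarith

theorem dn_card {ι : Type} [Fintype ι] (C : Cfg ι) :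
    (((C.V.image toE) ×ˢ (C.V.image toE)).filter fun pq => IsDNPair (C.V.image toE) pq.1 pq.2).card
      = (GP C.V).card := by
  symm
  apply Finset.card_bij (fun (a : R3 × R3) _ => (toE a.1, toE (-a.2)))
  · rintro ⟨x, y⟩ h
    simp only [GP, Finset.mem_filter, Finset.mem_product] at h
    obtain ⟨⟨hx, hy⟩, h1, h2⟩ := h
    rw [Finset.mem_filter, Finset.mem_product]
    refine ⟨⟨Finset.mem_image_of_mem _ hx, Finset.mem_image_of_mem _ (C.neg _ hy)⟩, ?_⟩
    refine (dn_iff C hx (C.neg _ hy)).2 ⟨fun h => h1 (by rw [h, neg_neg]), by rw [neg_neg]; exact h2⟩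
  · rintro ⟨x, y⟩ _ ⟨x', y'⟩ _ h
    have h1 := toE_inj (Prod.mk.inj h).1
    have h2 := toE_inj (Prod.mk.inj h).2
    exact Prod.ext h1 (neg_injective h2)
  · rintro ⟨a, b⟩ h
    rw [Finset.mem_filter, Finset.mem_product] at h
    obtain ⟨⟨ha, hb⟩, h⟩ := h
    obtain ⟨p, hp, rfl⟩ := Finset.mem_image.1 ha
    obtain ⟨q, hq, rfl⟩ := Finset.mem_image.1 hb
    obtain ⟨h1, h2⟩ := (dn_iff C hp hq).1 h
    refine ⟨(p, -q), ?_, by rw [neg_neg]⟩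
    simp only [GP, Finset.mem_filter, Finset.mem_product]
    exact ⟨⟨hp, C.neg _ hq⟩, fun h => h1 (neg_injective h).symm, h2⟩

/-- For infinitely many `n` there is a set of `n` points on the unit sphere with exactly
`(17/4)n - 6` double-normal pairs. -/
theorem doubleNormal_sphere_exactly_attained (N : ℕ) :
    ∃ n : ℕ, N < n ∧
      ∃ V : Finset (Euc 3), (∀ v ∈ V, ‖v‖ = 1) ∧ V.card = n ∧
        (numDN V : ℝ) = 17 / 4 * n - 6 := by
  obtain ⟨ι, _, _, C, h1, k, hk⟩ := exists_big N
  refine ⟨C.V.card, h1, C.V.image toE, ?_, Finset.card_image_of_injective _ toE_inj, ?_⟩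
  · intro w hw
    obtain ⟨v, hv, rfl⟩ := Finset.mem_image.1 hw
    exact toE_norm (C.sph v hv)
  · have hc := C.cnt
    have h : numDN (C.V.image toE) = k := by
      unfold numDN
      rw [dn_card C, hk]; omega
    rw [h]
    have h2 : 4 * k + 24 = 17 * C.V.card := by omega
    have h3 : (4 * k + 24 : ℝ) = 17 * (C.V.card : ℝ) := by exact_mod_cast h2
    linarith
end
end

section
/- For every even integer k ≥ 4 and every integer m ≥ 1, there exists a finite set V on the unit sphere S² ⊆ ℝ³ with |V| = 2(2^m − 1)k and N(V) = (17/4)|V| − (3/2)k. -/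
open scoped RealInnerProductSpace Classical

noncomputable section

structure Dat where
  k : ℕ
  m : ℕ
  hk : 4 ≤ k
  hke : Even k
  hm : 1 ≤ m
  r : ℕ → ℝ
  x : ℕ → ℝ
  z : ℕ → ℝ
  s : ℝ
  hs : 0 < s
  hrs : ∀ i, r i * Real.sin (Real.pi / ((2 ^ i * k : ℕ) : ℝ)) = s
  hrx : ∀ i, r i * Real.cos (Real.pi / ((2 ^ i * k : ℕ) : ℝ)) = x i
  hz : ∀ i < m, 0 < z i
  hrz : ∀ i < m, r i ^ 2 + z i ^ 2 = 1

/-- basic trig facts -/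
lemma sin_gt_of_between (N : ℕ) (t : ℤ) (h1 : 1 < t) (h2 : t < N - 1) :
    Real.sin (Real.pi / N) < Real.sin (t * (Real.pi / N)) := by
  have hN : (0:ℝ) < N := by
    have : (0:ℤ) < N := by omega
    exact_mod_cast this
  have hp := Real.pi_pos
  set h := Real.pi / N with hh
  have hNh : N * h = Real.pi := by rw [hh]; field_simp
  have hh0 : 0 < h := by positivity
  have h1' : (1:ℝ) < t := by exact_mod_cast h1
  have h2' : (t:ℝ) < N - 1 := by exact_mod_cast h2
  rcases le_total ((t:ℝ) * h) (Real.pi / 2) with hc | hc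
  · apply Real.sin_lt_sin_of_lt_of_le_pi_div_two <;> nlinarith
  · rw [← Real.sin_pi_sub (t * h)]
    apply Real.sin_lt_sin_of_lt_of_le_pi_div_two <;> nlinarith

lemma sin_ge_of_between (N : ℕ) (t : ℤ) (h1 : 1 ≤ t) (h2 : t ≤ N - 1) :
    Real.sin (Real.pi / N) ≤ Real.sin (t * (Real.pi / N)) := by
  rcases eq_or_lt_of_le h1 with h | h
  · subst h; simp
  rcases eq_or_lt_of_le h2 with h' | h'
  · have hN : (0:ℝ) < N := by
      have : (0:ℤ) < N := by omega
      exact_mod_cast this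
    have : (t:ℝ) = N - 1 := by exact_mod_cast h'
    rw [this, show ((N:ℝ) - 1) * (Real.pi / N) = Real.pi - Real.pi / N by field_simp,
      Real.sin_pi_sub]
  · exact (sin_gt_of_between N t h h').le

lemma sin_sq_ge (N : ℕ) (hN : 0 < N) (u : ℤ) (hu : ¬ (N:ℤ) ∣ u) :
    Real.sin (Real.pi / N) ^ 2 ≤ Real.sin (u * (Real.pi / N)) ^ 2 := by
  have hN' : (0:ℝ) < N := by exact_mod_cast hN
  have h0 : 0 ≤ Real.sin (Real.pi / N) := by
    apply Real.sin_nonneg_of_nonneg_of_le_pi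
    · positivity
    · apply div_le_self Real.pi_pos.le; exact_mod_cast hN
  have hm := Int.emod_add_mul_ediv u N
  have hlt : u % N < N := Int.emod_lt_of_pos u (by exact_mod_cast hN)
  have hge : 0 ≤ u % N := Int.emod_nonneg u (by omega)
  have hne : u % N ≠ 0 := fun h => hu (Int.dvd_of_emod_eq_zero h)
  have key := sin_ge_of_between N (u % N) (by omega) (by omega)
  have e : (u:ℝ) * (Real.pi / N) = ((u % N : ℤ):ℝ) * (Real.pi / N) + (u / N : ℤ) * Real.pi := by
    have : (u:ℝ) = ((u % N : ℤ):ℝ) + N * ((u / N : ℤ):ℝ) := by exact_mod_cast hm.symm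
    rw [this]; field_simp
  rw [e, Real.sin_add_int_mul_pi, mul_pow]
  have : (((-1:ℝ)) ^ (u / N : ℤ)) ^ 2 = 1 := by
    rw [← zpow_natCast, ← zpow_mul, mul_comm, zpow_mul]; norm_num
  rw [this, one_mul]
  exact pow_le_pow_left₀ h0 key 2

namespace Dat
variable (D : Dat)

def n (i : ℕ) : ℕ := 2 ^ i * D.k
def h (i : ℕ) : ℝ := Real.pi / (D.n i : ℝ)
def th (i : ℕ) (a : ℤ) : ℝ := (2 * a + 1) * D.h i

lemma n_ge (i : ℕ) : 4 ≤ D.n i := by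
  have := Nat.one_le_two_pow (n := i)
  have := D.hk
  unfold n; nlinarith

lemma n_succ (i : ℕ) : D.n (i+1) = 2 * D.n i := by unfold n; rw [pow_succ]; ring

lemma n_add (i d : ℕ) : D.n (i+d) = 2 ^ d * D.n i := by unfold n; rw [pow_add]; ring

lemma n_even (i : ℕ) : Even (D.n i) := by unfold n; exact D.hke.mul_left _

lemma n_pos (i : ℕ) : (0:ℝ) < D.n i := by
  have := D.n_ge i
  have : 0 < D.n i := by omega
  exact_mod_cast this

lemma h_pos (i : ℕ) : 0 < D.h i := div_pos Real.pi_pos (D.n_pos i)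

lemma n_mul_h (i : ℕ) : D.n i * D.h i = Real.pi := by
  have := D.n_pos i
  unfold h; field_simp

lemma h_le (i : ℕ) : D.h i ≤ Real.pi / 4 := by
  have := D.n_ge i
  have : (4:ℝ) ≤ D.n i := by exact_mod_cast this
  have := D.n_mul_h i
  have := D.h_pos i
  nlinarith

lemma h_succ (i : ℕ) : D.h i = 2 * D.h (i+1) := by
  have := D.n_pos i
  unfold h; rw [n_succ]; push_cast; field_simp

lemma h_add (i d : ℕ) : D.h i = 2 ^ d * D.h (i+d) := by
  have := D.n_pos i
  unfold h; rw [n_add]; push_cast; field_simp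

lemma sin_pos (i : ℕ) : 0 < Real.sin (D.h i) :=
  Real.sin_pos_of_pos_of_lt_pi (D.h_pos i) (by linarith [D.h_le i, Real.pi_pos])

lemma cos_ge (i : ℕ) : √2 / 2 ≤ Real.cos (D.h i) := by
  rw [← Real.cos_pi_div_four]
  exact Real.cos_le_cos_of_nonneg_of_le_pi (D.h_pos i).le (by linarith [Real.pi_pos]) (D.h_le i)

lemma cos_ge_half (i : ℕ) : 1 / 2 ≤ Real.cos (D.h i) := by
  have : 1 ≤ √2 := by rw [Real.one_le_sqrt]; norm_num
  linarith [D.cos_ge i]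

lemma cos_pos (i : ℕ) : 0 < Real.cos (D.h i) := by linarith [D.cos_ge_half i]

lemma rs (i : ℕ) : D.r i * Real.sin (D.h i) = D.s := D.hrs i
lemma rx (i : ℕ) : D.r i * Real.cos (D.h i) = D.x i := D.hrx i

lemma r_pos (i : ℕ) : 0 < D.r i := by
  have := D.rs i
  have := D.hs
  have := D.sin_pos i
  by_contra hc
  push Not at hc
  nlinarith

lemma r_sq (i : ℕ) : D.r i ^ 2 = D.x i ^ 2 + D.s ^ 2 := by
  rw [← D.rs i, ← D.rx i]
  linear_combination (-(D.r i)^2) * Real.sin_sq_add_cos_sq (D.h i)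

lemma x_pos (i : ℕ) : 0 < D.x i := by
  rw [← D.rx i]; exact mul_pos (D.r_pos i) (D.cos_pos i)

lemma x_lt_r (i : ℕ) : D.x i < D.r i := by
  nlinarith [D.r_sq i, D.x_pos i, D.r_pos i, D.hs]

lemma s_le_x (i : ℕ) : D.s ≤ D.x i := by
  rw [← D.rs i, ← D.rx i]
  apply mul_le_mul_of_nonneg_left _ (D.r_pos i).le
  calc Real.sin (D.h i) ≤ Real.sin (Real.pi/4) := by
        apply Real.sin_le_sin_of_le_of_le_pi_div_two <;> linarith [D.h_pos i, D.h_le i, Real.pi_pos]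
    _ = √2 / 2 := Real.sin_pi_div_four
    _ ≤ _ := D.cos_ge i

lemma x_succ (i : ℕ) : D.x (i+1) = D.x i + D.r i := by
  have e1 := D.rs i
  have e2 := D.rs (i+1)
  have s1 := D.sin_pos (i+1)
  have c1 := D.cos_pos (i+1)
  rw [← D.rx i, ← D.rx (i+1)]
  rw [D.h_succ i, Real.sin_two_mul] at e1
  rw [D.h_succ i, Real.cos_two_mul]
  have : D.r (i+1) = D.r i * (2 * Real.cos (D.h (i+1))) := by
    apply mul_right_cancel₀ s1.ne'
    linarith
  rw [this]; ring

lemma x_mono {i j : ℕ} (hij : i ≤ j) : D.x i ≤ D.x j :=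
  monotone_nat_of_le_succ (fun i => by rw [x_succ]; linarith [D.r_pos i]) hij

lemma r_strictMono : StrictMono D.r := by
  apply strictMono_nat_of_lt_succ
  intro i
  have := D.x_lt_r (i+1)
  rw [x_succ] at this
  linarith [D.x_pos i]

lemma r_mono {i j : ℕ} (hij : i ≤ j) : D.r i ≤ D.r j := D.r_strictMono.monotone hij

lemma r_add_s_le {l i : ℕ} (hl : l < i) : D.r l + D.s ≤ D.x i := by
  have h1 : D.x (l+1) ≤ D.x i := D.x_mono hl
  rw [x_succ] at h1
  linarith [D.s_le_x l]

lemma r_ge_add {l i : ℕ} (hl : i + 2 ≤ l) : D.r i + D.r (i+1) ≤ D.r l := by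
  have h1 : D.x (i+2) ≤ D.x l := D.x_mono hl
  have := D.x_succ (i+1)
  have := D.x_succ i
  linarith [D.x_lt_r l, D.x_pos i]

lemma z_anti {i j : ℕ} (hij : i ≤ j) (hj : j < D.m) : D.z j ≤ D.z i := by
  have := D.hrz i (by omega)
  have := D.hrz j hj
  have := D.hz i (by omega)
  have := D.hz j hj
  nlinarith [D.r_mono hij, D.r_pos i]

lemma z_anti_strict {i j : ℕ} (hij : i < j) (hj : j < D.m) : D.z j < D.z i := by
  have := D.hrz i (by omega)
  have := D.hrz j hj
  have := D.hz i (by omega)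
  have := D.hz j hj
  nlinarith [D.r_strictMono hij, D.r_pos i]

/-- frame coordinates -/
def X (μ : ℝ) (i : ℕ) (a : ℤ) : ℝ := D.r i * Real.cos (D.th i a - μ)
def Y (μ : ℝ) (i : ℕ) (a : ℤ) : ℝ := D.r i * Real.sin (D.th i a - μ)

lemma XY (μ : ℝ) (i : ℕ) (a : ℤ) : D.X μ i a ^ 2 + D.Y μ i a ^ 2 = D.r i ^ 2 := by
  unfold X Y
  linear_combination (D.r i)^2 * Real.sin_sq_add_cos_sq (D.th i a - μ)

lemma X_le (μ : ℝ) (i : ℕ) (a : ℤ) : D.X μ i a ≤ D.r i := by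
  nlinarith [D.XY μ i a, D.r_pos i, sq_nonneg (D.Y μ i a)]

def G (i : ℕ) (a : ℤ) (e : ℝ) (j : ℕ) (b : ℤ) (f : ℝ) (l : ℕ) (c : ℤ) (t : ℝ) : ℝ :=
  (D.X 0 l c - D.X 0 i a) * (D.X 0 l c - D.X 0 j b) +
  (D.Y 0 l c - D.Y 0 i a) * (D.Y 0 l c - D.Y 0 j b) +
  (t * D.z l - e * D.z i) * (t * D.z l - f * D.z j)

lemma G_frame (μ : ℝ) (i : ℕ) (a : ℤ) (e : ℝ) (j : ℕ) (b : ℤ) (f : ℝ) (l : ℕ) (c : ℤ) (t : ℝ) :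
    D.G i a e j b f l c t = (D.X μ l c - D.X μ i a) * (D.X μ l c - D.X μ j b) +
  (D.Y μ l c - D.Y μ i a) * (D.Y μ l c - D.Y μ j b) +
  (t * D.z l - e * D.z i) * (t * D.z l - f * D.z j) := by
  unfold G X Y
  simp only [sub_zero, Real.cos_sub, Real.sin_sub]
  generalize Real.cos (D.th i a) = c1
  generalize Real.sin (D.th i a) = s1
  generalize Real.cos (D.th j b) = c2
  generalize Real.sin (D.th j b) = s2
  generalize Real.cos (D.th l c) = c3
  generalize Real.sin (D.th l c) = s3
  linear_combination (-((D.r l * c3 - D.r i * c1) * (D.r l * c3 - D.r j * c2) +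
    (D.r l * s3 - D.r i * s1) * (D.r l * s3 - D.r j * s2))) * Real.sin_sq_add_cos_sq μ

def Gab (i : ℕ) (a : ℤ) (e : ℝ) (j : ℕ) (b : ℤ) (f : ℝ) : Prop :=
  ∀ l < D.m, ∀ c : ℤ, ∀ t : ℝ, (t = 1 ∨ t = -1) → 0 ≤ D.G i a e j b f l c t

lemma G_symm (i : ℕ) (a : ℤ) (e : ℝ) (j : ℕ) (b : ℤ) (f : ℝ) (l : ℕ) (c : ℤ) (t : ℝ) :
    D.G i a e j b f l c t = D.G j b f i a e l c t := by unfold G; ring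

lemma Gab_symm {i : ℕ} {a : ℤ} {e : ℝ} {j : ℕ} {b : ℤ} {f : ℝ} (hg : D.Gab i a e j b f) :
    D.Gab j b f i a e := by
  intro l hl c t ht
  rw [G_symm]; exact hg l hl c t ht

/-- frame values -/
lemma X_plus (i : ℕ) (a : ℤ) : D.X (2 * a * D.h i) i a = D.x i := by
  unfold X th; rw [← D.rx i]; congr 2; ring
lemma Y_plus (i : ℕ) (a : ℤ) : D.Y (2 * a * D.h i) i a = D.s := by
  unfold Y th; rw [← D.rs i]; congr 2; ring
lemma X_minus (i : ℕ) (a b : ℤ) (hb : b = a + 1) : D.X (2 * b * D.h i) i a = D.x i := by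
  subst hb
  unfold X th; rw [← D.rx i, ← Real.cos_neg]; congr 2; push_cast; ring
lemma Y_minus (i : ℕ) (a b : ℤ) (hb : b = a + 1) : D.Y (2 * b * D.h i) i a = -D.s := by
  subst hb
  unfold Y th; rw [← D.rs i, ← mul_neg, ← Real.sin_neg]; congr 2; push_cast; ring

lemma mu_succ (i : ℕ) (b : ℤ) : 2 * (b:ℝ) * D.h i = 2 * ((2 * b : ℤ):ℝ) * D.h (i+1) := by
  rw [D.h_succ i]; push_cast; ring

lemma Y_sq (i : ℕ) (b : ℤ) (l : ℕ) (hl : i ≤ l) (c : ℤ) : D.s ^ 2 ≤ D.Y (2 * b * D.h i) l c ^ 2 := by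
  obtain ⟨d, rfl⟩ := Nat.exists_eq_add_of_le hl
  have e : D.th (i+d) c - 2 * b * D.h i = ((2 * c + 1 - 2 * b * 2 ^ d : ℤ):ℝ) * D.h (i+d) := by
    unfold th; rw [D.h_add i d]; push_cast; ring
  unfold Y
  rw [e, ← D.rs (i+d), mul_pow, mul_pow]
  apply mul_le_mul_of_nonneg_left _ (sq_nonneg _)
  apply sin_sq_ge
  · have := D.n_ge (i+d); omega
  · intro hd
    have h2 : (2:ℤ) ∣ D.n (i+d) := by
      obtain ⟨w, hw⟩ := D.n_even (i+d)
      exact ⟨w, by rw [hw]; push_cast; ring⟩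
    have h3 := h2.trans hd
    have : (2:ℤ) ∣ 2 * b * 2 ^ d := ⟨b * 2^d, by ring⟩
    omega

lemma X_le_x (i : ℕ) (b : ℤ) (l : ℕ) (hl : i ≤ l) (c : ℤ) : D.X (2 * b * D.h i) l c ≤ D.x l := by
  nlinarith [D.Y_sq i b l hl c, D.XY (2 * b * D.h i) l c, D.r_sq l, D.x_pos l]

lemma X_le_x' (i : ℕ) (b : ℤ) (l : ℕ) (hl : l < i) (c : ℤ) :
    D.X (2 * b * D.h i) l c ≤ D.x i - D.s := by
  linarith [D.X_le (2 * b * D.h i) l c, D.r_add_s_le hl]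

/-- chord between points in the same ring -/
lemma chord (μ : ℝ) (i : ℕ) (a c : ℤ) (hn : ¬ (D.n i : ℤ) ∣ c - a) :
    4 * D.s ^ 2 ≤ (D.X μ i c - D.X μ i a) ^ 2 + (D.Y μ i c - D.Y μ i a) ^ 2 := by
  have e : (D.X μ i c - D.X μ i a) ^ 2 + (D.Y μ i c - D.Y μ i a) ^ 2
      = 4 * (D.r i) ^ 2 * Real.sin ((c - a : ℤ) * D.h i) ^ 2 := by
    have e1 : Real.sin ((c - a : ℤ) * D.h i) ^ 2 =
      1 / 2 - Real.cos ((D.th i c - μ) - (D.th i a - μ)) / 2 := by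
      rw [Real.sin_sq_eq_half_sub]; congr 3; unfold th; push_cast; ring
    rw [e1, Real.cos_sub]
    unfold X Y
    linear_combination (D.r i)^2 * Real.sin_sq_add_cos_sq (D.th i c - μ) +
      (D.r i)^2 * Real.sin_sq_add_cos_sq (D.th i a - μ)
  rw [e, ← D.rs i]
  have := sin_sq_ge (D.n i) (by have := D.n_ge i; omega) (c - a) hn
  have h2 : 0 ≤ (D.r i)^2 := sq_nonneg _
  change Real.sin (D.h i)^2 ≤ Real.sin ((c - a : ℤ) * D.h i) ^ 2 at this
  nlinarith

lemma periodicX (μ : ℝ) (i : ℕ) (a c : ℤ) (hn : (D.n i : ℤ) ∣ c - a) :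
    D.X μ i c = D.X μ i a ∧ D.Y μ i c = D.Y μ i a := by
  obtain ⟨w, hw⟩ := hn
  have : D.th i c - μ = D.th i a - μ + w * (2 * Real.pi) := by
    rw [← D.n_mul_h i]
    have : (c:ℝ) = a + D.n i * w := by
      have : c = a + D.n i * w := by omega
      exact_mod_cast this
    unfold th; rw [this]; ring
  unfold X Y
  rw [this, Real.cos_add_int_mul_two_pi, Real.sin_add_int_mul_two_pi]
  exact ⟨rfl, rfl⟩

end Dat

namespace Dat
variable (D : Dat)

lemma pos_self (i : ℕ) (a : ℤ) (e : ℝ) : D.Gab i a e i a e := by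
  intro l hl c t ht
  unfold G
  nlinarith [sq_nonneg (D.X 0 l c - D.X 0 i a), sq_nonneg (D.Y 0 l c - D.Y 0 i a),
    sq_nonneg (t * D.z l - e * D.z i)]

lemma pos_edge (i : ℕ) (a : ℤ) (e : ℝ) : D.Gab i a e i (a+1) e := by
  intro l hl c t ht
  rw [D.G_frame (2 * ((a+1:ℤ):ℝ) * D.h i), D.X_minus i a (a+1) rfl, D.Y_minus i a (a+1) rfl, D.X_plus,
    D.Y_plus]
  have hs := D.hs
  rcases le_or_gt i l with h | h
  · have := D.Y_sq i (a+1) l h c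
    nlinarith [sq_nonneg (D.X (2 * ((a+1:ℤ):ℝ) * D.h i) l c - D.x i), sq_nonneg (t * D.z l - e * D.z i)]
  · have := D.X_le_x' i (a+1) l h c
    nlinarith [sq_nonneg (D.Y (2 * ((a+1:ℤ):ℝ) * D.h i) l c), sq_nonneg (t * D.z l - e * D.z i)]

lemma opp_XY (i : ℕ) (a : ℤ) (w : ℤ) (hw : (D.n i : ℤ) = 2 * w) :
    D.X 0 i (a + w) = - D.X 0 i a ∧ D.Y 0 i (a+w) = - D.Y 0 i a := by
  have e : D.th i (a+w) - 0 = D.th i a - 0 + Real.pi := by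
    rw [← D.n_mul_h i]
    have : (D.n i : ℝ) = 2 * w := by exact_mod_cast hw
    rw [this]; unfold th; push_cast; ring
  unfold X Y
  rw [e, Real.cos_add_pi, Real.sin_add_pi]
  constructor <;> ring

lemma G_opp (i : ℕ) (hi : i < D.m) (a : ℤ) (e : ℝ) (he : e = 1 ∨ e = -1) (w : ℤ)
    (hw : (D.n i : ℤ) = 2 * w) (l : ℕ) (hl : l < D.m) (c : ℤ) (t : ℝ) (ht : t = 1 ∨ t = -1) :
    D.G i a e i (a+w) e l c t = 2 * D.z i ^ 2 - 2 * (t * e) * (D.z l * D.z i) := by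
  obtain ⟨h1, h2⟩ := D.opp_XY i a w hw
  unfold G
  rw [h1, h2]
  have q1 := D.XY 0 l c
  have q2 := D.XY 0 i a
  have q3 := D.hrz l hl
  have q4 := D.hrz i hi
  have he2 : e ^ 2 = 1 := by rcases he with h | h <;> rw [h] <;> norm_num
  have ht2 : t ^ 2 = 1 := by rcases ht with h | h <;> rw [h] <;> norm_num
  linear_combination q1 - q2 + q3 - q4 + (D.z l)^2 * ht2 + (D.z i)^2 * he2

lemma pos_opp (a : ℤ) (e : ℝ) (he : e = 1 ∨ e = -1) (w : ℤ)
    (hw : (D.n 0 : ℤ) = 2 * w) : D.Gab 0 a e 0 (a+w) e := by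
  intro l hl c t ht
  have hm := D.hm
  rw [D.G_opp 0 (by omega) a e he w hw l hl c t ht]
  have := D.z_anti (Nat.zero_le l) hl
  have := D.hz l hl
  have := D.hz 0 (by omega)
  rcases he with h | h <;> rcases ht with h' | h' <;> rw [h, h'] <;> nlinarith

lemma pos_cross0 (i : ℕ) (hi : i + 1 = D.m) (a : ℤ) (e : ℝ) (he : e = 1 ∨ e = -1) :
    D.Gab i a e i a (-e) := by
  intro l hl c t ht
  rw [D.G_frame (D.th i a)]
  have e1 : D.X (D.th i a) i a = D.r i := by unfold X; simp
  have e2 : D.Y (D.th i a) i a = 0 := by unfold Y; simp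
  rw [e1, e2]
  have q1 := D.XY (D.th i a) l c
  have q3 := D.hrz l hl
  have q4 := D.hrz i (by omega)
  have he2 : e ^ 2 = 1 := by rcases he with h | h <;> rw [h] <;> norm_num
  have ht2 : t ^ 2 = 1 := by rcases ht with h | h <;> rw [h] <;> norm_num
  have := D.X_le (D.th i a) l c
  have := D.r_mono (show l ≤ i by omega)
  have := D.r_pos i
  have : (D.X (D.th i a) l c - D.r i) * (D.X (D.th i a) l c - D.r i) +
      (D.Y (D.th i a) l c - 0) * (D.Y (D.th i a) l c - 0) +
      (t * D.z l - e * D.z i) * (t * D.z l - -e * D.z i) =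
      2 * D.r i * (D.r i - D.X (D.th i a) l c) := by
    linear_combination q1 + q3 - q4 + (D.z l)^2 * ht2 - (D.z i)^2 * he2
  rw [this]
  apply mul_nonneg <;> linarith

lemma pos_cross1 (i : ℕ) (hi : i + 1 = D.m) (a : ℤ) (e : ℝ) (he : e = 1 ∨ e = -1) :
    D.Gab i a e i (a+1) (-e) := by
  intro l hl c t ht
  rw [D.G_frame (2 * ((a+1:ℤ):ℝ) * D.h i), D.X_minus i a (a+1) rfl, D.Y_minus i a (a+1) rfl, D.X_plus,
    D.Y_plus]
  have hX : D.X (2 * ((a+1:ℤ):ℝ) * D.h i) l c ≤ D.x i := by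
    rcases lt_or_eq_of_le (show l ≤ i by omega) with h | h
    · linarith [D.X_le_x' i (a+1) l h c, D.hs]
    · subst h; exact D.X_le_x l (a+1) l le_rfl c
  have q1 := D.XY (2 * ((a+1:ℤ):ℝ) * D.h i) l c
  generalize D.X (2 * ((a+1:ℤ):ℝ) * D.h i) l c = X at *
  generalize D.Y (2 * ((a+1:ℤ):ℝ) * D.h i) l c = Y at *
  have q3 := D.hrz l hl
  have q4 := D.hrz i (by omega)
  have q5 := D.r_sq i
  have he2 : e ^ 2 = 1 := by rcases he with h | h <;> rw [h] <;> norm_num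
  have ht2 : t ^ 2 = 1 := by rcases ht with h | h <;> rw [h] <;> norm_num
  have : (X - D.x i) * (X - D.x i) + (Y - -D.s) * (Y - D.s) +
    (t * D.z l - e * D.z i) * (t * D.z l - -e * D.z i) = 2 * D.x i * (D.x i - X) := by
    linear_combination q1 + q3 - q4 + (D.z l)^2 * ht2 - (D.z i)^2 * he2 + q5
  rw [this]
  have := D.x_pos i
  apply mul_nonneg <;> linarith

lemma zterm (i : ℕ) (hi : i + 1 < D.m) (l : ℕ) (hl : l < D.m) (e t : ℝ)
    (he : e = 1 ∨ e = -1) (ht : t = 1 ∨ t = -1) :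
    0 ≤ (t * D.z l - e * D.z i) * (t * D.z l - e * D.z (i+1)) := by
  have p1 := D.hz l hl
  have p2 := D.hz i (by omega)
  have p3 := D.hz (i+1) hi
  have p4 := D.z_anti (show i ≤ i+1 by omega) hi
  have key : 0 ≤ (D.z l - D.z i) * (D.z l - D.z (i+1)) := by
    rcases le_or_gt l i with h | h
    · have := D.z_anti h (by omega)
      apply mul_nonneg <;> linarith
    · have := D.z_anti (show i+1 ≤ l from h) hl
      apply mul_nonneg_of_nonpos_of_nonpos <;> linarith
  rcases he with h | h <;> rcases ht with h' | h' <;> rw [h, h'] <;> nlinarith [mul_pos p1 p2, mul_pos p1 p3, mul_pos p2 p3]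

/-- diagonals of a rectangle, planar part -/
lemma diag_planar (i : ℕ) (b : ℤ) (l : ℕ) (c : ℤ) (v : ℝ) (hv : v = 1 ∨ v = -1) :
    0 ≤ (D.X (2 * b * D.h i) l c - D.x i) * (D.X (2 * b * D.h i) l c - D.x (i+1)) +
      (D.Y (2 * b * D.h i) l c - v * D.s) * (D.Y (2 * b * D.h i) l c - (-v) * D.s) := by
  have hs := D.hs
  have hv2 : v ^ 2 = 1 := by rcases hv with h | h <;> rw [h] <;> norm_num
  have e : (D.Y (2 * b * D.h i) l c - v * D.s) * (D.Y (2 * b * D.h i) l c - (-v) * D.s) =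
    D.Y (2 * b * D.h i) l c ^ 2 - D.s ^ 2 := by linear_combination (-D.s^2) * hv2
  rw [e]
  have x1 := D.x_mono (show i ≤ i+1 by omega)
  have x0 := D.x_pos i
  rcases le_or_gt i l with h | h
  · have q0 := D.X_le_x i b l h c
    have q1 := D.XY (2 * b * D.h i) l c
    have q2 := D.r_sq l
    have key : 0 ≤ (D.x l - D.x i) * (D.x l - D.x (i+1)) := by
      rcases eq_or_lt_of_le h with h | h
      · subst h; simp
      · have := D.x_mono (show i+1 ≤ l from h)
        apply mul_nonneg <;> linarith
    nlinarith
  · have q0 := D.X_le_x' i b l h c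
    nlinarith [sq_nonneg (D.Y (2 * b * D.h i) l c)]

/-- sides of a rectangle, planar part -/
lemma vert_planar (i : ℕ) (b : ℤ) (l : ℕ) (c : ℤ) (v : ℝ) (hv : v = 1 ∨ v = -1) (q : ℤ)
    (hqx : D.X (2 * b * D.h i) (i+1) q = D.x (i+1)) (hqy : D.Y (2 * b * D.h i) (i+1) q = v * D.s) :
    0 ≤ (D.X (2 * b * D.h i) l c - D.x i) * (D.X (2 * b * D.h i) l c - D.x (i+1)) +
      (D.Y (2 * b * D.h i) l c - v * D.s) * (D.Y (2 * b * D.h i) l c - v * D.s) := by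
  have hs := D.hs
  have hv2 : v ^ 2 = 1 := by rcases hv with h | h <;> rw [h] <;> norm_num
  have x1 := D.x_mono (show i ≤ i+1 by omega)
  have x0 := D.x_pos i
  have x2 := D.x_succ i
  have r0 := D.r_pos i
  have q1 := D.XY (2 * b * D.h i) l c
  have q2 := D.r_sq l
  rcases lt_trichotomy l (i+1) with h | h | h
  · have hX : D.X (2 * b * D.h i) l c ≤ D.x i := by
      rcases lt_or_eq_of_le (show l ≤ i by omega) with h | h
      · linarith [D.X_le_x' i b l h c, D.hs]
      · subst h; exact D.X_le_x l b l le_rfl c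
    nlinarith [sq_nonneg (D.Y (2 * b * D.h i) l c - v * D.s)]
  · subst h
    by_cases hd : (D.n (i+1) : ℤ) ∣ c - q
    · obtain ⟨e1, e2⟩ := D.periodicX (2 * b * D.h i) (i+1) q c hd
      rw [e1, e2, hqx, hqy]; simp
    · have hc := D.chord (2 * b * D.h i) (i+1) q c hd
      rw [hqx, hqy] at hc
      generalize D.X (2 * b * D.h i) (i+1) c = X at *
      generalize D.Y (2 * b * D.h i) (i+1) c = Y at *
      -- d² = u² + w²
      obtain ⟨u, hu⟩ : ∃ u, u = D.x (i+1) - X := ⟨_, rfl⟩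
      obtain ⟨w, hw⟩ : ∃ w, w = v * Y - D.s := ⟨_, rfl⟩
      have hY : Y = v * (w + D.s) := by rw [hw]; linear_combination (-Y) * hv2
      have hX : X = D.x (i+1) - u := by rw [hu]; ring
      have d1 : u ^ 2 + w ^ 2 = 2 * (D.x (i+1) * u - D.s * w) := by
        subst hX; rw [hY] at q1
        linear_combination q1 + q2 - (w + D.s)^2 * hv2
      have d2 : 4 * D.s ^ 2 ≤ u ^ 2 + w ^ 2 := by
        subst hX; rw [hY] at hc
        have : (D.x (i+1) - u - D.x (i+1)) ^ 2 + (v * (w + D.s) - v * D.s) ^ 2 = u^2 + w^2 := by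
          linear_combination w^2 * hv2
        linarith
      have d3 : D.x (i+1) * u ≤ u ^ 2 + w ^ 2 := by
        nlinarith [sq_nonneg (2 * D.s - w), sq_nonneg u]
      have : (X - D.x i) * (X - D.x (i+1)) + (Y - v * D.s) * (Y - v * D.s) =
          u ^ 2 + w ^ 2 - D.r i * u := by
        rw [hX, hY, x2]; linear_combination w^2 * hv2
      rw [this]
      have hr : D.r i ≤ D.x (i+1) := by linarith
      rcases le_total 0 u with h | h <;> nlinarith [sq_nonneg u, sq_nonneg w]
  · have hr := D.r_ge_add (show i + 2 ≤ l from h)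
    have q3 := D.r_sq i
    have q4 := D.r_sq (i+1)
    have r1 := D.r_pos (i+1)
    have rl := D.r_pos l
    generalize D.X (2 * b * D.h i) l c = X at *
    generalize D.Y (2 * b * D.h i) l c = Y at *
    have c1 : X * D.x i + Y * (v * D.s) ≤ D.r l * D.r i := by
      apply le_of_sq_le_sq _ (by positivity)
      have : D.r l ^ 2 * D.r i ^ 2 = (X^2+Y^2) * (D.x i ^ 2 + (v * D.s)^2) := by
        rw [q1, q3]; linear_combination (-D.r l^2 * D.s^2) * hv2
      rw [mul_pow, this]
      nlinarith [sq_nonneg (X * (v * D.s) - Y * D.x i)]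
    have c2 : X * D.x (i+1) + Y * (v * D.s) ≤ D.r l * D.r (i+1) := by
      apply le_of_sq_le_sq _ (by positivity)
      have : D.r l ^ 2 * D.r (i+1) ^ 2 = (X^2+Y^2) * (D.x (i+1) ^ 2 + (v * D.s)^2) := by
        rw [q1, q4]; linear_combination (-D.r l^2 * D.s^2) * hv2
      rw [mul_pow, this]
      nlinarith [sq_nonneg (X * (v * D.s) - Y * D.x (i+1))]
    have c3 : D.r l * (D.r i + D.r (i+1)) ≤ D.r l * D.r l := mul_le_mul_of_nonneg_left hr rl.le
    have c4 : 0 ≤ D.x i * D.x (i+1) := by have := D.x_pos (i+1); positivity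
    nlinarith [sq_nonneg (v * D.s)]

lemma pos_next (i : ℕ) (hi : i + 1 < D.m) (a b : ℤ) (e : ℝ) (he : e = 1 ∨ e = -1)
    (hb : b = 2 * a - 1 ∨ b = 2 * a ∨ b = 2 * a + 1 ∨ b = 2 * a + 2) : D.Gab i a e (i+1) b e := by
  intro l hl c t ht
  have hz := D.zterm i hi l hl e t he ht
  rcases hb with hb | hb | hb | hb
  · rw [D.G_frame (2 * (a:ℝ) * D.h i), D.X_plus i a, D.Y_plus i a]
    have e1 : D.X (2 * (a:ℝ) * D.h i) (i+1) b = D.x (i+1) := by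
      rw [mu_succ]; exact D.X_minus _ _ _ (by omega)
    have e2 : D.Y (2 * (a:ℝ) * D.h i) (i+1) b = -D.s := by
      rw [mu_succ]; exact D.Y_minus _ _ _ (by omega)
    rw [e1, e2]
    have := D.diag_planar i a l c 1 (by simp)
    simp only [one_mul, neg_mul] at this
    linarith
  · rw [D.G_frame (2 * (a:ℝ) * D.h i), D.X_plus i a, D.Y_plus i a]
    have e1 : D.X (2 * (a:ℝ) * D.h i) (i+1) b = D.x (i+1) := by
      rw [mu_succ, hb]; exact D.X_plus _ _
    have e2 : D.Y (2 * (a:ℝ) * D.h i) (i+1) b = D.s := by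
      rw [mu_succ, hb]; exact D.Y_plus _ _
    rw [e1, e2]
    have := D.vert_planar i a l c 1 (by simp) b e1 (by rw [e2]; ring)
    simp only [one_mul] at this
    linarith
  · rw [D.G_frame (2 * ((a+1:ℤ):ℝ) * D.h i), D.X_minus i a _ rfl, D.Y_minus i a _ rfl]
    have e1 : D.X (2 * ((a+1:ℤ):ℝ) * D.h i) (i+1) b = D.x (i+1) := by
      rw [mu_succ]; exact D.X_minus _ _ _ (by omega)
    have e2 : D.Y (2 * ((a+1:ℤ):ℝ) * D.h i) (i+1) b = -D.s := by
      rw [mu_succ]; exact D.Y_minus _ _ _ (by omega)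
    rw [e1, e2]
    have := D.vert_planar i (a+1) l c (-1) (by simp) b e1 (by rw [e2]; ring)
    simp only [one_mul, neg_mul] at this
    linarith
  · rw [D.G_frame (2 * ((a+1:ℤ):ℝ) * D.h i), D.X_minus i a _ rfl, D.Y_minus i a _ rfl]
    have hb' : b = 2 * (a+1) := by omega
    have e1 : D.X (2 * ((a+1:ℤ):ℝ) * D.h i) (i+1) b = D.x (i+1) := by
      rw [mu_succ, hb']; exact D.X_plus _ _
    have e2 : D.Y (2 * ((a+1:ℤ):ℝ) * D.h i) (i+1) b = D.s := by
      rw [mu_succ, hb']; exact D.Y_plus _ _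
    rw [e1, e2]
    have := D.diag_planar i (a+1) l c (-1) (by simp)
    simp only [one_mul, neg_mul, neg_neg] at this
    linarith

end Dat

namespace Dat
variable (D : Dat)

lemma Gab_congr {i : ℕ} {a : ℤ} {e : ℝ} {j : ℕ} {b b' : ℤ} {f : ℝ} (hd : (D.n j : ℤ) ∣ b' - b)
    (hg : D.Gab i a e j b f) : D.Gab i a e j b' f := by
  intro l hl c t ht
  have := hg l hl c t ht
  obtain ⟨h1, h2⟩ := D.periodicX 0 j b b' hd
  unfold G at *
  rwa [h1, h2]

lemma diff_frame (i d : ℕ) (b c : ℤ) :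
    D.th (i+d) b - 2 * c * D.h i = ((2 * b + 1 - 2 * c * 2 ^ d : ℤ):ℝ) * D.h (i+d) := by
  unfold th; rw [D.h_add i d]; push_cast; ring

lemma neg1 (i d : ℕ) (hi : i < D.m) (a b : ℤ) (e f : ℝ) (he : e = 1 ∨ e = -1)
    (hg : D.Gab i a e (i+d) b f) (Δ : ℤ) (hΔ : Δ = 2 * b + 1 - (2 * a + 1) * 2 ^ d)
    (h1 : - (D.n (i+d) : ℤ) < Δ) (h2 : Δ ≤ D.n (i+d)) :
    (-(2 ^ d + 1) ≤ Δ ∧ Δ ≤ 2 ^ d + 1) ∨ (d = 0 ∧ Δ = D.n (i+d)) := by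
  have hs := D.hs
  have hr := D.r_pos (i+d)
  have hrs := D.rs (i+d)
  have hp : (1:ℤ) ≤ 2 ^ d := one_le_pow₀ (by norm_num)
  by_contra hcon
  push Not at hcon
  obtain ⟨hc1, hc2⟩ := hcon
  rcases le_or_gt 0 Δ with h0 | h0
  · have hc1' := hc1 (by omega)
    have := hg i hi (a+1) e he
    rw [D.G_frame (2 * ((a+1:ℤ):ℝ) * D.h i), D.X_minus i a (a+1) rfl, D.Y_minus i a (a+1) rfl,
      D.X_plus, D.Y_plus] at this
    have hY : D.Y (2 * ((a+1:ℤ):ℝ) * D.h i) (i+d) b ≤ D.s := by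
      by_contra hY
      push Not at hY
      nlinarith
    unfold Y at hY
    rw [diff_frame] at hY
    have hlt := sin_gt_of_between (D.n (i+d)) (2 * b + 1 - 2 * (a+1) * 2 ^ d)
      (by rw [hΔ] at hc1'; linarith) (by
        have e1 : 2 * b + 1 - 2 * (a+1) * 2 ^ d = Δ - 2 ^ d := by rw [hΔ]; ring
        rw [e1]
        by_contra hh
        push Not at hh
        have : (2:ℤ)^d = 1 := by omega
        have hd : d = 0 := by
          by_contra hd
          have : (2:ℤ) ^ d > 1 := one_lt_pow₀ (by norm_num) hd
          omega
        exact hc2 hd (by omega))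
    have := mul_lt_mul_of_pos_left hlt hr
    change D.r (i+d) * Real.sin (D.h (i+d)) < D.r (i+d) * Real.sin (_ * D.h (i+d)) at this
    linarith
  · have hc1' : Δ < -(2 ^ d + 1) := by
      by_contra hh
      have := hc1 (by omega)
      omega
    have := hg i hi (a-1) e he
    rw [D.G_frame (2 * (a:ℝ) * D.h i), D.X_minus i (a-1) a (by ring), D.Y_minus i (a-1) a (by ring),
      D.X_plus, D.Y_plus] at this
    have hY : -D.s ≤ D.Y (2 * (a:ℝ) * D.h i) (i+d) b := by
      by_contra hY
      push Not at hY
      nlinarith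
    unfold Y at hY
    rw [diff_frame] at hY
    have hlt := sin_gt_of_between (D.n (i+d)) (-(2 * b + 1 - 2 * a * 2 ^ d))
      (by rw [hΔ] at hc1'; linarith) (by
        have e1 : 2 * b + 1 - 2 * a * 2 ^ d = Δ + 2 ^ d := by rw [hΔ]; ring
        rw [e1]
        omega)
    have := mul_lt_mul_of_pos_left hlt hr
    change D.r (i+d) * Real.sin (D.h (i+d)) < D.r (i+d) * Real.sin (_ * D.h (i+d)) at this
    rw [Int.cast_neg, neg_mul, Real.sin_neg] at this
    linarith

lemma cos_bound (j : ℕ) (u B : ℤ) (h1 : -B ≤ u) (h2 : u ≤ B) (hB : B ≤ D.n j) :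
    Real.cos (B * D.h j) ≤ Real.cos (u * D.h j) := by
  have hh := D.h_pos j
  rw [← Real.cos_abs (u * D.h j), abs_mul, abs_of_pos hh]
  have hB' : (B:ℝ) ≤ D.n j := by exact_mod_cast hB
  have hu : |(u:ℝ)| ≤ B := by
    rw [abs_le]; exact ⟨by exact_mod_cast h1, by exact_mod_cast h2⟩
  apply Real.cos_le_cos_of_nonneg_of_le_pi
  · positivity
  · rw [← D.n_mul_h j]; exact mul_le_mul_of_nonneg_right hB' hh.le
  · exact mul_le_mul_of_nonneg_right hu hh.le

/-- the vertical witness -/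
lemma neg2_core (i d : ℕ) (hi : i + 1 < D.m) (hj : i + d < D.m) (a b c : ℤ) (e f : ℝ)
    (he : e = 1 ∨ e = -1) (hf : f = 1 ∨ f = -1) (v : ℝ) (μ : ℤ)
    (p1 : D.X (2 * μ * D.h i) i a = D.x i) (p2 : D.Y (2 * μ * D.h i) i a = v)
    (v1 : D.X (2 * μ * D.h i) (i+1) c = D.x (i+1)) (v2 : D.Y (2 * μ * D.h i) (i+1) c = v)
    (u : ℤ) (hu : u = 2 * b + 1 - 2 * μ * 2 ^ d)
    (hu0 : d = 0 → -1 ≤ u ∧ u ≤ 1) (hu1 : 1 ≤ d → -(2 ^ d - 1) ≤ u ∧ u ≤ 2 ^ d - 1)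
    (hcase : 2 ≤ d ∨ f = -e) (hg : D.Gab i a e (i+d) b f) : False := by
  have key := hg (i+1) hi c e he
  rw [D.G_frame (2 * (μ:ℝ) * D.h i), p1, p2, v1, v2] at key
  have hXQ : D.X (2 * (μ:ℝ) * D.h i) (i+d) b = D.r (i+d) * Real.cos (u * D.h (i+d)) := by
    unfold X; rw [diff_frame, hu]
  rw [hXQ] at key
  have rj := D.r_pos (i+d)
  have ri := D.r_pos i
  have xs := D.x_succ i
  have zz := D.z_anti_strict (show i < i+1 by omega) hi
  have zi := D.hz (i+1) hi
  have zj := D.hz (i+d) hj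
  have e2 : e ^ 2 = 1 := by rcases he with h | h <;> rw [h] <;> norm_num
  set Q := D.r (i+d) * Real.cos (u * D.h (i+d)) with hQ
  have key2 : 0 ≤ D.r i * (D.x (i+1) - Q) - (D.z i - D.z (i+1)) * (D.z (i+1) - (e * f) * D.z (i+d)) := by
    have : (D.x (i + 1) - D.x i) * (D.x (i + 1) - Q) + (v - v) * (v - D.Y (2 * ↑μ * D.h i) (i + d) b) +
      (e * D.z (i + 1) - e * D.z i) * (e * D.z (i + 1) - f * D.z (i + d)) =
       D.r i * (D.x (i+1) - Q) - (D.z i - D.z (i+1)) * (D.z (i+1) - (e * f) * D.z (i+d)) := by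
      rw [xs]
      linear_combination (D.z (i+1) - D.z i) * D.z (i+1) * e2
    linarith
  rcases Nat.eq_zero_or_pos d with hd | hd
  · subst hd
    obtain ⟨u1, u2⟩ := hu0 rfl
    have hfe : f = -e := by rcases hcase with h | h; omega; exact h
    have hcb := D.cos_bound (i+0) u 1 u1 u2 (by have := D.n_ge (i+0); omega)
    have hq : D.x i ≤ Q := by
      rw [← D.rx i, hQ]
      apply mul_le_mul_of_nonneg_left _ ri.le
      simpa using hcb
    rw [hfe] at key2
    have q1 := D.hrz i (by omega)
    have q2 := D.hrz (i+1) hi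
    have q3 := D.r_sq i
    have q4 := D.r_sq (i+1)
    have x0 := D.x_pos i
    have ee : e * -e = -1 := by linear_combination -e2
    rw [ee] at key2
    simp only [add_zero] at key2
    have : D.r i * (D.x (i+1) - Q) ≤ D.r i * D.r i := by
      apply mul_le_mul_of_nonneg_left _ ri.le; linarith
    rw [xs] at q4
    nlinarith [mul_pos x0 ri]
  · obtain ⟨u1, u2⟩ := hu1 hd
    have hp : (2:ℤ) ^ d ≤ D.n (i+d) := by
      rw [D.n_add]; push_cast
      have h4 : (4:ℤ) ≤ D.n i := by exact_mod_cast D.n_ge i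
      have : (1:ℤ) ≤ 2 ^ d := one_le_pow₀ (by norm_num)
      nlinarith
    have hcb := D.cos_bound (i+d) u (2^d-1) u1 u2 (by omega)
    have hq : D.x (i+1) ≤ Q := by
      rcases eq_or_lt_of_le (show 1 ≤ d from hd) with h | h
      · subst h
        rw [← D.rx (i+1), hQ]
        apply mul_le_mul_of_nonneg_left _ rj.le
        have e1 : (((2 ^ 1 - 1 : ℤ)) : ℝ) = 1 := by norm_num
        rw [e1, one_mul] at hcb; exact hcb
      · have hcb2 := D.cos_bound (i+d) u (2^d) (by omega) (by omega) hp
        have e1 : (((2 ^ d : ℤ)) : ℝ) * D.h (i+d) = D.h i := by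
          rw [D.h_add i d]; push_cast; ring
        rw [e1] at hcb2
        have hh := D.cos_ge_half i
        have w1 := D.x_mono (show i + 1 + 1 ≤ i + d by omega)
        have w2 := D.x_succ (i+1)
        have w3 := D.x_lt_r (i+d)
        have w4 := D.x_lt_r (i+1)
        rw [hQ]
        have : D.r (i+d) * (1/2) ≤ D.r (i+d) * Real.cos (u * D.h (i+d)) :=
          mul_le_mul_of_nonneg_left (by linarith) rj.le
        linarith
    have t1 : D.r i * (D.x (i+1) - Q) ≤ 0 := mul_nonpos_of_nonneg_of_nonpos ri.le (by linarith)
    have t2 : 0 < D.z (i+1) - (e * f) * D.z (i+d) := by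
      have hef : e * f = 1 ∨ f = -e := by
        rcases he with h | h <;> rcases hf with h' | h' <;> rw [h, h'] <;> norm_num
      rcases hef with h | h
      · rcases hcase with h' | h'
        · rw [h]
          have := D.z_anti_strict (show i+1 < i+d by omega) hj
          linarith
        · rw [h'] at h; nlinarith
      · rw [h]
        have : e * -e = -1 := by linear_combination -e2
        rw [this]; linarith
    nlinarith [mul_pos (sub_pos.mpr zz) t2]

lemma neg2 (i d : ℕ) (hi : i + 1 < D.m) (hj : i + d < D.m) (a b : ℤ) (e f : ℝ)
    (he : e = 1 ∨ e = -1) (hf : f = 1 ∨ f = -1) (Δ : ℤ) (hΔ : Δ = 2 * b + 1 - (2 * a + 1) * 2 ^ d)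
    (h1 : -(2 ^ d + 1) ≤ Δ) (h2 : Δ ≤ 2 ^ d + 1)
    (hcase : 2 ≤ d ∨ f = -e) (hg : D.Gab i a e (i+d) b f) : False := by
  have hpar : d = 0 ∨ ∃ w : ℤ, 1 ≤ w ∧ (2:ℤ) ^ d = 2 * w := by
    rcases Nat.eq_zero_or_pos d with h | h
    · exact Or.inl h
    · right
      refine ⟨2 ^ (d-1), one_le_pow₀ (by norm_num), ?_⟩
      rw [← pow_succ']; congr 1; omega
  have hodd : d = 0 ∨ Δ % 2 = 1 := by
    rcases hpar with h | ⟨w, _, hw⟩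
    · exact Or.inl h
    · right; rw [hΔ, hw]
      have : (2 * a + 1) * (2 * w) = 2 * ((2*a+1) * w) := by ring
      omega
  rcases le_or_gt 0 Δ with h0 | h0
  · refine D.neg2_core i d hi hj a b (2*a+1) e f he hf (-D.s) (a+1) (D.X_minus i a _ rfl)
      (D.Y_minus i a _ rfl) ?_ ?_ _ rfl ?_ ?_ hcase hg
    · rw [mu_succ]; exact D.X_minus _ _ _ (by ring)
    · rw [mu_succ]; exact D.Y_minus _ _ _ (by ring)
    · intro hd; subst hd; simp at *; omega
    · intro hd
      have e1 : 2 * b + 1 - 2 * (a + 1) * 2 ^ d = Δ - 2 ^ d := by rw [hΔ]; ring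
      rw [e1]
      rcases hpar with h | ⟨w, hw1, hw⟩
      · omega
      · omega
  · refine D.neg2_core i d hi hj a b (2*a) e f he hf (D.s) a (D.X_plus i a)
      (D.Y_plus i a) ?_ ?_ _ rfl ?_ ?_ hcase hg
    · rw [mu_succ]; exact D.X_plus _ _
    · rw [mu_succ]; exact D.Y_plus _ _
    · intro hd; subst hd; simp at *; omega
    · intro hd
      have e1 : 2 * b + 1 - 2 * a * 2 ^ d = Δ + 2 ^ d := by rw [hΔ]; ring
      rw [e1]
      rcases hpar with h | ⟨w, hw1, hw⟩
      · omega
      · omega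

/-- reduction modulo a full turn -/
lemma reduce (N : ℤ) (hN : 0 < N) (D0 b : ℤ) : ∃ b' : ℤ, N ∣ b' - b ∧
    -N < 2 * b' + 1 - D0 ∧ 2 * b' + 1 - D0 ≤ N := by
  set E := 2 * b + 1 - D0 + N - 1 with hE
  have h1 := Int.emod_add_mul_ediv E (2 * N)
  have h2 := Int.emod_nonneg E (show 2 * N ≠ 0 by omega)
  have h3 := Int.emod_lt_of_pos E (show 0 < 2 * N by omega)
  refine ⟨b - N * (E / (2 * N)), ⟨-(E / (2*N)), by ring⟩, ?_, ?_⟩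
  · have : 2 * N * (E / (2 * N)) = 2 * (N * (E / (2*N))) := by ring
    omega
  · have : 2 * N * (E / (2 * N)) = 2 * (N * (E / (2*N))) := by ring
    omega

/-- classification -/
lemma cls_same (i : ℕ) (hi : i < D.m) (a b : ℤ) (e : ℝ) (he : e = 1 ∨ e = -1) (w : ℤ)
    (hw : (D.n i : ℤ) = 2 * w) :
    D.Gab i a e i b e ↔ ((D.n i : ℤ) ∣ b - a ∨ (D.n i : ℤ) ∣ b - (a + 1) ∨
      (D.n i : ℤ) ∣ b - (a - 1) ∨ (i = 0 ∧ (D.n i : ℤ) ∣ b - (a + w))) := by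
  have n4 := D.n_ge i
  constructor
  · intro hg
    obtain ⟨b', hb, l1, l2⟩ := reduce (D.n i) (by omega) (2 * a + 1) b
    have hg' : D.Gab i a e (i+0) b' e := D.Gab_congr hb hg
    have hb2 : (D.n i : ℤ) ∣ b - b' := by rw [← dvd_neg]; simpa using hb
    have := D.neg1 i 0 hi a b' e e he hg' (2 * b' + 1 - (2 * a + 1)) (by ring) l1 l2
    rcases this with ⟨k1, k2⟩ | ⟨_, k⟩
    · norm_num at k1 k2
      have : b' = a ∨ b' = a + 1 ∨ b' = a - 1 := by omega
      rcases this with h | h | h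
      · left; rwa [← h]
      · right; left; rwa [← h]
      · right; right; left; rwa [← h]
    · right; right; right
      rw [add_zero] at k
      have hb3 : b' = a + w := by omega
      refine ⟨?_, by rwa [← hb3]⟩
      by_contra hi0
      have hm := D.hm
      have := hg' 0 (by omega) 0 e he
      rw [hb3] at this
      have h2 := D.G_opp i hi a e he w hw 0 (by omega) 0 e he
      rw [add_zero, h2] at this
      have z0 := D.z_anti_strict (show 0 < i by omega) hi
      have zi := D.hz i hi
      have e2 : e * e = 1 := by rcases he with h | h <;> rw [h] <;> norm_num
      rw [e2] at this
      nlinarith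
  · rintro (h | h | h | ⟨h0, h⟩)
    · exact D.Gab_congr h (D.pos_self i a e)
    · exact D.Gab_congr h (D.pos_edge i a e)
    · refine D.Gab_congr h (D.Gab_symm ?_)
      have := D.pos_edge i (a-1) e
      rwa [sub_add_cancel] at this
    · subst h0
      exact D.Gab_congr h (D.pos_opp a e he w hw)

lemma cls_cross (i : ℕ) (hi : i < D.m) (a b : ℤ) (e : ℝ) (he : e = 1 ∨ e = -1) (w : ℤ)
    (hw : (D.n i : ℤ) = 2 * w) :
    (D.Gab i a e i b (-e) ∧ ¬ (D.n i : ℤ) ∣ b - (a + w)) ↔ (i + 1 = D.m ∧ ((D.n i : ℤ) ∣ b - a ∨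
      (D.n i : ℤ) ∣ b - (a + 1) ∨ (D.n i : ℤ) ∣ b - (a - 1))) := by
  have n4 := D.n_ge i
  have he' : -e = 1 ∨ -e = -1 := by
    rcases he with h | h <;> rw [h] <;> norm_num
  constructor
  · rintro ⟨hg, hnd⟩
    obtain ⟨b', hb, l1, l2⟩ := reduce (D.n i) (by omega) (2 * a + 1) b
    have hg' : D.Gab i a e (i+0) b' (-e) := D.Gab_congr hb hg
    have hb2 : (D.n i : ℤ) ∣ b - b' := by rw [← dvd_neg]; simpa using hb
    have := D.neg1 i 0 hi a b' e (-e) he hg' (2 * b' + 1 - (2 * a + 1)) (by ring) l1 l2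
    rcases this with ⟨k1, k2⟩ | ⟨_, k⟩
    · refine ⟨?_, ?_⟩
      · by_contra hne
        exact D.neg2 i 0 (by omega) (by omega) a b' e (-e) he he' _ rfl (by simpa using k1)
          (by simpa using k2) (Or.inr rfl) hg'
      norm_num at k1 k2
      have : b' = a ∨ b' = a + 1 ∨ b' = a - 1 := by omega
      rcases this with h | h | h
      · left; rwa [← h]
      · right; left; rwa [← h]
      · right; right; rwa [← h]
    · exfalso
      rw [add_zero] at k
      have hb3 : b' = a + w := by omega
      exact hnd (by rwa [← hb3])
  · rintro ⟨hm, h⟩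
    constructor
    · rcases h with h | h | h
      · exact D.Gab_congr h (D.pos_cross0 i hm a e he)
      · exact D.Gab_congr h (D.pos_cross1 i hm a e he)
      · refine D.Gab_congr h (D.Gab_symm ?_)
        have := D.pos_cross1 i hm (a-1) (-e) he'
        rwa [sub_add_cancel, neg_neg] at this
    · intro h2
      have aux : ∀ y : ℤ, (D.n i : ℤ) ∣ y → -(D.n i : ℤ) < y → y < D.n i → y = 0 := by
        intro y hy h1 h2
        exact Int.eq_zero_of_abs_lt_dvd hy (by rw [abs_lt]; exact ⟨h1, h2⟩)
      rcases h with h | h | h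
      · have := aux _ (dvd_sub h h2) (by omega) (by omega); omega
      · have := aux _ (dvd_sub h h2) (by omega) (by omega); omega
      · have := aux _ (dvd_sub h h2) (by omega) (by omega); omega

lemma cls_next (i : ℕ) (hi : i + 1 < D.m) (a b : ℤ) (e f : ℝ) (he : e = 1 ∨ e = -1)
    (hf : f = 1 ∨ f = -1) :
    D.Gab i a e (i+1) b f ↔ (f = e ∧ ((D.n (i+1) : ℤ) ∣ b - (2 * a - 1) ∨
      (D.n (i+1) : ℤ) ∣ b - 2 * a ∨
      (D.n (i+1) : ℤ) ∣ b - (2 * a + 1) ∨ (D.n (i+1) : ℤ) ∣ b - (2 * a + 2))) := by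
  have n4 := D.n_ge (i+1)
  constructor
  · intro hg
    obtain ⟨b', hb, l1, l2⟩ := reduce (D.n (i+1)) (by omega) ((2 * a + 1) * 2 ^ 1) b
    have hg' : D.Gab i a e (i+1) b' f := D.Gab_congr hb hg
    have hb2 : (D.n (i+1) : ℤ) ∣ b - b' := by rw [← dvd_neg]; simpa using hb
    have := D.neg1 i 1 (by omega) a b' e f he hg' _ rfl l1 l2
    rcases this with ⟨k1, k2⟩ | ⟨k, _⟩
    · constructor
      · by_contra hne
        have hfe : f = -e := by
          rcases he with h | h <;> rcases hf with h' | h' <;>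
            first
            | exact absurd (h'.trans h.symm) hne
            | (rw [h, h']; try norm_num)
        exact D.neg2 i 1 hi hi a b' e f he hf _ rfl k1 k2 (Or.inr hfe) hg'
      norm_num at k1 k2
      have : b' = 2 * a - 1 ∨ b' = 2 * a ∨ b' = 2 * a + 1 ∨ b' = 2 * a + 2 := by omega
      rcases this with h | h | h | h <;> rw [← h] <;> tauto
    · omega
  · rintro ⟨rfl, h | h | h | h⟩
    · exact D.Gab_congr h (D.pos_next i hi a _ f hf (by simp))
    · exact D.Gab_congr h (D.pos_next i hi a _ f hf (by simp))
    · exact D.Gab_congr h (D.pos_next i hi a _ f hf (by simp))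
    · exact D.Gab_congr h (D.pos_next i hi a _ f hf (by simp))

lemma cls_far (i j : ℕ) (hij : i + 2 ≤ j) (hj : j < D.m) (a b : ℤ) (e f : ℝ)
    (he : e = 1 ∨ e = -1) (hf : f = 1 ∨ f = -1) : ¬ D.Gab i a e j b f := by
  intro hg
  obtain ⟨d, rfl⟩ := Nat.exists_eq_add_of_le (show i ≤ j by omega)
  have n4 := D.n_ge (i+d)
  obtain ⟨b', hb, l1, l2⟩ := reduce (D.n (i+d)) (by omega) ((2 * a + 1) * 2 ^ d) b
  have hg' : D.Gab i a e (i+d) b' f := D.Gab_congr hb hg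
  have := D.neg1 i d (by omega) a b' e f he hg' _ rfl l1 l2
  rcases this with ⟨k1, k2⟩ | ⟨k, _⟩
  · exact D.neg2 i d (by omega) hj a b' e f he hf _ rfl k1 k2 (Or.inl (by omega)) hg'
  · omega

end Dat
lemma cnt_zmod (n : ℕ) [NeZero n] (S : Finset ℤ) (lo : ℤ) (hS : ∀ d ∈ S, lo ≤ d ∧ d < lo + n)
    (A : ZMod n) : (Finset.univ.filter (fun B : ZMod n => ∃ d ∈ S, B = A + (d : ZMod n))).card = S.card := by
  have : Finset.univ.filter (fun B : ZMod n => ∃ d ∈ S, B = A + (d : ZMod n)) =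
      S.image (fun d : ℤ => A + (d : ZMod n)) := by
    ext B
    simp only [Finset.mem_filter, Finset.mem_univ, true_and, Finset.mem_image]
    constructor
    · rintro ⟨d, hd, rfl⟩; exact ⟨d, hd, rfl⟩
    · rintro ⟨d, hd, rfl⟩; exact ⟨d, hd, rfl⟩
  rw [this, Finset.card_image_of_injOn]
  intro d hd d' hd' h
  have h' : (d : ZMod n) = d' := add_left_cancel h
  rw [ZMod.intCast_eq_intCast_iff_dvd_sub] at h'
  have h1 := hS d hd
  have h2 := hS d' hd'
  have := Int.eq_zero_of_abs_lt_dvd h' (by rw [abs_lt]; constructor <;> omega)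
  omega

lemma zmod_dvd (n : ℕ) [NeZero n] (A B : ZMod n) (d : ℤ) :
    ((n : ℤ) ∣ (B.val : ℤ) - (A.val + d)) ↔ B = A + (d : ZMod n) := by
  rw [← ZMod.intCast_eq_intCast_iff_dvd_sub]
  simp only [Int.cast_add, Int.cast_natCast, ZMod.natCast_zmod_val]
  exact eq_comm

def sg (b : Bool) : ℝ := if b then 1 else -1

lemma sg_cases (b : Bool) : sg b = 1 ∨ sg b = -1 := by cases b <;> simp [sg]
lemma sg_not (b : Bool) : sg (!b) = - sg b := by cases b <;> simp [sg]
lemma sg_inj {b c : Bool} (h : sg b = sg c) : b = c := by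
  cases b <;> cases c <;> simp [sg] at * <;> linarith

lemma sum_band (m : ℕ) (F : ℕ → ℕ → ℕ) (hs : ∀ i j, F i j = F j i) :
    (∀ i j, i + 2 ≤ j → j < m + 1 → F i j = 0) →
    ∑ i ∈ Finset.range (m+1), ∑ j ∈ Finset.range (m+1), F i j =
      ∑ i ∈ Finset.range (m+1), F i i + 2 * ∑ i ∈ Finset.range m, F i (i+1) := by
  induction m with
  | zero => intro _; simp
  | succ m ih =>
    intro h0
    have ih' := ih (fun i j h1 h2 => h0 i j h1 (by omega))
    have e1 : ∑ i ∈ Finset.range (m+1), F i (m+1) = F m (m+1) := by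
      rw [Finset.sum_range_succ, Finset.sum_eq_zero, zero_add]
      intro i hi
      rw [Finset.mem_range] at hi
      exact h0 i (m+1) (by omega) (by omega)
    rw [Finset.sum_range_succ]
    simp_rw [Finset.sum_range_succ _ (m+1)]
    rw [Finset.sum_add_distrib, ih', e1]
    simp_rw [hs (m+1)]
    rw [e1, Finset.sum_range_succ (fun i => F i (i+1)) m]
    ring

namespace Dat
variable (D : Dat)

instance (i : ℕ) : NeZero (D.n i) := ⟨by have := D.n_ge i; omega⟩

def ip (i : ℕ) (a : ℤ) (e : ℝ) : Euc 3 := !₂[D.X 0 i a, D.Y 0 i a, e * D.z i]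

def pt (s : Σ i : ℕ, Bool × ZMod (D.n i)) : Euc 3 := D.ip s.1 (s.2.2.val : ℤ) (sg s.2.1)

lemma ip_inner (i : ℕ) (a : ℤ) (e : ℝ) (j : ℕ) (b : ℤ) (f : ℝ) (l : ℕ) (c : ℤ) (t : ℝ) :
    ⟪D.ip l c t - D.ip i a e, D.ip l c t - D.ip j b f⟫ = D.G i a e j b f l c t := by
  unfold G ip
  simp [PiLp.inner_apply, Fin.sum_univ_three]
  ring

lemma ip_norm (i : ℕ) (hi : i < D.m) (a : ℤ) (e : ℝ) (he : e = 1 ∨ e = -1) : ‖D.ip i a e‖ = 1 := by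
  have h1 := D.XY 0 i a
  have h2 := D.hrz i hi
  have e2 : e ^ 2 = 1 := by rcases he with h | h <;> rw [h] <;> norm_num
  rw [EuclideanSpace.norm_eq, Real.sqrt_eq_one]
  unfold ip
  simp [Fin.sum_univ_three]
  linear_combination h1 + h2 + (D.z i)^2 * e2

lemma ip_congr (i : ℕ) (a b : ℤ) (e : ℝ) (h : (D.n i : ℤ) ∣ b - a) : D.ip i b e = D.ip i a e := by
  obtain ⟨h1, h2⟩ := D.periodicX 0 i a b h
  unfold ip; rw [h1, h2]

lemma ip_neg (i : ℕ) (a w : ℤ) (e : ℝ) (hw : (D.n i : ℤ) = 2 * w) :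
    - D.ip i a e = D.ip i (a + w) (-e) := by
  obtain ⟨h1, h2⟩ := D.opp_XY i a w hw
  unfold ip; rw [h1, h2]
  ext q; fin_cases q <;> simp

lemma ip_eq (i j : ℕ) (hi : i < D.m) (hj : j < D.m) (a b : ℤ) (e f : ℝ) (he : e = 1 ∨ e = -1)
    (hf : f = 1 ∨ f = -1) (h : D.ip i a e = D.ip j b f) : i = j ∧ e = f ∧ (D.n i : ℤ) ∣ b - a := by
  have h0 : D.X 0 i a = D.X 0 j b := by simpa [ip] using congrArg (fun v : Euc 3 => v 0) h
  have h1 : D.Y 0 i a = D.Y 0 j b := by simpa [ip] using congrArg (fun v : Euc 3 => v 1) h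
  have h2 : e * D.z i = f * D.z j := by simpa [ip] using congrArg (fun v : Euc 3 => v 2) h
  have z1 := D.hz i hi
  have z2 := D.hz j hj
  have hef : e = f := by
    rcases he with h | h <;> rcases hf with h' | h' <;> rw [h, h'] at h2 ⊢ <;> linarith
  have hr : D.r i = D.r j := by
    have := D.XY 0 i a
    have h4 := D.XY 0 j b
    rw [← h0, ← h1, this] at h4
    have := D.r_pos i
    have := D.r_pos j
    nlinarith
  have hij := D.r_strictMono.injective hr
  refine ⟨hij, hef, ?_⟩
  subst hij
  by_contra hn
  have := D.chord 0 i a b hn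
  rw [h0, h1] at this
  have := D.hs
  nlinarith

lemma exists_half (i : ℕ) : ∃ w : ℤ, (D.n i : ℤ) = 2 * w := by
  obtain ⟨w, hw⟩ := D.n_even i
  exact ⟨w, by rw [hw]; push_cast; ring⟩

def I : Finset (Σ i : ℕ, Bool × ZMod (D.n i)) := (Finset.range D.m).sigma (fun _ => Finset.univ)

def V : Finset (Euc 3) := D.I.image D.pt

lemma mem_I (s) : s ∈ D.I ↔ s.1 < D.m := by simp [I]

lemma pt_inj : Set.InjOn D.pt D.I := by
  rintro ⟨i, e, A⟩ hi ⟨j, f, B⟩ hj h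
  rw [Finset.mem_coe, mem_I] at hi hj
  obtain ⟨h1, h2, h3⟩ := D.ip_eq i j hi hj _ _ _ _ (sg_cases e) (sg_cases f) h
  subst h1
  have h2 := sg_inj h2
  subst h2
  have := (zmod_dvd (D.n i) A B 0).1 (by simpa using h3)
  simp at this
  rw [this]

lemma ip_mem (i : ℕ) (hi : i < D.m) (a : ℤ) (e : ℝ) (he : e = 1 ∨ e = -1) : D.ip i a e ∈ D.V := by
  have hb : ∃ b : Bool, sg b = e := by
    rcases he with h | h
    · exact ⟨true, by simp [sg, h]⟩
    · exact ⟨false, by simp [sg, h]⟩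
  obtain ⟨b, hb⟩ := hb
  refine Finset.mem_image.2 ⟨⟨i, b, (a : ZMod (D.n i))⟩, (D.mem_I _).2 hi, ?_⟩
  unfold pt
  simp only
  rw [hb]
  apply D.ip_congr
  rw [← ZMod.intCast_eq_intCast_iff_dvd_sub]
  simp

lemma mem_V (v : Euc 3) : v ∈ D.V ↔ ∃ i < D.m, ∃ a : ℤ, ∃ e : ℝ, (e = 1 ∨ e = -1) ∧ v = D.ip i a e := by
  constructor
  · intro h
    obtain ⟨s, hs, rfl⟩ := Finset.mem_image.1 h
    exact ⟨s.1, (D.mem_I s).1 hs, _, _, sg_cases _, rfl⟩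
  · rintro ⟨i, hi, a, e, he, rfl⟩
    exact D.ip_mem i hi a e he

lemma V_norm (v : Euc 3) (hv : v ∈ D.V) : ‖v‖ = 1 := by
  obtain ⟨i, hi, a, e, he, rfl⟩ := (D.mem_V v).1 hv
  exact D.ip_norm i hi a e he

lemma V_neg (v : Euc 3) (hv : v ∈ D.V) : -v ∈ D.V := by
  obtain ⟨i, hi, a, e, he, rfl⟩ := (D.mem_V v).1 hv
  obtain ⟨w, hw⟩ := D.exists_half i
  rw [D.ip_neg i a w e hw]
  apply D.ip_mem i hi
  rcases he with h | h <;> rw [h] <;> norm_num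

lemma V_card : D.V.card = 2 * (2 ^ D.m - 1) * D.k := by
  unfold V
  rw [Finset.card_image_of_injOn D.pt_inj]
  unfold I
  rw [Finset.card_sigma]
  simp only [Finset.card_univ, Fintype.card_prod, Fintype.card_bool, ZMod.card]
  rw [← Finset.mul_sum, mul_assoc]
  congr 1
  unfold n
  rw [← Finset.sum_mul]
  congr 1
  have := Nat.geomSum_eq (le_refl 2) D.m
  simpa using this

def R (s t : Σ i : ℕ, Bool × ZMod (D.n i)) : Prop :=
  D.Gab s.1 (s.2.2.val : ℤ) (sg s.2.1) t.1 (t.2.2.val : ℤ) (sg t.2.1) ∧ D.pt s ≠ - D.pt t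

lemma R_symm (s t) : D.R s t ↔ D.R t s := by
  unfold R
  constructor
  · rintro ⟨h1, h2⟩
    exact ⟨D.Gab_symm h1, fun h => h2 (by rw [h, neg_neg])⟩
  · rintro ⟨h1, h2⟩
    exact ⟨D.Gab_symm h1, fun h => h2 (by rw [h, neg_neg])⟩

lemma inner_unit (v p q : Euc 3) (hv : ‖v‖ = 1) (hp : ‖p‖ = 1) :
    ⟪v - p, -q - p⟫ = ⟪v - p, v - q⟫ := by
  have h1 : ⟪v, v⟫ = (1:ℝ) := by rw [real_inner_self_eq_norm_sq, hv]; norm_num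
  have h2 : ⟪p, p⟫ = (1:ℝ) := by rw [real_inner_self_eq_norm_sq, hp]; norm_num
  simp only [inner_sub_left, inner_sub_right, inner_neg_right]
  rw [h1, h2, real_inner_comm p v]
  ring

lemma DN_iff (s t) (hs : s ∈ D.I) (ht : t ∈ D.I) : IsDNPair D.V (D.pt s) (-(D.pt t)) ↔ D.R s t := by
  have ms : D.pt s ∈ D.V := Finset.mem_image_of_mem _ hs
  have mt : D.pt t ∈ D.V := Finset.mem_image_of_mem _ ht
  unfold IsDNPair R
  constructor
  · rintro ⟨_, _, h1, h2⟩
    refine ⟨?_, h1⟩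
    intro l hl c u hu
    have := (h2 _ (D.ip_mem l hl c u hu)).1
    rw [inner_unit _ _ _ (D.ip_norm l hl c u hu) (D.V_norm _ ms)] at this
    rw [← ip_inner]; exact this
  · rintro ⟨hg, hne⟩
    refine ⟨ms, D.V_neg _ mt, hne, ?_⟩
    have key : ∀ v ∈ D.V, 0 ≤ ⟪v - D.pt s, v - D.pt t⟫ := by
      intro v hv
      obtain ⟨l, hl, c, u, hu, rfl⟩ := (D.mem_V v).1 hv
      have := hg l hl c u hu
      rw [← ip_inner] at this; exact this
    intro v hv
    constructor
    · rw [inner_unit _ _ _ (D.V_norm v hv) (D.V_norm _ ms)]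
      exact key v hv
    · have h1 := key (-v) (D.V_neg v hv)
      rw [real_inner_comm, ← inner_unit _ _ _ (D.V_norm _ (D.V_neg v hv)) (D.V_norm _ mt)] at h1
      have : ⟪v - -D.pt t, D.pt s - -D.pt t⟫ = ⟪-v - D.pt t, -D.pt s - D.pt t⟫ := by
        rw [← inner_neg_neg]; congr 1 <;> abel
      rw [this]; exact h1

def F (i j : ℕ) : ℕ := ∑ p : Bool × ZMod (D.n i), ∑ q : Bool × ZMod (D.n j),
  if D.R ⟨i, p⟩ ⟨j, q⟩ then 1 else 0

lemma card_DN : ((D.V ×ˢ D.V).filter fun pq => IsDNPair D.V pq.1 pq.2).card =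
    ∑ i ∈ Finset.range D.m, ∑ j ∈ Finset.range D.m, D.F i j := by
  rw [Finset.card_filter, Finset.sum_product]
  have e1 : ∀ p, ∑ q ∈ D.V, (if IsDNPair D.V p q then 1 else 0) =
      ∑ q ∈ D.V, (if IsDNPair D.V p (-q) then 1 else 0) := by
    intro p
    apply Finset.sum_nbij' (fun q => -q) (fun q => -q)
    · exact fun q hq => D.V_neg q hq
    · exact fun q hq => D.V_neg q hq
    · simp
    · simp
    · simp
  simp only [e1]
  rw [V, Finset.sum_image D.pt_inj]
  have e2 : ∀ s ∈ D.I, ∑ q ∈ D.I.image D.pt,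
      (if IsDNPair (D.I.image D.pt) (D.pt s) (-q) then 1 else 0) =
      ∑ t ∈ D.I, if D.R s t then 1 else 0 := by
    intro s hs
    rw [Finset.sum_image D.pt_inj]
    apply Finset.sum_congr rfl
    intro t ht
    have := D.DN_iff s t hs ht
    unfold V at this
    simp only [this]
  rw [Finset.sum_congr rfl e2]
  unfold I
  rw [Finset.sum_sigma]
  apply Finset.sum_congr rfl
  intro i _
  simp_rw [Finset.sum_sigma]
  rw [Finset.sum_comm]
  rfl

lemma F_symm (i j : ℕ) : D.F i j = D.F j i := by
  unfold F
  rw [Finset.sum_comm]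
  simp only [D.R_symm ⟨i, _⟩ ⟨j, _⟩]

lemma F_far (i j : ℕ) (hij : i + 2 ≤ j) (hj : j < D.m) : D.F i j = 0 := by
  unfold F
  apply Finset.sum_eq_zero; intro p _
  apply Finset.sum_eq_zero; intro q _
  rw [if_neg]
  rintro ⟨h, _⟩
  exact D.cls_far i j hij hj _ _ _ _ (sg_cases _) (sg_cases _) h

lemma pt_ne_neg (i j : ℕ) (hi : i < D.m) (hj : j < D.m) (p : Bool × ZMod (D.n i))
    (q : Bool × ZMod (D.n j)) (h : D.pt ⟨i, p⟩ = - D.pt ⟨j, q⟩) : i = j ∧ sg p.1 = - sg q.1 := by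
  obtain ⟨w, hw⟩ := D.exists_half j
  unfold pt at h
  simp only at h
  rw [D.ip_neg _ _ w _ hw] at h
  have := D.ip_eq i j hi hj _ _ _ _ (sg_cases _) (by rw [← sg_not]; exact sg_cases _) h
  exact ⟨this.1, this.2.1⟩

lemma pt_eq_neg (i : ℕ) (hi : i < D.m) (w : ℤ) (hw : (D.n i : ℤ) = 2 * w) (e : Bool)
    (A B : ZMod (D.n i)) : D.pt ⟨i, e, A⟩ = - D.pt ⟨i, !e, B⟩ ↔ (D.n i : ℤ) ∣ (B.val : ℤ) - (A.val + w) := by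
  unfold pt
  simp only
  rw [D.ip_neg _ _ w _ hw, sg_not, neg_neg]
  have hiff : (D.n i : ℤ) ∣ (B.val : ℤ) - (A.val + w) ↔ (D.n i : ℤ) ∣ ((B.val : ℤ) + w) - A.val := by
    have : ((B.val : ℤ) + w) - A.val = ((B.val : ℤ) - (A.val + w)) + D.n i := by rw [hw]; ring
    rw [this]; simp
  rw [hiff]
  constructor
  · intro h
    exact (D.ip_eq i i hi hi _ _ _ _ (sg_cases _) (sg_cases _) h).2.2
  · intro h
    exact (D.ip_congr _ _ _ _ h).symm

lemma row_self (i : ℕ) (hi : i < D.m) (e : Bool) (A : ZMod (D.n i)) :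
    ∑ B : ZMod (D.n i), (if D.R ⟨i, e, A⟩ ⟨i, e, B⟩ then 1 else 0) = 3 + if i = 0 then 1 else 0 := by
  obtain ⟨w, hw⟩ := D.exists_half i
  have n4 := D.n_ge i
  have hR : ∀ B, D.R ⟨i, e, A⟩ ⟨i, e, B⟩ ↔
      ∃ d ∈ (if i = 0 then ({-1, 0, 1, w} : Finset ℤ) else {-1, 0, 1}), B = A + (d : ZMod (D.n i)) := by
    intro B
    have h0 : D.pt ⟨i, e, A⟩ ≠ - D.pt ⟨i, e, B⟩ := by
      intro h
      have := (D.pt_ne_neg i i hi hi _ _ h).2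
      rcases sg_cases e with h | h <;> simp only [h] at this <;> linarith
    unfold R
    simp only [h0, ne_eq, not_false_eq_true, and_true]
    rw [D.cls_same i hi _ _ _ (sg_cases e) w hw]
    have t0 := zmod_dvd (D.n i) A B 0
    rw [add_zero] at t0
    rw [t0, zmod_dvd, zmod_dvd, sub_eq_add_neg (A.val : ℤ) 1, zmod_dvd]
    split_ifs with h
    · simp [h]; tauto
    · simp [h]; tauto
  simp only [hR]
  rw [← Finset.card_filter, cnt_zmod (D.n i) _ (-1)]
  · split_ifs with h
    · rw [Finset.card_insert_of_notMem, Finset.card_insert_of_notMem, Finset.card_insert_of_notMem,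
        Finset.card_singleton]
      all_goals simp
      all_goals omega
    · rfl
  · intro d hd
    split_ifs at hd with h
    · simp at hd; omega
    · simp at hd; omega

lemma row_cross (i : ℕ) (hi : i < D.m) (e : Bool) (A : ZMod (D.n i)) :
    ∑ B : ZMod (D.n i), (if D.R ⟨i, e, A⟩ ⟨i, !e, B⟩ then 1 else 0) = if i + 1 = D.m then 3 else 0 := by
  obtain ⟨w, hw⟩ := D.exists_half i
  have n4 := D.n_ge i
  have hR : ∀ B, D.R ⟨i, e, A⟩ ⟨i, !e, B⟩ ↔
      ∃ d ∈ (if i + 1 = D.m then ({-1, 0, 1} : Finset ℤ) else ∅), B = A + (d : ZMod (D.n i)) := by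
    intro B
    unfold R
    rw [ne_eq, D.pt_eq_neg i hi w hw]
    simp only [sg_not]
    rw [D.cls_cross i hi _ _ _ (sg_cases e) w hw]
    have t0 := zmod_dvd (D.n i) A B 0
    rw [add_zero] at t0
    rw [t0, zmod_dvd, sub_eq_add_neg (A.val : ℤ) 1, zmod_dvd]
    split_ifs with h
    · simp [h]; tauto
    · simp [h]
  simp only [hR]
  rw [← Finset.card_filter, cnt_zmod (D.n i) _ (-1)]
  · split_ifs with h <;> rfl
  · intro d hd
    split_ifs at hd with h
    · simp at hd; omega
    · simp at hd

lemma row_next (i : ℕ) (hi : i + 1 < D.m) (e : Bool) (A : ZMod (D.n i)) :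
    ∑ B : ZMod (D.n (i+1)), (if D.R ⟨i, e, A⟩ ⟨i+1, e, B⟩ then 1 else 0) = 4 := by
  have n4 := D.n_ge i
  have n5 := D.n_succ i
  have hR : ∀ B, D.R ⟨i, e, A⟩ ⟨i+1, e, B⟩ ↔
      ∃ d ∈ ({-1, 0, 1, 2} : Finset ℤ), B = ((2 * A.val : ℤ) : ZMod (D.n (i+1))) + (d : ZMod (D.n (i+1))) := by
    intro B
    have h0 : D.pt ⟨i, e, A⟩ ≠ - D.pt ⟨i+1, e, B⟩ := by
      intro h
      have := (D.pt_ne_neg i (i+1) (by omega) hi _ _ h).1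
      omega
    unfold R
    simp only [h0, ne_eq, not_false_eq_true, and_true]
    rw [D.cls_next i hi _ _ _ _ (sg_cases e) (sg_cases e)]
    have aux : ∀ y : ℤ, ((D.n (i+1) : ℤ) ∣ (B.val : ℤ) - y) ↔ B = (y : ZMod (D.n (i+1))) := by
      intro y
      rw [← ZMod.intCast_eq_intCast_iff_dvd_sub]
      simp only [Int.cast_natCast, ZMod.natCast_zmod_val]
      exact eq_comm
    simp only [aux]
    simp [sub_eq_add_neg]
  simp only [hR]
  rw [← Finset.card_filter, cnt_zmod (D.n (i+1)) _ (-1)]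
  · rfl
  · intro d hd
    simp at hd; omega

lemma row_next' (i : ℕ) (hi : i + 1 < D.m) (e : Bool) (A : ZMod (D.n i)) :
    ∑ B : ZMod (D.n (i+1)), (if D.R ⟨i, e, A⟩ ⟨i+1, !e, B⟩ then 1 else 0) = 0 := by
  apply Finset.sum_eq_zero
  intro B _
  rw [if_neg]
  rintro ⟨h, _⟩
  rw [D.cls_next i hi _ _ _ _ (sg_cases _) (sg_cases _)] at h
  have := sg_inj h.1
  simp at this

lemma F_self (i : ℕ) (hi : i < D.m) : D.F i i = 2 * D.n i *
    ((3 + if i = 0 then 1 else 0) + if i + 1 = D.m then 3 else 0) := by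
  unfold F
  have : ∀ p : Bool × ZMod (D.n i), ∑ q : Bool × ZMod (D.n i), (if D.R ⟨i, p⟩ ⟨i, q⟩ then 1 else 0) =
     ((3 + if i = 0 then 1 else 0) + if i + 1 = D.m then 3 else 0) := by
    rintro ⟨e, A⟩
    rw [Fintype.sum_prod_type, Fintype.sum_bool]
    have h1 := D.row_self i hi e A
    have h2 := D.row_cross i hi e A
    cases e
    · simp only [Bool.not_false] at h2; rw [h1, h2, add_comm]
    · simp only [Bool.not_true] at h2; rw [h1, h2]
  simp only [this]
  rw [Finset.sum_const, Finset.card_univ, Fintype.card_prod, Fintype.card_bool, ZMod.card, smul_eq_mul]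

lemma F_next (i : ℕ) (hi : i + 1 < D.m) : D.F i (i+1) = 2 * D.n i * 4 := by
  unfold F
  have : ∀ p : Bool × ZMod (D.n i), ∑ q : Bool × ZMod (D.n (i+1)),
      (if D.R ⟨i, p⟩ ⟨i+1, q⟩ then 1 else 0) = 4 := by
    rintro ⟨e, A⟩
    rw [Fintype.sum_prod_type, Fintype.sum_bool]
    have h1 := D.row_next i hi e A
    have h2 := D.row_next' i hi e A
    cases e
    · simp only [Bool.not_false] at h2; rw [h1, h2]
    · simp only [Bool.not_true] at h2; rw [h1, h2]
  simp only [this]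
  rw [Finset.sum_const, Finset.card_univ, Fintype.card_prod, Fintype.card_bool, ZMod.card, smul_eq_mul]

lemma sum_n (M : ℕ) : ∑ i ∈ Finset.range M, D.n i + D.k = 2 ^ M * D.k := by
  unfold n
  induction M with
  | zero => simp
  | succ M ih => rw [Finset.sum_range_succ, add_right_comm, ih, pow_succ]; ring

lemma total (M : ℕ) (hM : D.m = M + 1) :
    ((D.V ×ˢ D.V).filter fun pq => IsDNPair D.V pq.1 pq.2).card + 20 * D.k = 34 * 2 ^ M * D.k := by
  rw [card_DN, hM, sum_band M D.F D.F_symm (fun i j h1 h2 => D.F_far i j h1 (by omega))]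
  have e1 : ∑ i ∈ Finset.range (M+1), D.F i i =
      6 * ∑ i ∈ Finset.range (M+1), D.n i + 2 * D.n 0 + 6 * D.n M := by
    have : ∀ i ∈ Finset.range (M+1), D.F i i = 6 * D.n i + (if i = 0 then 2 * D.n i else 0)
        + (if i = M then 6 * D.n i else 0) := by
      intro i hi
      rw [Finset.mem_range] at hi
      rw [D.F_self i (by omega), hM]
      simp only [Nat.add_right_cancel_iff]
      split_ifs <;> ring
    rw [Finset.sum_congr rfl this, Finset.sum_add_distrib, Finset.sum_add_distrib, ← Finset.mul_sum,
      Finset.sum_ite_eq', Finset.sum_ite_eq']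
    simp
  have e2 : ∑ i ∈ Finset.range M, D.F i (i+1) = 8 * ∑ i ∈ Finset.range M, D.n i := by
    rw [Finset.mul_sum]
    apply Finset.sum_congr rfl
    intro i hi
    rw [Finset.mem_range] at hi
    rw [D.F_next i (by omega)]; ring
  have s1 := D.sum_n (M+1)
  have s2 := D.sum_n M
  have n0 : D.n 0 = D.k := by simp [n]
  have nM : D.n M = 2 ^ M * D.k := rfl
  rw [e1, e2, n0, nM]
  rw [pow_succ] at s1
  nlinarith

end Dat

lemma exists_dat (k m : ℕ) (hk : 4 ≤ k) (hke : Even k) (hm : 1 ≤ m) : ∃ D : Dat, D.k = k ∧ D.m = m := by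
  have hsin : ∀ i : ℕ, 0 < Real.sin (Real.pi / ((2 ^ i * k : ℕ) : ℝ)) := by
    intro i
    have h1 : 4 ≤ 2 ^ i * k := by nlinarith [Nat.one_le_two_pow (n := i)]
    have h2 : (4:ℝ) ≤ ((2 ^ i * k : ℕ) : ℝ) := by exact_mod_cast h1
    apply Real.sin_pos_of_pos_of_lt_pi
    · have := Real.pi_pos; positivity
    · apply div_lt_self Real.pi_pos; linarith
  have hmono : ∀ i < m, Real.sin (Real.pi / ((2 ^ (m-1) * k : ℕ) : ℝ)) ≤
      Real.sin (Real.pi / ((2 ^ i * k : ℕ) : ℝ)) := by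
    intro i hi
    have h1 : 4 ≤ 2 ^ i * k := by nlinarith [Nat.one_le_two_pow (n := i)]
    have h2 : (4:ℝ) ≤ ((2 ^ i * k : ℕ) : ℝ) := by exact_mod_cast h1
    have h3 : 2 ^ i * k ≤ 2 ^ (m-1) * k :=
      Nat.mul_le_mul_right _ (Nat.pow_le_pow_right (by norm_num) (by omega))
    have h4 : ((2 ^ i * k : ℕ) : ℝ) ≤ ((2 ^ (m-1) * k : ℕ) : ℝ) := by exact_mod_cast h3
    have hp := Real.pi_pos
    apply Real.sin_le_sin_of_le_of_le_pi_div_two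
    · have : 0 ≤ Real.pi / ((2 ^ (m-1) * k : ℕ) : ℝ) := by positivity
      linarith
    · apply div_le_div_of_nonneg_left hp.le (by norm_num) (by linarith)
    · apply div_le_div_of_nonneg_left hp.le (by linarith) h4
  set σ : ℝ := Real.sin (Real.pi / ((2 ^ (m-1) * k : ℕ) : ℝ)) / 2 with hσ
  have hσ0 : 0 < σ := by have := hsin (m-1); positivity
  have hr : ∀ i < m, (σ / Real.sin (Real.pi / ((2 ^ i * k : ℕ) : ℝ))) ^ 2 < 1 := by
    intro i hi
    have h1 := hsin i
    have h2 := hmono i hi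
    have h3 : σ / Real.sin (Real.pi / ((2 ^ i * k : ℕ) : ℝ)) ≤ 1 / 2 := by
      rw [div_le_iff₀ h1]; linarith
    have h4 : 0 < σ / Real.sin (Real.pi / ((2 ^ i * k : ℕ) : ℝ)) := by positivity
    nlinarith
  refine ⟨⟨k, m, hk, hke, hm, fun i => σ / Real.sin (Real.pi / ((2 ^ i * k : ℕ) : ℝ)),
    fun i => σ / Real.sin (Real.pi / ((2 ^ i * k : ℕ) : ℝ)) * Real.cos (Real.pi / ((2 ^ i * k : ℕ) : ℝ)),
    fun i => √(1 - (σ / Real.sin (Real.pi / ((2 ^ i * k : ℕ) : ℝ))) ^ 2), σ, hσ0, ?_, ?_, ?_, ?_⟩, rfl, rfl⟩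
  · intro i
    exact div_mul_cancel₀ _ (hsin i).ne'
  · intro i; rfl
  · intro i hi
    exact Real.sqrt_pos.2 (by linarith [hr i hi])
  · intro i hi
    rw [Real.sq_sqrt (by linarith [hr i hi])]
    ring

/-- For every even `k ≥ 4` and every `m ≥ 1` there is a set `V` of `2(2^m - 1)k` points on
the unit sphere with `N(V) = (17/4)|V| - (3/2)k`. -/
theorem doubleNormal_sphere_construction (k m : ℕ) (hk : 4 ≤ k) (hke : Even k)
    (hm : 1 ≤ m) :
    ∃ V : Finset (Euc 3), (∀ v ∈ V, ‖v‖ = 1) ∧ V.card = 2 * (2 ^ m - 1) * k ∧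
      (numDN V : ℝ) = 17 / 4 * V.card - 3 / 2 * k := by
  obtain ⟨D, hDk, hDm⟩ := exists_dat k m hk hke hm
  obtain ⟨M, hM⟩ : ∃ M, m = M + 1 := ⟨m - 1, by omega⟩
  have hc := D.V_card
  have ht := D.total M (by omega)
  refine ⟨D.V, D.V_norm, by rw [hc, hDk, hDm], ?_⟩
  have hN : numDN D.V + 10 * k = 17 * 2 ^ M * k := by
    unfold numDN
    rw [hDk, mul_assoc] at ht
    rw [mul_assoc]
    omega
  have hN' : (numDN D.V : ℝ) + 10 * k = 17 * 2 ^ M * k := by exact_mod_cast hN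
  have hc' : (D.V.card : ℝ) = 2 * (2 * 2 ^ M - 1) * k := by
    rw [hc, hDk, hDm, hM, pow_succ]
    have : 1 ≤ 2 ^ M * 2 := by nlinarith [Nat.one_le_two_pow (n := M)]
    push_cast [Nat.cast_sub this]
    ring
  rw [hc']
  linarith
end
end
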